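/- arXiv:2209.04003 — 2 statements merged into one kernel-verified Lean document; each statement's English description precedes it below -/
import Mathlib

section
/- Let N_1 ≥ N_2 ≥ ⋯ ≥ N_m (m ≥ 3) and let r ≤ r_m, where r_m is defined by the recursion: r_3 := Ñ_{m−2}·⌊Ñ_{m−1}Ñ_m/(Ñ_{m−2}+Ñ_{m−1}+Ñ_m−2)⌋ with Ñ_{m−2}, Ñ_{m−1}, Ñ_m the largest integers such that Ñ_{m−2} is even, Ñ_{m−2} ≥ Ñ_{m−1} ≥ Ñ_m, and N_i ≥ Ñ_i for i = m−2, m−1, m; and r_k := N_{m−k+1}·min{ r_{k−1}, ⌊N_{m−k+2}⋯N_m/(N_{m−k+1}+⋯+N_m−k+1)⌋ } for k = 4,…,m. For Θ̃* = (U_1*, Ũ_2*, …, Ũ_m*) with U_1* ∈ ℝ^{N_1×r} and Ũ_i* ∈ ℝ^{(N_i−1)×r} (2 ≤ i ≤ m), set A := [[U_1*, [1ᵀ;Ũ_2*], …, [1ᵀ;Ũ_m*]]] and define f̃(Θ̃) := ‖A − [[U_1, [1ᵀ;Ũ_2], …, [1ᵀ;Ũ_m]]]‖_F². Then for generic Θ̃*,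 the Hessian matrix ∇²f̃(Θ̃*) is positive definite; that is, the set of Θ̃* for which ∇²f̃(Θ̃*) fails to be positive definite is contained in the zero set of some nonzero polynomial in the entries of Θ̃*. -/
noncomputable section

/-- Index set of the free entries of the normalized CP parameters
`Θ̃ = (U₁, Ũ₂, …, Ũ_m)`: all entries of the factor matrices except the (fixed) first rows of
the factors `2,…,m`.  Here `N i` is the number of rows of the `i`-th factor (0-indexed)
and `r` the CP rank. -/
abbrev FreeIdx (m r : ℕ) (N : Fin m → ℕ) : Type :=
  {p : Σ i : Fin m, Fin (N i) × Fin r // (p.1 : ℕ) = 0 ∨ ((p.2.1 : ℕ) ≠ 0)}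

/-- Embed the normalized parameters into full factor matrices, filling the first rows of the
factors `2,…,m` with the prescribed values `u`. -/
def embTheta {m r : ℕ} {N : Fin m → ℕ} (u : Fin m → Fin r → ℝ)
    (x : FreeIdx m r N → ℝ) : (i : Fin m) → Fin (N i) → Fin r → ℝ :=
  fun i j c => if h : (i : ℕ) = 0 ∨ ((j : ℕ) ≠ 0) then x ⟨⟨i, (j, c)⟩, h⟩ else u i c

/-- Entry `(i₁,…,i_m)` of the CP tensor `[[W₁,…,W_m]]`, namely `∑_{c=1}^r ∏_k W_k(i_k,c)`. -/
def cpEntry {m r : ℕ} {N : Fin m → ℕ} (W : (i : Fin m) → Fin (N i) → Fin r → ℝ)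
    (idx : (i : Fin m) → Fin (N i)) : ℝ :=
  ∑ c : Fin r, ∏ i : Fin m, W i (idx i) c

/-- Largest even integer `≤ a`. -/
def evenTrunc (a : ℕ) : ℕ := if a % 2 = 0 then a else a - 1

/-- `r₃ = Ñ_{m−2}·⌊Ñ_{m−1}Ñ_m/(Ñ_{m−2}+Ñ_{m−1}+Ñ_m−2)⌋` where `Ñ_{m−2}, Ñ_{m−1}, Ñ_m` are the
largest integers with `Ñ_{m−2}` even, `Ñ_{m−2} ≥ Ñ_{m−1} ≥ Ñ_m` and `N_i ≥ Ñ_i`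
(`a = N_{m−2}`, `b = N_{m−1}`, `c = N_m`, assumed `a ≥ b ≥ c`). -/
def rankBound3 (a b c : ℕ) : ℕ :=
  let t1 := evenTrunc a
  let t2 := min b t1
  let t3 := min c t2
  t1 * (t2 * t3 / (t1 + t2 + t3 - 2))

/-- The recursive rank bound `r_k` of the paper, for a `1`-indexed dimension list
`N 1 ≥ N 2 ≥ ⋯ ≥ N m`:  `r₃` as above and
`r_k = N_{m−k+1}·min{ r_{k−1}, ⌊N_{m−k+2}⋯N_m/(N_{m−k+1}+⋯+N_m−k+1)⌋ }` for `4 ≤ k ≤ m`. -/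
def rankBound (N : ℕ → ℕ) (m : ℕ) : ℕ → ℕ
  | 0 => 0
  | 1 => 0
  | 2 => 0
  | 3 => rankBound3 (N (m - 2)) (N (m - 1)) (N m)
  | (k + 4) =>
      N (m - (k + 4) + 1) *
        min (rankBound N m (k + 3))
          ((∏ i ∈ Finset.Icc (m - (k + 4) + 2) m, N i) /
            ((∑ i ∈ Finset.Icc (m - (k + 4) + 1) m, N i) - (k + 4) + 1))

namespace CPH

/-- polynomial functions on a real vector space -/
def PolyFn (E : Type*) [AddCommGroup E] [Module ℝ E] : Subalgebra ℝ (E → ℝ) :=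
  Algebra.adjoin ℝ (Set.range (fun l : E →ₗ[ℝ] ℝ => (l : E → ℝ)))

section poly
variable {E F : Type*} [AddCommGroup E] [Module ℝ E] [AddCommGroup F] [Module ℝ F]

lemma poly_lin (l : E →ₗ[ℝ] ℝ) : (fun x => l x) ∈ PolyFn E :=
  Algebra.subset_adjoin ⟨l, rfl⟩

lemma poly_const (a : ℝ) : (fun _ : E => a) ∈ PolyFn E :=
  (PolyFn E).algebraMap_mem a

lemma poly_add {f g : E → ℝ} (hf : f ∈ PolyFn E) (hg : g ∈ PolyFn E) :
    (fun x => f x + g x) ∈ PolyFn E := (PolyFn E).add_mem hf hg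

lemma poly_sub {f g : E → ℝ} (hf : f ∈ PolyFn E) (hg : g ∈ PolyFn E) :
    (fun x => f x - g x) ∈ PolyFn E := (PolyFn E).sub_mem hf hg

lemma poly_mul {f g : E → ℝ} (hf : f ∈ PolyFn E) (hg : g ∈ PolyFn E) :
    (fun x => f x * g x) ∈ PolyFn E := (PolyFn E).mul_mem hf hg

lemma poly_sum {ι : Type*} (s : Finset ι) {f : ι → E → ℝ} (hf : ∀ i, f i ∈ PolyFn E) :
    (fun x => ∑ i ∈ s, f i x) ∈ PolyFn E := by
  have := (PolyFn E).sum_mem (t := s) (f := f) (fun i _ => hf i)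
  convert this using 1
  ext x; simp

lemma poly_prod {ι : Type*} (s : Finset ι) {f : ι → E → ℝ} (hf : ∀ i, f i ∈ PolyFn E) :
    (fun x => ∏ i ∈ s, f i x) ∈ PolyFn E := by
  have := (PolyFn E).prod_mem (t := s) (f := f) (fun i _ => hf i)
  convert this using 1
  ext x; simp

lemma poly_comp (L : E →ₗ[ℝ] F) {f : F → ℝ} (hf : f ∈ PolyFn F) :
    (fun x => f (L x)) ∈ PolyFn E := by
  induction hf using Algebra.adjoin_induction with
  | mem f hf => obtain ⟨l, rfl⟩ := hf; exact poly_lin (l ∘ₗ L)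
  | algebraMap a => exact poly_const a
  | add f g _ _ hf hg => exact poly_add hf hg
  | mul f g _ _ hf hg => exact poly_mul hf hg

lemma poly_line {f : E → ℝ} (hf : f ∈ PolyFn E) (a b : E) :
    ∃ p : Polynomial ℝ, ∀ t : ℝ, f (a + t • b) = p.eval t := by
  induction hf using Algebra.adjoin_induction with
  | mem f hf =>
    obtain ⟨l, rfl⟩ := hf
    exact ⟨Polynomial.C (l a) + Polynomial.X * Polynomial.C (l b), fun t => by simp; ring⟩
  | algebraMap c => exact ⟨Polynomial.C c, fun t => by simp⟩
  | add f g _ _ hf hg =>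
    obtain ⟨p, hp⟩ := hf
    obtain ⟨q, hq⟩ := hg
    exact ⟨p + q, fun t => by simp [hp, hq]⟩
  | mul f g _ _ hf hg =>
    obtain ⟨p, hp⟩ := hf
    obtain ⟨q, hq⟩ := hg
    exact ⟨p * q, fun t => by simp [hp, hq]⟩

lemma poly_common {f g : E → ℝ} (hf : f ∈ PolyFn E) (hg : g ∈ PolyFn E) {a b : E}
    (ha : f a ≠ 0) (hb : g b ≠ 0) : ∃ c, f c ≠ 0 ∧ g c ≠ 0 := by
  obtain ⟨p, hp⟩ := poly_line hf a (b - a)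
  obtain ⟨q, hq⟩ := poly_line hg a (b - a)
  have hp0 : p ≠ 0 := by
    rintro rfl
    apply ha
    simpa using hp 0
  have hq0 : q ≠ 0 := by
    rintro rfl
    apply hb
    simpa using hq 1
  obtain ⟨t, ht⟩ : ∃ t, t ∉ (p * q).roots.toFinset := Infinite.exists_notMem_finset _
  refine ⟨a + t • (b - a), ?_⟩
  rw [hp, hq]
  have : (p * q).eval t ≠ 0 := by
    intro h
    apply ht
    simp [hp0, hq0] at h ⊢
    exact h
  simpa [not_or] using this

/-- `S` holds outside the zero set of a nonzero polynomial function -/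
def Gen (S : E → Prop) : Prop :=
  ∃ f ∈ PolyFn E, (∃ x, f x ≠ 0) ∧ ∀ x, f x ≠ 0 → S x

lemma Gen.ex {S : E → Prop} (h : Gen S) : ∃ x, S x := by
  obtain ⟨f, _, ⟨x, hx⟩, h⟩ := h
  exact ⟨x, h x hx⟩

lemma Gen.mono {S T : E → Prop} (h : Gen S) (hST : ∀ x, S x → T x) : Gen T := by
  obtain ⟨f, hf, hx, h⟩ := h
  exact ⟨f, hf, hx, fun x hx => hST x (h x hx)⟩

lemma Gen.triv : Gen (fun _ : E => True) :=
  ⟨_, poly_const 1, ⟨0, one_ne_zero⟩, fun _ _ => trivial⟩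

lemma Gen.and {S T : E → Prop} (hS : Gen S) (hT : Gen T) : Gen (fun x => S x ∧ T x) := by
  obtain ⟨f, hf, ⟨x, hx⟩, h⟩ := hS
  obtain ⟨g, hg, ⟨y, hy⟩, h'⟩ := hT
  obtain ⟨c, hc⟩ := poly_common hf hg hx hy
  refine ⟨_, poly_mul hf hg, ⟨c, mul_ne_zero hc.1 hc.2⟩, fun x hx => ?_⟩
  exact ⟨h x (left_ne_zero_of_mul hx), h' x (right_ne_zero_of_mul hx)⟩

lemma Gen.all {ι : Type*} [Finite ι] {S : ι → E → Prop} (h : ∀ i, Gen (S i)) :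
    Gen (fun x => ∀ i, S i x) := by
  classical
  cases nonempty_fintype ι
  have : ∀ s : Finset ι, Gen (fun x => ∀ i ∈ s, S i x) := by
    intro s
    induction s using Finset.induction_on with
    | empty => exact Gen.triv.mono (by simp)
    | insert a s _ ih => exact ((h a).and ih).mono (by simp)
  exact (this Finset.univ).mono (by simp)

lemma Gen.of_ne {f : E → ℝ} (hf : f ∈ PolyFn E) {x : E} (hx : f x ≠ 0) :
    Gen (fun x => f x ≠ 0) := ⟨f, hf, ⟨x, hx⟩, fun _ h => h⟩

lemma Gen.comp {S : F → Prop} (h : Gen S) (L : E →ₗ[ℝ] F) (hL : Function.Surjective L) :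
    Gen (fun x => S (L x)) := by
  obtain ⟨f, hf, ⟨x, hx⟩, h⟩ := h
  obtain ⟨y, rfl⟩ := hL x
  exact ⟨_, poly_comp L hf, ⟨y, hx⟩, fun x hx => h _ hx⟩

lemma gen_inj {V κ : Type*} [AddCommGroup V] [Module ℝ V] [FiniteDimensional ℝ V] [Finite κ]
    (M : E → V →ₗ[ℝ] (κ → ℝ)) (hM : ∀ v k, (fun x => M x v k) ∈ PolyFn E)
    (x0 : E) (h0 : ∀ v, M x0 v = 0 → v = 0) : Gen (fun x => ∀ v, M x v = 0 → v = 0) := by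
  classical
  cases nonempty_fintype κ
  let b := Module.finBasis ℝ V
  let A : E → Matrix κ (Fin (Module.finrank ℝ V)) ℝ := fun x => Matrix.of fun k j => M x (b j) k
  have hA : ∀ x (c : Fin (Module.finrank ℝ V) → ℝ), (A x).mulVec c = M x (∑ j, c j • b j) := by
    intro x c
    ext k
    simp [A, Matrix.mulVec, dotProduct, mul_comm]
  have key : ∀ x, ((A x).transpose * A x).det ≠ 0 ↔ ∀ v, M x v = 0 → v = 0 := by
    intro x
    rw [← not_iff_not, not_not, ← Matrix.exists_mulVec_eq_zero_iff]
    constructor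
    · rintro ⟨c, hc, h⟩ h'
      have h2 : (A x).mulVec c = 0 := by
        have h3 : dotProduct ((A x).mulVec c) ((A x).mulVec c) = 0 := by
          rw [Matrix.dotProduct_mulVec, ← Matrix.mulVec_transpose, Matrix.mulVec_mulVec, h]
          simp
        exact dotProduct_self_eq_zero.mp h3
      rw [hA] at h2
      apply hc
      have h3 := h' _ h2
      ext j
      exact (Fintype.linearIndependent_iff.mp b.linearIndependent) c h3 j
    · intro h
      push Not at h
      obtain ⟨v, hv, hv0⟩ := h
      refine ⟨b.repr v, ?_, ?_⟩
      · intro h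
        apply hv0
        apply b.repr.injective
        ext j
        simpa using congrFun h j
      · rw [← Matrix.mulVec_mulVec, hA, b.sum_repr, hv]
        simp
  refine ⟨fun x => ((A x).transpose * A x).det, ?_, ⟨x0, (key x0).mpr h0⟩, fun x hx => (key x).mp hx⟩
  simp only [Matrix.det_apply', Matrix.mul_apply, Matrix.transpose_apply, A, Matrix.of_apply]
  exact poly_sum _ fun σ => poly_mul (poly_const _) <| poly_prod _ fun i =>
    poly_sum _ fun j => poly_mul (hM _ _) (hM _ _)

lemma poly_mv {τ : Type*} [Finite τ] {f : (τ → ℝ) → ℝ} (hf : f ∈ PolyFn (τ → ℝ)) :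
    ∃ P : MvPolynomial τ ℝ, ∀ x, f x = MvPolynomial.eval x P := by
  classical
  cases nonempty_fintype τ
  induction hf using Algebra.adjoin_induction with
  | mem f hf =>
    obtain ⟨l, rfl⟩ := hf
    refine ⟨∑ i, MvPolynomial.C (l (Pi.single i 1)) * MvPolynomial.X i, fun x => ?_⟩
    simp only [map_sum, map_mul, MvPolynomial.eval_C, MvPolynomial.eval_X]
    conv_lhs => rw [LinearMap.pi_apply_eq_sum_univ l x]
    refine Finset.sum_congr rfl fun i _ => ?_
    rw [smul_eq_mul, mul_comm]
    congr 2
    ext j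
    simp [Pi.single_apply, eq_comm]
  | algebraMap c => exact ⟨MvPolynomial.C c, fun t => by simp⟩
  | add f g _ _ hf hg =>
    obtain ⟨p, hp⟩ := hf
    obtain ⟨q, hq⟩ := hg
    exact ⟨p + q, fun t => by simp [hp, hq]⟩
  | mul f g _ _ hf hg =>
    obtain ⟨p, hp⟩ := hf
    obtain ⟨q, hq⟩ := hg
    exact ⟨p * q, fun t => by simp [hp, hq]⟩

end poly

lemma ext_fin {X V W : Type*} [AddCommGroup V] [Module ℝ V] [FiniteDimensional ℝ V]
    [AddCommGroup W] [Module ℝ W] [FiniteDimensional ℝ W] (φ : X → W)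
    (hφ : Submodule.span ℝ (Set.range φ) = ⊤) (L : V →ₗ[ℝ] W) (hL : ∀ v, L v = 0 → v = 0)
    (q : ℕ) (hq : Module.finrank ℝ V + q ≤ Module.finrank ℝ W) :
    ∃ z : Fin q → X, ∀ v (a : Fin q → ℝ), L v + ∑ k, a k • φ (z k) = 0 → v = 0 ∧ a = 0 := by
  induction q with
  | zero => 
    refine ⟨Fin.elim0, fun v a h => ⟨hL v (by simpa using h), Subsingleton.elim _ _⟩⟩
  | succ q ih =>
    obtain ⟨z, hz⟩ := ih (by omega)
    let T : V × (Fin q → ℝ) →ₗ[ℝ] W :=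
      L ∘ₗ LinearMap.fst ℝ V (Fin q → ℝ) +
        (Fintype.linearCombination ℝ (fun k => φ (z k))) ∘ₗ LinearMap.snd ℝ V (Fin q → ℝ)
    have hT : ∀ v a, T (v, a) = L v + ∑ k, a k • φ (z k) := by
      intro v a
      simp [T, Fintype.linearCombination_apply]
    have hlt : LinearMap.range T < ⊤ := by
      rw [lt_top_iff_ne_top]
      intro h
      have h1 := LinearMap.finrank_range_le T
      rw [h, finrank_top, Module.finrank_prod, Module.finrank_fin_fun] at h1
      omega
    obtain ⟨x, hx⟩ : ∃ x, φ x ∉ LinearMap.range T := by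
      by_contra! hcon
      apply hlt.ne
      rw [eq_top_iff, ← hφ, Submodule.span_le]
      rintro _ ⟨x, rfl⟩
      exact hcon x
    refine ⟨Fin.cons x z, fun v a h => ?_⟩
    rw [Fin.sum_univ_succ] at h
    simp only [Fin.cons_zero, Fin.cons_succ] at h
    have ha : a 0 = 0 := by
      by_contra ha
      apply hx
      refine ⟨-(a 0)⁻¹ • (v, fun k => a k.succ), ?_⟩
      rw [map_smul, hT]
      have : L v + ∑ k : Fin q, a k.succ • φ (z k) = - (a 0 • φ x) := by
        rw [eq_neg_iff_add_eq_zero, ← h]; abel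
      rw [this, smul_neg, neg_smul, neg_neg, smul_smul, inv_mul_cancel₀ ha, one_smul]
    rw [ha, zero_smul, zero_add] at h
    obtain ⟨h1, h2⟩ := hz v (fun k => a k.succ) h
    refine ⟨h1, ?_⟩
    ext k
    refine Fin.cases ha (fun k => congrFun h2 k) k

lemma ext_o {X V W o : Type*} [AddCommGroup V] [Module ℝ V] [FiniteDimensional ℝ V]
    [AddCommGroup W] [Module ℝ W] [FiniteDimensional ℝ W] [Fintype o] (φ : X → W)
    (hφ : Submodule.span ℝ (Set.range φ) = ⊤) (L : V →ₗ[ℝ] W) (hL : ∀ v, L v = 0 → v = 0)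
    (hq : Module.finrank ℝ V + Fintype.card o ≤ Module.finrank ℝ W) :
    ∃ z : o → X, ∀ v (a : o → ℝ), L v + ∑ k, a k • φ (z k) = 0 → v = 0 ∧ a = 0 := by
  obtain ⟨z, hz⟩ := ext_fin φ hφ L hL _ hq
  let e := Fintype.equivFin o
  refine ⟨fun k => z (e k), fun v a h => ?_⟩
  have := hz v (fun k => a (e.symm k)) (by
    rw [← h, ← e.sum_comp]; simp)
  refine ⟨this.1, ?_⟩
  ext k
  simpa using congrFun this.2 (e k)

end CPH

namespace CPH

/-- tangent vectors at `x`, points `z` over a block with coordinates `τ` are independent -/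
def PieceInj {X W τ κs o : Type*} [AddCommGroup X] [Module ℝ X] [AddCommGroup W] [Module ℝ W]
    [Fintype κs] [Fintype o] (φ : X → W) (D : X → X →ₗ[ℝ] W)
    (w : κs → τ → ℝ) (x : κs → X) (z : o → X) : Prop :=
  ∀ (V : κs → τ → ℝ) (V' : o → τ → ℝ) (y : κs → X),
    (∀ t, ∑ d, V d t • φ (x d) + ∑ k, V' k t • φ (z k) + ∑ d, w d t • D (x d) (y d) = 0) →
    V = 0 ∧ V' = 0 ∧ y = 0

/-- tangent map of `ℝ^ν ⊗ φ` injective -/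
def TInj {X W ν ι : Type*} [AddCommGroup X] [Module ℝ X] [AddCommGroup W] [Module ℝ W]
    [Fintype ι] (φ : X → W) (D : X → X →ₗ[ℝ] W) (u : ι → ν → ℝ) (x : ι → X) : Prop :=
  ∀ (V : ι → ν → ℝ) (y : ι → X),
    (∀ a, ∑ c, (V c a • φ (x c) + u c a • D (x c) (y c)) = 0) → V = 0 ∧ y = 0

lemma PieceInj.of_comp {X W W' τ κs o : Type*} [AddCommGroup X] [Module ℝ X]
    [AddCommGroup W] [Module ℝ W] [AddCommGroup W'] [Module ℝ W']
    [Fintype κs] [Fintype o] (φ : X → W) (D : X → X →ₗ[ℝ] W) (Λ : W →ₗ[ℝ] W')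
    (w : κs → τ → ℝ) (x : κs → X) (z : o → X)
    (h : PieceInj (fun x => Λ (φ x)) (fun x => Λ ∘ₗ D x) w x z) : PieceInj φ D w x z := by
  intro V V' y hv
  refine h V V' y fun t => ?_
  have := congrArg Λ (hv t)
  simpa using this

section
variable {X κ : Type*} [AddCommGroup X] [Module ℝ X] [FiniteDimensional ℝ X] [Finite κ]
  (φ : X → κ → ℝ) (D : X → X →ₗ[ℝ] (κ → ℝ))

lemma gen_piece {τ κs o : Type*} [Finite τ] [Fintype κs] [Fintype o]
    (hφ : ∀ k, (fun x => φ x k) ∈ PolyFn X) (hD : ∀ y k, (fun x => D x y k) ∈ PolyFn X)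
    (w : κs → τ → ℝ) (x : κs → X) (z : o → X) (h : PieceInj φ D w x z) :
    Gen (fun p : (κs → τ → ℝ) × (κs → X) × (o → X) => PieceInj φ D p.1 p.2.1 p.2.2) := by
  let M : ((κs → τ → ℝ) × (κs → X) × (o → X)) →
      ((κs → τ → ℝ) × (o → τ → ℝ) × (κs → X)) →ₗ[ℝ] (τ × κ → ℝ) := fun p =>
    { toFun := fun v tk => ∑ d, v.1 d tk.1 * φ (p.2.1 d) tk.2 +
        ∑ k, v.2.1 k tk.1 * φ (p.2.2 k) tk.2 + ∑ d, p.1 d tk.1 * D (p.2.1 d) (v.2.2 d) tk.2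
      map_add' := by
        intro v v'
        ext tk
        simp only [Prod.fst_add, Prod.snd_add, Pi.add_apply, map_add, add_mul, mul_add,
          Finset.sum_add_distrib]
        ring
      map_smul' := by
        intro c v
        ext tk
        simp only [Prod.smul_fst, Prod.smul_snd, Pi.smul_apply, map_smul, smul_eq_mul,
          RingHom.id_apply, mul_add, Finset.mul_sum]
        congr 1
        · congr 1 <;> exact Finset.sum_congr rfl fun _ _ => by ring
        · exact Finset.sum_congr rfl fun _ _ => by ring }
  have key : ∀ p, PieceInj φ D p.1 p.2.1 p.2.2 ↔ ∀ v, M p v = 0 → v = 0 := by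
    intro p
    constructor
    · rintro hp ⟨V, V', y⟩ hv
      obtain ⟨h1, h2, h3⟩ := hp V V' y (fun t => by
        ext k
        have := congrFun hv (t, k)
        simpa [M] using this)
      simp [h1, h2, h3]
    · intro hp V V' y hv
      have := hp (V, V', y) (by
        ext ⟨t, k⟩
        have := congrFun (hv t) k
        simpa [M] using this)
      simpa using this
  refine (gen_inj M ?_ (w, x, z) ((key _).mp h)).mono fun p hp => (key p).mpr hp
  rintro ⟨V, V', y⟩ ⟨t, k⟩
  let L1 : κs → ((κs → τ → ℝ) × (κs → X) × (o → X)) →ₗ[ℝ] ℝ := fun d =>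
    (LinearMap.proj t : (τ → ℝ) →ₗ[ℝ] ℝ) ∘ₗ
      (LinearMap.proj d : (κs → τ → ℝ) →ₗ[ℝ] (τ → ℝ)) ∘ₗ LinearMap.fst ℝ _ _
  let L2 : κs → ((κs → τ → ℝ) × (κs → X) × (o → X)) →ₗ[ℝ] X := fun d =>
    (LinearMap.proj d : (κs → X) →ₗ[ℝ] X) ∘ₗ LinearMap.fst ℝ _ _ ∘ₗ LinearMap.snd ℝ _ _
  let L3 : o → ((κs → τ → ℝ) × (κs → X) × (o → X)) →ₗ[ℝ] X := fun d =>
    (LinearMap.proj d : (o → X) →ₗ[ℝ] X) ∘ₗ LinearMap.snd ℝ _ _ ∘ₗ LinearMap.snd ℝ _ _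
  exact poly_add (poly_add
    (poly_sum _ fun d => poly_mul (poly_const _) (poly_comp (L2 d) (hφ k)))
    (poly_sum _ fun d => poly_mul (poly_const _) (poly_comp (L3 d) (hφ k))))
    (poly_sum _ fun d => poly_mul (poly_lin (L1 d)) (poly_comp (L2 d) (hD (y d) k)))

lemma gen_tinj {ν ι : Type*} [Finite ν] [Fintype ι]
    (hφ : ∀ k, (fun x => φ x k) ∈ PolyFn X) (hD : ∀ y k, (fun x => D x y k) ∈ PolyFn X)
    (u : ι → ν → ℝ) (x : ι → X) (h : TInj φ D u x) :
    Gen (fun p : (ι → ν → ℝ) × (ι → X) => TInj φ D p.1 p.2) := by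
  have h' : PieceInj φ D u x (fun k : Empty => k.elim) := by
    intro V V' y hv
    obtain ⟨h1, h2⟩ := h V y (fun t => by
      have := hv t
      simpa [Finset.sum_add_distrib] using this)
    exact ⟨h1, Subsingleton.elim _ _, h2⟩
  refine ((gen_piece φ D hφ hD u x _ h').comp
    (LinearMap.prod (LinearMap.fst ℝ _ _) (LinearMap.prod (LinearMap.snd ℝ _ _) 0)) ?_).mono ?_
  · rintro ⟨a, b, c⟩
    refine ⟨(a, b), ?_⟩
    simp only [LinearMap.prod_apply, Function.prod_apply, LinearMap.fst_apply, LinearMap.snd_apply]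
    congr 2
    exact Subsingleton.elim _ _
  · rintro ⟨u, x⟩ hp V y hv
    obtain ⟨h1, _, h2⟩ := hp V (fun k => k.elim) y (fun t => by
      have := hv t
      simpa [Finset.sum_add_distrib] using this)
    exact ⟨h1, h2⟩

lemma assembly {τ κs μ ρ ν : Type*} [Finite τ] [Nonempty τ] [Fintype κs] [Fintype μ]
    [DecidableEq μ]
    (hφ : ∀ k, (fun x => φ x k) ∈ PolyFn X) (hD : ∀ y k, (fun x => D x y k) ∈ PolyFn X)
    (e : (μ × τ) ⊕ ρ ≃ ν)
    (h : ∀ i : μ, ∃ (w : κs → τ → ℝ) (x : κs → X) (z : {j // j ≠ i} × κs → X),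
      PieceInj φ D w x z) :
    ∃ (u : μ × κs → ν → ℝ) (x : μ × κs → X), TInj φ D u x := by
  have hg : ∀ i : μ, Gen (fun p : (μ × κs → τ → ℝ) × (μ × κs → X) =>
      PieceInj φ D (fun d => p.1 (i, d)) (fun d => p.2 (i, d))
        (fun k : {j // j ≠ i} × κs => p.2 (k.1, k.2))) := by
    intro i
    obtain ⟨w, x, z, hz⟩ := h i
    let L : ((μ × κs → τ → ℝ) × (μ × κs → X)) →ₗ[ℝ]
      ((κs → τ → ℝ) × (κs → X) × ({j // j ≠ i} × κs → X)) :=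
      LinearMap.prod (LinearMap.funLeft ℝ (τ → ℝ) (fun d => (i, d)) ∘ₗ LinearMap.fst ℝ _ _)
        (LinearMap.prod (LinearMap.funLeft ℝ X (fun d => (i, d)) ∘ₗ LinearMap.snd ℝ _ _)
          (LinearMap.funLeft ℝ X (fun k : {j // j ≠ i} × κs => ((k.1 : μ), k.2)) ∘ₗ
            LinearMap.snd ℝ _ _))
    refine ((gen_piece φ D hφ hD w x z hz).comp L ?_).mono fun p hp => hp
    rintro ⟨a, b, c⟩
    refine ⟨(fun p => a p.2, fun p => if hp : p.1 ≠ i then c (⟨p.1, hp⟩, p.2) else b p.2), ?_⟩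
    refine Prod.ext ?_ (Prod.ext ?_ ?_)
    · rfl
    · ext d; simp [L, LinearMap.funLeft_apply]
    · ext ⟨⟨j, hj⟩, d⟩; simp [L, LinearMap.funLeft_apply, hj]
  obtain ⟨⟨w, x⟩, hp⟩ := (Gen.all hg).ex
  simp only at hp
  refine ⟨fun c a => Sum.elim (fun q => if q.1 = c.1 then w c q.2 else 0) (fun _ => 0) (e.symm a),
    x, ?_⟩
  intro V y hv
  have hsplit : ∀ (i : μ) (f : μ × κs → κ → ℝ), ∑ c, f c =
      ∑ d, f (i, d) + ∑ k : {j // j ≠ i} × κs, f (k.1, k.2) := by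
    intro i f
    rw [Fintype.sum_prod_type, Fintype.sum_eq_add_sum_subtype_ne _ i, Fintype.sum_prod_type]
  have main : ∀ i, (∀ c t, V c (e (Sum.inl (i, t))) = 0) ∧ ∀ d, y (i, d) = 0 := by
    intro i
    obtain ⟨h1, h2, h3⟩ := hp i (fun d t => V (i, d) (e (Sum.inl (i, t))))
      (fun k t => V (k.1, k.2) (e (Sum.inl (i, t)))) (fun d => y (i, d)) (fun t => by
        have := hv (e (Sum.inl (i, t)))
        rw [Finset.sum_add_distrib, hsplit i (fun c => V c _ • _), hsplit i] at this
        rw [← this]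
        congr 1
        have h0 : ∀ k : {j // j ≠ i} × κs, i ≠ k.1 := fun k => fun h => k.1.2 h.symm
        simp [h0])
    refine ⟨?_, fun d => congrFun h3 d⟩
    rintro ⟨j, d⟩ t
    by_cases hj : j = i
    · subst hj
      exact congrFun (congrFun h1 d) t
    · exact congrFun (congrFun h2 (⟨j, hj⟩, d)) t
  have hy : y = 0 := by
    ext1 ⟨i, d⟩
    exact (main i).2 d
  refine ⟨?_, hy⟩
  ext c a
  obtain ⟨b, rfl⟩ := e.surjective a
  rcases b with ⟨i, t⟩ | b
  · exact (main i).1 c t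
  · have := hv (e (Sum.inr b))
    rw [hy] at this
    simp only [Pi.zero_apply, map_zero, smul_zero, add_zero] at this
    obtain ⟨t0⟩ := ‹Nonempty τ›
    obtain ⟨h1, h2, h3⟩ := hp c.1 (fun d t => V (c.1, d) (e (Sum.inr b)))
      (fun k t => V (k.1, k.2) (e (Sum.inr b))) 0 (fun t => by
        rw [hsplit c.1] at this
        simpa using this)
    exact congrFun (congrFun h1 c.2) t0

lemma step {s n : ℕ} (hφ : ∀ k, (fun x => φ x k) ∈ PolyFn X)
    (hD : ∀ y k, (fun x => D x y k) ∈ PolyFn X)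
    (hspan : Submodule.span ℝ (Set.range φ) = ⊤)
    (x : Fin s → X) (hx : TInj (ν := Unit) φ D (fun _ _ => 1) x)
    (hc : s * (n + Module.finrank ℝ X) ≤ Nat.card κ) :
    ∃ (u : Fin n × Fin s → Fin n → ℝ) (x : Fin n × Fin s → X), TInj φ D u x := by
  cases nonempty_fintype κ
  refine assembly (τ := Unit) (ρ := Empty) φ D hφ hD
    ((Equiv.sumEmpty _ _).trans (Equiv.prodPUnit _)) fun i => ?_
  let L : ((Fin s → ℝ) × (Fin s → X)) →ₗ[ℝ] (κ → ℝ) :=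
    (Fintype.linearCombination ℝ (fun k => φ (x k))) ∘ₗ LinearMap.fst ℝ _ _ +
    (∑ d, D (x d) ∘ₗ LinearMap.proj d) ∘ₗ LinearMap.snd ℝ _ _
  have hL : ∀ v, L v = ∑ d, v.1 d • φ (x d) + ∑ d, D (x d) (v.2 d) := by
    intro v
    simp [L, Fintype.linearCombination_apply]
  obtain ⟨z, hz⟩ := ext_o (o := {j // j ≠ i} × Fin s) φ hspan L (by
    rintro ⟨V, y⟩ hv
    rw [hL] at hv
    obtain ⟨h1, h2⟩ := hx (fun d _ => V d) y (fun _ => by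
      simpa [Finset.sum_add_distrib] using hv)
    have h1' : V = 0 := by
      ext d; exact congrFun (congrFun h1 d) ()
    simp [h1', h2]) (by
    have hn : 0 < n := i.pos
    have : Fintype.card {j // j ≠ i} = n - 1 := by
      rw [Fintype.card_subtype_compl]; simp
    rw [Fintype.card_prod, this, Module.finrank_prod, Module.finrank_fintype_fun_eq_card,
      Module.finrank_fintype_fun_eq_card, Module.finrank_pi_fintype]
    rw [Nat.card_eq_fintype_card] at hc
    simp only [Fintype.card_fin, Finset.sum_const, Finset.card_univ, smul_eq_mul]
    refine le_trans (le_of_eq ?_) hc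
    obtain ⟨n, rfl⟩ : ∃ k, n = k + 1 := ⟨n - 1, by omega⟩
    simp
    ring)
  refine ⟨fun _ _ => 1, x, z, fun V V' y hv => ?_⟩
  obtain ⟨h1, h2⟩ := hz (fun d => V d (), y) (fun k => V' k ()) (by
    rw [hL, ← hv ()]
    simp only [one_smul]
    abel)
  rw [Prod.mk_eq_zero] at h1
  refine ⟨?_, ?_, h1.2⟩
  · ext d t; exact congrFun h1.1 d
  · ext d t; exact congrFun h2 d

end

end CPH

namespace CPH

lemma blockB {X B' C' σ o : Type*} [AddCommGroup X] [Module ℝ X] [FiniteDimensional ℝ X]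
    [Fintype B'] [Fintype C'] [Fintype σ] [Fintype o] [DecidableEq σ] [DecidableEq B']
    [DecidableEq C']
    (φ : X → ((Bool × σ) ⊕ B') × ((Bool × σ) ⊕ C') → ℝ)
    (D : X → X →ₗ[ℝ] (((Bool × σ) ⊕ B') × ((Bool × σ) ⊕ C') → ℝ))
    (hφ : ∀ k, (fun x => φ x k) ∈ PolyFn X)
    (hspan : Submodule.span ℝ (Set.range φ) = ⊤)
    (h1 : X → (Bool × σ) ⊕ B' → ℝ) (h2 : X → (Bool × σ) ⊕ C' → ℝ)
    (k1 : X → (Bool × σ) ⊕ B' → ℝ) (k2 : X → (Bool × σ) ⊕ C' → ℝ)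
    (hφe : ∀ x p q, φ x (p, q) = h1 x p * h2 x q)
    (hDe : ∀ x y p q, D x y (p, q) = k1 y p * h2 x q + h1 x p * k2 y q)
    (x0 : Bool × σ → X)
    (hx1 : ∀ d p, h1 (x0 d) p = if p = Sum.inl d then 1 else 0)
    (hx2 : ∀ d p, h2 (x0 d) p = if p = Sum.inl d then 1 else 0)
    (hker : ∀ d y, (∀ p, p ≠ Sum.inl d → k1 y p = 0) → (∀ p, p ≠ Sum.inl d → k2 y p = 0) → y = 0)
    (hc : Fintype.card o ≤ Fintype.card σ * Fintype.card C' + (Fintype.card B' * Fintype.card σ +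
      Fintype.card B' * Fintype.card C')) :
    ∃ (w : Bool × σ → Bool → ℝ) (z : o → X), PieceInj φ D w x0 z := by
  -- step 1
  let g : Bool → (σ × C') ⊕ ((B' × σ) ⊕ (B' × C')) →
      ((Bool × σ) ⊕ B') × ((Bool × σ) ⊕ C') := fun t =>
    Sum.elim (fun a => (Sum.inl (!t, a.1), Sum.inr a.2))
      (Sum.elim (fun a => (Sum.inr a.1, Sum.inl (!t, a.2))) (fun a => (Sum.inr a.1, Sum.inr a.2)))
  have hg : ∀ t, Function.Injective (g t) := by
    rintro t (⟨a, b⟩ | ⟨a, b⟩ | ⟨a, b⟩) (⟨c, d⟩ | ⟨c, d⟩ | ⟨c, d⟩) <;> simp [g]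
  have hz1 : ∀ t, ∃ z : o → X, ∀ a : o → ℝ,
      (∀ k, ∑ j, a j * φ (z j) (g t k) = 0) → a = 0 := by
    intro t
    have hs : Submodule.span ℝ (Set.range fun x k => φ x (g t k)) = ⊤ := by
      have : (Set.range fun x k => φ x (g t k)) = (LinearMap.funLeft ℝ ℝ (g t)) '' Set.range φ := by
        rw [← Set.range_comp]; rfl
      rw [this, Submodule.span_image, hspan, Submodule.map_top, LinearMap.range_eq_top]
      exact LinearMap.funLeft_surjective_of_injective _ _ _ (hg t)
    obtain ⟨z, hz⟩ := ext_o (o := o) _ hs (0 : (Fin 0 → ℝ) →ₗ[ℝ] _)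
      (fun _ _ => Subsingleton.elim _ _) (by
        simpa [Module.finrank_fintype_fun_eq_card] using hc)
    refine ⟨z, fun a ha => (hz 0 a ?_).2⟩
    ext k
    simpa using ha k
  have hz2 : ∀ t, Gen (fun z : o → X => ∀ a : o → ℝ,
      (∀ k, ∑ j, a j * φ (z j) (g t k) = 0) → a = 0) := by
    intro t
    obtain ⟨z, hz⟩ := hz1 t
    let M : (o → X) → (o → ℝ) →ₗ[ℝ] ((σ × C') ⊕ ((B' × σ) ⊕ (B' × C')) → ℝ) := fun z =>
      Fintype.linearCombination ℝ (fun j k => φ (z j) (g t k))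
    have hM : ∀ z v k, M z v k = ∑ j, v j * φ (z j) (g t k) := by
      intro z v k
      simp [M, Fintype.linearCombination_apply]
    refine (gen_inj M ?_ z ?_).mono ?_
    · intro v k
      simp only [hM]
      exact poly_sum _ fun j => poly_mul (poly_const _)
        (poly_comp (LinearMap.proj j : (o → X) →ₗ[ℝ] X) (hφ _))
    · intro v hv
      exact hz v fun k => by rw [← hM, hv]; rfl
    · intro z hz a ha
      exact hz a (by ext k; rw [hM, ha]; rfl)
  obtain ⟨z0, hz0⟩ := (Gen.all hz2).ex
  -- step 2
  let Q := ((Bool × σ) × C') ⊕ ((B' × (Bool × σ)) ⊕ (B' × C'))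
  let G : Q → ((Bool × σ) ⊕ B') × ((Bool × σ) ⊕ C') :=
    Sum.elim (fun a => (Sum.inl a.1, Sum.inr a.2))
      (Sum.elim (fun a => (Sum.inr a.1, Sum.inl a.2)) (fun a => (Sum.inr a.1, Sum.inr a.2)))
  let R2 : (w : Bool × σ → Bool → ℝ) → (Bool × σ → C' → ℝ) → (Bool × σ → B' → ℝ) →
      Bool → Q → ℝ := fun w η ξ t =>
    Sum.elim (fun a => w a.1 t * η a.1 a.2)
      (Sum.elim (fun a => w a.2 t * ξ a.2 a.1) (fun _ => 0))
  let R : ((Bool × σ → Bool → ℝ) × (o → X)) →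
      ((o → Bool → ℝ) × (Bool × σ → C' → ℝ) × (Bool × σ → B' → ℝ)) →ₗ[ℝ] (Bool × Q → ℝ) := fun p =>
    { toFun := fun v k => ∑ j, v.1 j k.1 * φ (p.2 j) (G k.2) + R2 p.1 v.2.1 v.2.2 k.1 k.2
      map_add' := by
        rintro v v'
        ext ⟨t, (k | k | k)⟩ <;>
        simp [R2, add_mul, mul_add, Finset.sum_add_distrib] <;> ring
      map_smul' := by
        rintro a v
        ext ⟨t, (k | k | k)⟩ <;>
        simp [R2, mul_add, Finset.mul_sum, mul_assoc, mul_left_comm] }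
  have hR : ∀ p v t k, R p v (t, k) =
    ∑ j, v.1 j t * φ (p.2 j) (G k) + R2 p.1 v.2.1 v.2.2 t k := fun _ _ _ _ => rfl
  have hgen : Gen (fun p => ∀ v, R p v = 0 → v = 0) := by
    refine gen_inj R ?_ (fun d t => if t = d.1 then 1 else 0, z0) ?_
    · rintro ⟨V, η, ξ⟩ ⟨t, k⟩
      simp only [hR]
      let L1 : Bool × σ → ((Bool × σ → Bool → ℝ) × (o → X)) →ₗ[ℝ] ℝ := fun d =>
        (LinearMap.proj t : (Bool → ℝ) →ₗ[ℝ] ℝ) ∘ₗ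
          (LinearMap.proj d : (Bool × σ → Bool → ℝ) →ₗ[ℝ] (Bool → ℝ)) ∘ₗ LinearMap.fst ℝ _ _
      let L2 : o → ((Bool × σ → Bool → ℝ) × (o → X)) →ₗ[ℝ] X := fun j =>
        (LinearMap.proj j : (o → X) →ₗ[ℝ] X) ∘ₗ LinearMap.snd ℝ _ _
      refine poly_add (poly_sum _ fun j => poly_mul (poly_const _) (poly_comp (L2 j) (hφ _))) ?_
      rcases k with k | k | k
      · exact poly_mul (poly_lin (L1 k.1)) (poly_const _)
      · exact poly_mul (poly_lin (L1 k.2)) (poly_const _)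
      · exact poly_const 0
    · rintro ⟨V, η, ξ⟩ hv
      have hv' : ∀ t k, ∑ j, V j t * φ (z0 j) (G k) +
          R2 (fun d t => if t = d.1 then 1 else 0) η ξ t k = 0 := fun t k => congrFun hv (t, k)
      have hV : ∀ t, (fun j => V j t) = 0 := by
        intro t
        apply hz0 t
        rintro (⟨a, b⟩ | ⟨a, b⟩ | ⟨a, b⟩)
        · have := hv' t (Sum.inl ((!t, a), b))
          simpa [R2, G, g] using this
        · have := hv' t (Sum.inr (Sum.inl (a, (!t, b))))
          simpa [R2, G, g] using this
        · have := hv' t (Sum.inr (Sum.inr (a, b)))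
          simpa [R2, G, g] using this
      have hV' : V = 0 := by
        ext j t; exact congrFun (hV t) j
      subst hV'
      refine Prod.ext rfl (Prod.ext ?_ ?_)
      · ext d b
        have := hv' d.1 (Sum.inl (d, b))
        simpa [R2] using this
      · ext d b
        have := hv' d.1 (Sum.inr (Sum.inl (b, d)))
        simpa [R2] using this
  have hw : Gen (fun p : (Bool × σ → Bool → ℝ) × (o → X) =>
      ∀ q : {q : (Bool × σ) × (Bool × σ) // q.1 ≠ q.2},
      p.1 q.1.1 true * p.1 q.1.2 false - p.1 q.1.1 false * p.1 q.1.2 true ≠ 0) := by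
    refine Gen.all fun q => ?_
    let L1 : Bool → Bool × σ → ((Bool × σ → Bool → ℝ) × (o → X)) →ₗ[ℝ] ℝ := fun t d =>
        (LinearMap.proj t : (Bool → ℝ) →ₗ[ℝ] ℝ) ∘ₗ
          (LinearMap.proj d : (Bool × σ → Bool → ℝ) →ₗ[ℝ] (Bool → ℝ)) ∘ₗ LinearMap.fst ℝ _ _
    have := q.2
    refine Gen.of_ne (f := fun p : (Bool × σ → Bool → ℝ) × (o → X) =>
      p.1 q.1.1 true * p.1 q.1.2 false - p.1 q.1.1 false * p.1 q.1.2 true)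
      (poly_sub (poly_mul (poly_lin (L1 true _)) (poly_lin (L1 false _)))
      (poly_mul (poly_lin (L1 false _)) (poly_lin (L1 true _))))
      (x := (fun d t => if d = q.1.1 then (if t then 1 else 0) else (if t then 0 else 1), 0)) ?_
    simp [this.symm]
  obtain ⟨⟨w, z⟩, hp1, hp2⟩ := (hgen.and hw).ex
  simp only at hp2
  refine ⟨w, z, fun V V' y hv => ?_⟩
  have hE : ∀ t p q, ∑ d, V d t * ((if p = Sum.inl d then 1 else 0) * (if q = Sum.inl d then 1 else 0))
      + ∑ k, V' k t * φ (z k) (p, q) + ∑ d, w d t * (k1 (y d) p * (if q = Sum.inl d then 1 else 0) +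
      (if p = Sum.inl d then 1 else 0) * k2 (y d) q) = 0 := by
    intro t p q
    have := congrFun (hv t) (p, q)
    simpa [hφe (x0 _), hDe, hx1, hx2] using this
  have h0 := hp1 (V', fun d q => k2 (y d) (Sum.inr q), fun d p => k1 (y d) (Sum.inr p)) (by
    ext ⟨t, (⟨a, b⟩ | ⟨a, b⟩ | ⟨a, b⟩)⟩
    · have := hE t (Sum.inl a) (Sum.inr b)
      simpa [hR, R2, G] using this
    · have := hE t (Sum.inr a) (Sum.inl b)
      simpa [hR, R2, G] using this
    · have := hE t (Sum.inr a) (Sum.inr b)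
      simpa [hR, R2, G] using this)
  simp only [Prod.mk_eq_zero] at h0
  obtain ⟨rfl, hη, hξ⟩ := h0
  have hoff : ∀ d d', d ≠ d' → k1 (y d') (Sum.inl d) = 0 ∧ k2 (y d) (Sum.inl d') = 0 := by
    intro d d' hne
    have e1 := hE true (Sum.inl d) (Sum.inl d')
    have e2 := hE false (Sum.inl d) (Sum.inl d')
    have hdet := hp2 ⟨(d, d'), hne⟩
    simp only at hdet
    have hz : ∀ x, ((if d = x then (1:ℝ) else 0) * if d' = x then (1:ℝ) else 0) = 0 := by
      intro x
      by_cases h : d = x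
      · subst h; simp [hne.symm]
      · simp [h]
    simp [hz, mul_add, Finset.sum_add_distrib] at e1 e2
    constructor
    · have : (w d true * w d' false - w d false * w d' true) * k1 (y d') (Sum.inl d) = 0 := by
        linear_combination w d true * e2 - w d false * e1
      exact (mul_eq_zero.mp this).resolve_left hdet
    · have : (w d true * w d' false - w d false * w d' true) * k2 (y d) (Sum.inl d') = 0 := by
        linear_combination w d' false * e1 - w d' true * e2
      exact (mul_eq_zero.mp this).resolve_left hdet
  have hy : y = 0 := by
    ext1 d
    apply hker d
    · rintro (p | p) hp
      · exact (hoff p d (by simpa using hp)).1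
      · exact congrFun (congrFun hξ d) p
    · rintro (p | p) hp
      · exact (hoff d p (by intro h; simp [h] at hp)).2
      · exact congrFun (congrFun hη d) p
  refine ⟨?_, rfl, hy⟩
  subst hy
  ext d t
  have := congrFun (hv t) (Sum.inl d, Sum.inl d)
  simpa [hφe (x0 _), hx1, hx2] using this

end CPH

namespace CPH

/-- free coordinates of a normalized vector of length `b` -/
abbrev Ch (b : ℕ) : Type := {j : Fin b // (j : ℕ) ≠ 0} → ℝ

/-- the normalized vector -/
def hh {b : ℕ} (x : Ch b) (j : Fin b) : ℝ := if h : (j : ℕ) ≠ 0 then x ⟨j, h⟩ else 1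

/-- its differential -/
def hd {b : ℕ} : Ch b →ₗ[ℝ] (Fin b → ℝ) where
  toFun x j := if h : (j : ℕ) ≠ 0 then x ⟨j, h⟩ else 0
  map_add' x y := by ext j; by_cases h : (j : ℕ) = 0 <;> simp [h]
  map_smul' c x := by ext j; by_cases h : (j : ℕ) = 0 <;> simp [h]

lemma hd_apply {b : ℕ} (x : Ch b) (j : Fin b) :
    hd x j = if h : (j : ℕ) ≠ 0 then x ⟨j, h⟩ else 0 := rfl

lemma hd_inj {b : ℕ} (x : Ch b) (h : hd x = 0) : x = 0 := by
  ext ⟨j, hj⟩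
  have := congrFun h j
  simpa [hd_apply, hj] using this

/-- free coordinates of normalized factors -/
abbrev SX {k : ℕ} (n : Fin k → ℕ) : Type := (i : Fin k) → Ch (n i)

/-- rank one tensor -/
def sφ {k : ℕ} (n : Fin k → ℕ) (x : SX n) (idx : (i : Fin k) → Fin (n i)) : ℝ :=
  ∏ i, hh (x i) (idx i)

/-- differential of the rank one tensor -/
def sD {k : ℕ} (n : Fin k → ℕ) (x : SX n) : SX n →ₗ[ℝ] (((i : Fin k) → Fin (n i)) → ℝ) where
  toFun y idx := ∑ i, hd (y i) (idx i) * ∏ j, if j = i then 1 else hh (x j) (idx j)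
  map_add' y y' := by
    ext idx
    simp [add_mul, Finset.sum_add_distrib]
  map_smul' c y := by
    ext idx
    simp [mul_assoc, Finset.mul_sum]

lemma sD_apply {k : ℕ} (n : Fin k → ℕ) (x y : SX n) (idx : (i : Fin k) → Fin (n i)) :
    sD n x y idx = ∑ i, hd (y i) (idx i) * ∏ j, if j = i then 1 else hh (x j) (idx j) := rfl

lemma poly_hh {k : ℕ} (n : Fin k → ℕ) (i : Fin k) (j : Fin (n i)) :
    (fun x : SX n => hh (x i) j) ∈ PolyFn (SX n) := by
  by_cases h : (j : ℕ) ≠ 0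
  · simp only [hh, h, ne_eq, not_false_eq_true, dite_true]
    exact poly_lin ((LinearMap.proj (⟨j, h⟩ : {j : Fin (n i) // (j : ℕ) ≠ 0}) :
      Ch (n i) →ₗ[ℝ] ℝ) ∘ₗ (LinearMap.proj i : SX n →ₗ[ℝ] Ch (n i)))
  · simp only [hh, h, dite_false]
    exact poly_const 1

lemma poly_sφ {k : ℕ} (n : Fin k → ℕ) (idx : (i : Fin k) → Fin (n i)) :
    (fun x => sφ n x idx) ∈ PolyFn (SX n) :=
  poly_prod _ fun i => poly_hh n i _

lemma poly_sD {k : ℕ} (n : Fin k → ℕ) (y : SX n) (idx : (i : Fin k) → Fin (n i)) :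
    (fun x => sD n x y idx) ∈ PolyFn (SX n) := by
  simp only [sD_apply]
  refine poly_sum _ fun i => poly_mul (poly_const _) (poly_prod _ fun j => ?_)
  by_cases h : j = i
  · simp only [h, if_true]; exact poly_const 1
  · simp only [h, if_false]; exact poly_hh n _ _

lemma finrank_SX {k : ℕ} (n : Fin k → ℕ) : Module.finrank ℝ (SX n) = ∑ i, (n i - 1) := by
  rw [Module.finrank_pi_fintype]
  refine Finset.sum_congr rfl fun i _ => ?_
  rw [Module.finrank_fintype_fun_eq_card]
  rcases Nat.eq_zero_or_pos (n i) with h | h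
  · have : IsEmpty (Fin (n i)) := by rw [h]; infer_instance
    rw [Fintype.card_eq_zero, h]
  · rw [Fintype.card_subtype_compl (fun j : Fin (n i) => (j : ℕ) = 0)]
    have : Fintype.card {j : Fin (n i) // (j : ℕ) = 0} = 1 := by
      rw [Fintype.card_eq_one_iff]
      exact ⟨⟨⟨0, h⟩, rfl⟩, fun ⟨y, hy⟩ => Subtype.ext (Fin.ext hy)⟩
    simp [this]

lemma span_of_single {κ : Type*} [Fintype κ] [DecidableEq κ] (S : Submodule ℝ (κ → ℝ))
    (h : ∀ k, (fun j => if j = k then (1:ℝ) else 0) ∈ S) : S = ⊤ := by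
  rw [eq_top_iff]
  intro v _
  have : v = ∑ k, v k • (fun j => if j = k then (1:ℝ) else 0) := by
    ext j
    simp
  rw [this]
  exact S.sum_mem fun k _ => S.smul_mem _ (h k)

lemma span_sφ {k : ℕ} (n : Fin k → ℕ) : Submodule.span ℝ (Set.range (sφ n)) = ⊤ := by
  have main : ∀ (s : Finset (Fin k)) (v : (i : Fin k) → Fin (n i) → ℝ),
      (∀ i, i ∉ s → ∀ j : Fin (n i), (j : ℕ) = 0 → v i j = 1) →
      (fun idx : (i : Fin k) → Fin (n i) => ∏ i, v i (idx i)) ∈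
        Submodule.span ℝ (Set.range (sφ n)) := by
    intro s
    induction s using Finset.induction_on with
    | empty =>
      intro v hv
      apply Submodule.subset_span
      refine ⟨fun i j => v i j, ?_⟩
      ext idx
      refine Finset.prod_congr rfl fun i _ => ?_
      by_cases h : ((idx i : Fin (n i)) : ℕ) = 0
      · simp [hh, h, hv i (by simp) _ h]
      · simp [hh, h]
    | insert a s ha ih =>
      intro v hv
      let v1 : Fin (n a) → ℝ := fun j => if (j : ℕ) = 0 then 1 else v a j
      let e1 : Fin (n a) → ℝ := fun j => if (j : ℕ) = 0 then 1 else 0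
      let c : ℝ := if h : 0 < n a then v a ⟨0, h⟩ else 0
      have hva : ∀ j, v a j = v1 j - (1 - c) * e1 j := by
        intro j
        by_cases h : (j : ℕ) = 0
        · have hpos : 0 < n a := j.pos
          have : j = ⟨0, hpos⟩ := Fin.ext h
          subst this
          simp [v1, e1, c, hpos]
        · simp [v1, e1, h]
      have hu : ∀ f : Fin (n a) → ℝ, (∀ j : Fin (n a), (j : ℕ) = 0 → f j = 1) →
          (fun idx : (i : Fin k) → Fin (n i) => f (idx a) * ∏ i ∈ {a}ᶜ, v i (idx i)) ∈
          Submodule.span ℝ (Set.range (sφ n)) := by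
        intro f hf
        have := ih (Function.update v a f) (by
          intro i hi j hj
          by_cases hia : i = a
          · subst hia; simpa using hf j hj
          · rw [Function.update_of_ne hia]
            exact hv i (by simp [hia, hi]) j hj)
        convert this using 2 with idx
        rw [Fintype.prod_eq_mul_prod_compl a]
        congr 1
        · simp
        · refine Finset.prod_congr rfl fun i hi => ?_
          have : i ≠ a := by simpa using hi
          rw [Function.update_of_ne this]
      have h1 := hu v1 (by intro j hj; simp [v1, hj])
      have h2 := hu e1 (by intro j hj; simp [e1, hj])
      convert Submodule.sub_mem _ h1 (Submodule.smul_mem _ (1 - c) h2) using 1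
      ext idx
      rw [Fintype.prod_eq_mul_prod_compl a, hva]
      simp only [Pi.sub_apply, Pi.smul_apply, smul_eq_mul]
      ring
  apply span_of_single
  intro idx0
  convert main Finset.univ (fun i j => if j = idx0 i then 1 else 0) (by simp) using 1
  ext idx
  rw [Fintype.prod_ite_zero]
  simp [funext_iff]

lemma TInj.restrict {X W ν ι ι' : Type*} [AddCommGroup X] [Module ℝ X] [AddCommGroup W]
    [Module ℝ W] [Fintype ι] [Fintype ι'] {φ : X → W} {D : X → X →ₗ[ℝ] W} {u : ι → ν → ℝ}
    {x : ι → X} (h : TInj φ D u x) (f : ι' → ι) (hf : Function.Injective f) :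
    TInj φ D (fun c => u (f c)) (fun c => x (f c)) := by
  intro V y hv
  obtain ⟨h1, h2⟩ := h (Function.extend f V 0) (Function.extend f y 0) (fun a => by
    rw [← hv a]
    symm
    apply Fintype.sum_of_injective f hf
    · intro i hi
      have : ¬ ∃ a, f a = i := hi
      rw [Function.extend_apply' _ _ _ this, Function.extend_apply' _ _ _ this]
      simp
    · intro i
      rw [hf.extend_apply, hf.extend_apply])
  constructor
  · ext1 c
    rw [← hf.extend_apply V 0 c, h1]; rfl
  · ext1 c
    rw [← hf.extend_apply y 0 c, h2]; rfl

/-- independence for `ℝ^a ⊗ (normalized Segre)` -/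
def SInd (a : ℕ) {k : ℕ} (n : Fin k → ℕ) (r : ℕ) : Prop :=
  ∃ (u : Fin r → Fin a → ℝ) (x : Fin r → SX n), TInj (sφ n) (sD n) u x

lemma SInd.of_inj {ι : Type*} [Fintype ι] {a k r : ℕ} {n : Fin k → ℕ} (u : ι → Fin a → ℝ)
    (x : ι → SX n) (h : TInj (sφ n) (sD n) u x) (hr : r ≤ Fintype.card ι) : SInd a n r := by
  let f : Fin r → ι := fun c => (Fintype.equivFin ι).symm (Fin.castLE hr c)
  exact ⟨_, _, h.restrict f
    ((Fintype.equivFin ι).symm.injective.comp (Fin.castLE_injective hr))⟩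

lemma SInd.norm {k r : ℕ} (n : Fin (k + 1) → ℕ) (hn : 0 < n 0)
    (h : SInd (n 0) (fun i : Fin k => n i.succ) r) :
    ∃ x : Fin r → SX n, TInj (ν := Unit) (sφ n) (sD n) (fun _ _ => 1) x := by
  obtain ⟨u, x, h⟩ := h
  have g1 := gen_tinj _ _ (poly_sφ _) (poly_sD _) u x h
  have g2 : Gen (fun p : (Fin r → Fin (n 0) → ℝ) × (Fin r → SX (fun i : Fin k => n i.succ)) =>
      ∀ c, p.1 c ⟨0, hn⟩ ≠ 0) := by
    refine Gen.all fun c => ?_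
    let L1 : ((Fin r → Fin (n 0) → ℝ) × (Fin r → SX (fun i : Fin k => n i.succ))) →ₗ[ℝ] ℝ :=
      (LinearMap.proj ⟨0, hn⟩ : (Fin (n 0) → ℝ) →ₗ[ℝ] ℝ) ∘ₗ
          (LinearMap.proj c : (Fin r → Fin (n 0) → ℝ) →ₗ[ℝ] (Fin (n 0) → ℝ)) ∘ₗ
            LinearMap.fst ℝ _ _
    exact Gen.of_ne (poly_lin L1) (x := (fun _ _ => 1, 0)) (by simp)
  obtain ⟨⟨u, x⟩, h, hu⟩ := (g1.and g2).ex
  simp only at h hu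
  have hh0 : ∀ c (j : Fin (n 0)), hh (fun j : {j : Fin (n 0) // (j : ℕ) ≠ 0} =>
      u c j / u c ⟨0, hn⟩) j = u c j / u c ⟨0, hn⟩ := by
    intro c j
    by_cases hj : (j : ℕ) = 0
    · have : j = ⟨0, hn⟩ := Fin.ext hj
      subst this
      simp [hh, hu]
    · simp [hh, hj]
  let x' : Fin r → SX n := fun c => Fin.cons (α := fun i => Ch (n i))
    (fun j => u c j / u c ⟨0, hn⟩) (x c)
  refine ⟨x', fun α y hv => ?_⟩
  obtain ⟨h1, h2⟩ := h (fun c a => α c () * (u c a / u c ⟨0, hn⟩) + hd (y c 0) a)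
    (fun c => (u c ⟨0, hn⟩)⁻¹ • fun i : Fin k => y c i.succ) (fun a => by
      ext idx
      have := congrFun (hv ()) (Fin.cons (α := fun i => Fin (n i)) a idx)
      refine Eq.trans ?_ this
      simp only [Finset.sum_apply, Pi.add_apply, Pi.smul_apply, smul_eq_mul, sφ, sD_apply,
        Fin.prod_univ_succ, Fin.sum_univ_succ, x', Fin.cons_zero, Fin.cons_succ, hh0, map_smul,
        one_mul, Fin.succ_ne_zero, if_false, if_true, Fin.succ_inj, Ne.symm (Fin.succ_ne_zero _)]
      refine Finset.sum_congr rfl fun c _ => ?_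
      rw [show ∀ s t v w z : ℝ, s * (t * v) + (w * v + z) = (s * t + w) * v + z by intros; ring]
      congr 1
      rw [Finset.mul_sum, Finset.mul_sum]
      refine Finset.sum_congr rfl fun i _ => ?_
      rw [div_eq_mul_inv]
      ring)
  have hα : α = 0 := by
    ext c t
    have := congrFun (congrFun h1 c) ⟨0, hn⟩
    simpa [hd_apply, hu] using this
  refine ⟨hα, ?_⟩
  subst hα
  ext1 c
  ext1 i
  refine Fin.cases ?_ (fun i => ?_) i
  · apply hd_inj
    ext a
    have := congrFun (congrFun h1 c) a
    simpa using this
  · have := congrFun (congrFun h2 c) i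
    simpa [hu] using this

lemma SInd.step {k s a : ℕ} (n : Fin (k + 1) → ℕ) (hn : 0 < n 0)
    (h : SInd (n 0) (fun i : Fin k => n i.succ) s)
    (hc : s * (a + ∑ i, (n i - 1)) ≤ ∏ i, n i) : SInd a n (a * s) := by
  obtain ⟨x, hx⟩ := h.norm n hn
  obtain ⟨u, x, h⟩ := CPH.step (n := a) _ _ (poly_sφ n) (poly_sD n) (span_sφ n) x hx (by
    rw [finrank_SX]
    simpa using hc)
  exact SInd.of_inj u x h (by simp)

end CPH

namespace CPH

/-- dual coordinates for the normalized basis `e₀, e₀ + e_p` -/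
def gl (b : ℕ) : (Fin b → ℝ) →ₗ[ℝ] (Fin b → ℝ) where
  toFun v p := if (p : ℕ) = 0 then v p - ∑ j : Fin b, (if (j : ℕ) = 0 then 0 else v j) else v p
  map_add' v w := by
    ext p
    have : ∑ j : Fin b, (if (j : ℕ) = 0 then 0 else (v + w) j) =
      ∑ j : Fin b, (if (j : ℕ) = 0 then 0 else v j) +
        ∑ j : Fin b, (if (j : ℕ) = 0 then 0 else w j) := by
      rw [← Finset.sum_add_distrib]
      exact Finset.sum_congr rfl fun j _ => by split_ifs <;> simp
    simp only [this]
    simp only [Pi.add_apply]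
    split_ifs <;> ring
  map_smul' c v := by
    ext p
    have : ∑ j : Fin b, (if (j : ℕ) = 0 then 0 else (c • v) j) =
      c * ∑ j : Fin b, (if (j : ℕ) = 0 then 0 else v j) := by
      rw [Finset.mul_sum]
      exact Finset.sum_congr rfl fun j _ => by split_ifs <;> simp
    simp only [this]
    simp only [Pi.smul_apply, smul_eq_mul, RingHom.id_apply]
    split_ifs <;> ring

lemma gl_apply (b : ℕ) (v : Fin b → ℝ) (p : Fin b) : gl b v p =
    if (p : ℕ) = 0 then v p - ∑ j : Fin b, (if (j : ℕ) = 0 then 0 else v j) else v p := rfl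

/-- normalized basis vector -/
def fp {b : ℕ} (p : Fin b) : Ch b := fun j => if j.1 = p then 1 else 0

lemma gl_fp {b : ℕ} (p q : Fin b) : gl b (hh (fp p)) q = if q = p then 1 else 0 := by
  rw [gl_apply]
  by_cases hq : (q : ℕ) = 0
  · have hs : ∑ j : Fin b, (if (j : ℕ) = 0 then 0 else hh (fp p) j) =
        if (p : ℕ) = 0 then 0 else 1 := by
      rw [Finset.sum_eq_single p]
      · by_cases hp : (p : ℕ) = 0 <;> simp [hp, hh, fp]
      · intro j _ hj
        by_cases hj0 : (j : ℕ) = 0 <;> simp [hj0, hh, fp, hj]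
      · simp
    rw [if_pos hq, hs]
    by_cases hp : (p : ℕ) = 0
    · have : q = p := Fin.ext (hq.trans hp.symm)
      simp [hh, hp, this]
    · have : q ≠ p := fun h => hp (h ▸ hq)
      simp [hh, hp, hq, this]
  · simp [hq, hh, fp]

lemma gl_ker {b : ℕ} (p : Fin b) (y : Ch b) (h : ∀ q, q ≠ p → gl b (hd y) q = 0) : y = 0 := by
  have h1 : ∀ j : {j : Fin b // (j : ℕ) ≠ 0}, j.1 ≠ p → y j = 0 := by
    rintro ⟨j, hj⟩ hjp
    have := h j hjp
    simpa [gl_apply, hd_apply, hj] using this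
  by_cases hp : (p : ℕ) = 0
  · ext j
    exact h1 j fun hj => j.2 (hj ▸ hp)
  · have hpos : 0 < b := p.pos
    have h2 := h ⟨0, hpos⟩ (fun h => hp (h ▸ rfl))
    rw [gl_apply, if_pos rfl, Finset.sum_eq_single p] at h2
    · have h3 : y ⟨p, hp⟩ = 0 := by simpa [hd_apply, hp] using h2
      ext ⟨j, hj⟩
      by_cases hjp : j = p
      · subst hjp; exact h3
      · exact h1 _ hjp
    · intro j _ hjp
      by_cases hj : (j : ℕ) = 0
      · simp [hj]
      · simp [hj, hd_apply, h1 ⟨j, hj⟩ hjp]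
    · simp

lemma poly_gl {k : ℕ} (n : Fin k → ℕ) (i : Fin k) (p : Fin (n i)) :
    (fun x : SX n => gl (n i) (hh (x i)) p) ∈ PolyFn (SX n) := by
  simp only [gl_apply]
  by_cases h : (p : ℕ) = 0
  · simp only [h, if_true]
    refine poly_sub (poly_hh n i p) (poly_sum _ fun j => ?_)
    by_cases hj : (j : ℕ) = 0
    · simp only [hj, if_true]; exact poly_const 0
    · simp only [hj, if_false]; exact poly_hh n i j
  · simp only [h, if_false]; exact poly_hh n i p

lemma SInd.base (n : Fin 2 → ℕ) (μ ρ s b' c' : ℕ) (hb : n 0 = 2 * s + b') (hc : n 1 = 2 * s + c')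
    (hcard : (μ - 1) * (2 * s) ≤ s * c' + (b' * s + b' * c')) :
    SInd (2 * μ + ρ) n (2 * μ * s) := by
  have eB : ((Bool × Fin s) ⊕ Fin b') ≃ Fin (n 0) := Fintype.equivOfCardEq (by simp [hb])
  have eC : ((Bool × Fin s) ⊕ Fin c') ≃ Fin (n 1) := Fintype.equivOfCardEq (by simp [hc])
  have eA : ((Fin μ × Bool) ⊕ Fin ρ) ≃ Fin (2 * μ + ρ) :=
    Fintype.equivOfCardEq (by simp [mul_comm])
  let mk : Fin (n 0) → Fin (n 1) → ((i : Fin 2) → Fin (n i)) := fun i j =>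
    (piFinTwoEquiv (fun i => Fin (n i))).symm (i, j)
  let Λ : (((i : Fin 2) → Fin (n i)) → ℝ) →ₗ[ℝ]
      (((Bool × Fin s) ⊕ Fin b') × ((Bool × Fin s) ⊕ Fin c') → ℝ) :=
    LinearMap.pi fun pq => LinearMap.proj (eB pq.1) ∘ₗ gl (n 0) ∘ₗ
      LinearMap.pi fun i => LinearMap.proj (eC pq.2) ∘ₗ gl (n 1) ∘ₗ
        LinearMap.pi fun j => LinearMap.proj (mk i j)
  have hΛ : ∀ F p q, Λ F (p, q) = gl (n 0) (fun i => gl (n 1) (fun j => F (mk i j)) (eC q)) (eB p) :=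
    fun _ _ _ => rfl
  have hΛ' : ∀ (F : ((i : Fin 2) → Fin (n i)) → ℝ) (f : Fin (n 0) → ℝ) (g : Fin (n 1) → ℝ),
      (∀ i j, F (mk i j) = f i * g j) →
      ∀ p q, Λ F (p, q) = gl (n 0) f (eB p) * gl (n 1) g (eC q) := by
    intro F f g h p q
    rw [hΛ]
    have e1 : ∀ i, gl (n 1) (fun j => F (mk i j)) (eC q) = gl (n 1) g (eC q) * f i := by
      intro i
      have : (fun j => F (mk i j)) = f i • g := by ext j; simp [h]
      rw [this, map_smul, Pi.smul_apply, smul_eq_mul, mul_comm]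
    have : (fun i => gl (n 1) (fun j => F (mk i j)) (eC q)) = gl (n 1) g (eC q) • f := by
      ext i; simp [e1]
    rw [this, map_smul, Pi.smul_apply, smul_eq_mul, mul_comm]
  have hφe : ∀ x p q, Λ (sφ n x) (p, q) = gl (n 0) (hh (x 0)) (eB p) * gl (n 1) (hh (x 1)) (eC q) := by
    intro x
    apply hΛ'
    intro i j
    simp [sφ, Fin.prod_univ_two, mk]
  have hDe : ∀ x y p q, Λ (sD n x y) (p, q) =
      gl (n 0) (hd (y 0)) (eB p) * gl (n 1) (hh (x 1)) (eC q) +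
      gl (n 0) (hh (x 0)) (eB p) * gl (n 1) (hd (y 1)) (eC q) := by
    intro x y p q
    have : sD n x y = (fun idx => hd (y 0) (idx 0) * hh (x 1) (idx 1)) +
        (fun idx => hh (x 0) (idx 0) * hd (y 1) (idx 1)) := by
      ext idx
      simp [sD_apply, Fin.sum_univ_two, Fin.prod_univ_two, mul_comm]
    rw [this, map_add, Pi.add_apply, hΛ' _ (hd (y 0)) (hh (x 1)), hΛ' _ (hh (x 0)) (hd (y 1))]
    · intro i j; simp [mk]
    · intro i j; simp [mk]
  let pt : Fin (n 0) → Fin (n 1) → SX n := fun i j =>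
    (piFinTwoEquiv (fun i => Ch (n i))).symm (fp i, fp j)
  have hpt0 : ∀ i j, pt i j 0 = fp i := fun i j => by simp [pt]
  have hpt1 : ∀ i j, pt i j 1 = fp j := fun i j => by simp [pt]
  obtain ⟨u, x, h⟩ := assembly (τ := Bool) (κs := Bool × Fin s) (sφ n) (sD n) (poly_sφ n)
    (poly_sD n) eA (fun i => by
      obtain ⟨w, z, hw⟩ := blockB (o := {j // j ≠ i} × (Bool × Fin s)) (fun x => Λ (sφ n x))
        (fun x => Λ ∘ₗ sD n x) (by
          rintro ⟨p, q⟩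
          simp only [hφe]
          exact poly_mul (poly_gl n 0 _) (poly_gl n 1 _)) (by
          apply span_of_single
          rintro ⟨p, q⟩
          apply Submodule.subset_span
          refine ⟨pt (eB p) (eC q), ?_⟩
          ext ⟨p', q'⟩
          simp only [hφe, hpt0, hpt1, gl_fp, EmbeddingLike.apply_eq_iff_eq, Prod.mk.injEq]
          by_cases h1 : p' = p <;> by_cases h2 : q' = q <;> simp [h1, h2])
        (fun x p => gl (n 0) (hh (x 0)) (eB p)) (fun x q => gl (n 1) (hh (x 1)) (eC q))
        (fun x p => gl (n 0) (hd (x 0)) (eB p)) (fun x q => gl (n 1) (hd (x 1)) (eC q))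
        hφe hDe (fun d => pt (eB (Sum.inl d)) (eC (Sum.inl d)))
        (by intro d p; simp [hpt0, gl_fp]) (by intro d p; simp [hpt1, gl_fp])
        (by
          intro d y h1 h2
          have e0 : y 0 = 0 := gl_ker (eB (Sum.inl d)) _ fun q hq => by
            have := h1 (eB.symm q) (fun h => hq (by simp [← h]))
            simpa using this
          have e1 : y 1 = 0 := gl_ker (eC (Sum.inl d)) _ fun q hq => by
            have := h2 (eC.symm q) (fun h => hq (by simp [← h]))
            simpa using this
          ext1 i
          fin_cases i
          · exact e0
          · exact e1)
        (by
          have : Fintype.card {j // j ≠ i} = μ - 1 := by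
            rw [Fintype.card_subtype_compl]; simp
          rw [Fintype.card_prod, this]
          simpa using hcard)
      exact ⟨w, _, z, PieceInj.of_comp _ _ Λ _ _ _ hw⟩)
  exact SInd.of_inj u x h (by simp; apply le_of_eq; ring)

end CPH

namespace CPH

lemma SInd.mono {a k r r' : ℕ} {n : Fin k → ℕ} (h : SInd a n r) (hr : r' ≤ r) : SInd a n r' := by
  obtain ⟨u, x, h⟩ := h
  exact SInd.of_inj u x h (by simpa using hr)

lemma SInd.zero {a k : ℕ} {n : Fin k → ℕ} : SInd a n 0 :=
  ⟨Fin.elim0, Fin.elim0, fun _ _ _ => ⟨Subsingleton.elim _ _, Subsingleton.elim _ _⟩⟩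

lemma arith3 (t1 t2 t3 b c s : ℕ) (h2 : 2 ≤ t1) (h12 : t2 ≤ t1) (h23 : t3 ≤ t2)
    (hb : t2 ≤ b) (hc : t3 ≤ c) (hs : s * (t1 + t2 + t3 - 2) ≤ t2 * t3)
    (h00 : t2 = 0 → s = 0) :
    2 * s ≤ t3 ∧ s * (t1 + b + c - 2) ≤ b * c := by
  have h1 : 2 * s ≤ t3 := by
    rcases Nat.eq_zero_or_pos s with rfl | hs0
    · simp
    obtain ⟨d, rfl⟩ : ∃ d, t1 = d + 2 := ⟨t1 - 2, by omega⟩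
    have e : d + 2 + t2 + t3 - 2 = d + t2 + t3 := by omega
    rw [e] at hs
    have ht2 : 0 < t2 := by
      by_contra h
      have : t2 = 0 := by omega
      have := h00 this
      omega
    have ht3 : 2 ≤ t3 := by
      by_contra h
      have h' : t3 = 0 ∨ t3 = 1 := by omega
      rcases h' with h' | h' <;> subst h' <;> nlinarith
    have : 2 * s * t2 ≤ t3 * t2 := by nlinarith
    exact Nat.le_of_mul_le_mul_right this ht2
  refine ⟨h1, ?_⟩
  obtain ⟨d, rfl⟩ : ∃ d, t1 = d + 2 := ⟨t1 - 2, by omega⟩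
  have e : d + 2 + t2 + t3 - 2 = d + t2 + t3 := by omega
  have e' : d + 2 + b + c - 2 = d + b + c := by omega
  rw [e] at hs
  rw [e']
  obtain ⟨x, rfl⟩ := Nat.exists_eq_add_of_le hb
  obtain ⟨y, rfl⟩ := Nat.exists_eq_add_of_le hc
  have e1 : s * x ≤ t3 * x := Nat.mul_le_mul_right _ (by omega)
  have e2 : s * y ≤ t2 * y := Nat.mul_le_mul_right _ (by omega)
  nlinarith [Nat.zero_le (x * y)]

lemma SInd.base3 (n : Fin 2 → ℕ) (a r : ℕ) 
    (hr : r ≤ rankBound3 a (n 0) (n 1)) : SInd a n r := by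
  unfold rankBound3 at hr
  simp only at hr
  set t1 := evenTrunc a with ht1
  set t2 := min (n 0) t1 with ht2
  set t3 := min (n 1) t2 with ht3
  set s := t2 * t3 / (t1 + t2 + t3 - 2) with hs
  obtain ⟨μ, ρ, hμ, ha⟩ : ∃ μ ρ, t1 = 2 * μ ∧ a = 2 * μ + ρ := by
    refine ⟨t1 / 2, a - t1, ?_, ?_⟩ <;> (rw [ht1]; unfold evenTrunc; split_ifs <;> omega)
  refine SInd.mono ?_ hr
  rcases Nat.eq_zero_or_pos μ with h0 | h0
  · subst h0
    rw [hμ]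
    simpa using SInd.zero
  have hs' : s * (t1 + t2 + t3 - 2) ≤ t2 * t3 := Nat.div_mul_le_self _ _
  obtain ⟨h1, h2⟩ := arith3 t1 t2 t3 (n 0) (n 1) s (by omega) (min_le_right _ _) (min_le_right _ _)
    (min_le_left _ _) (min_le_left _ _) hs' (by intro h; rw [hs, h]; simp)
  have hb : t3 ≤ n 0 := (min_le_right _ _).trans (min_le_left _ _)
  have hc : t3 ≤ n 1 := min_le_left _ _
  obtain ⟨b', hb'⟩ := Nat.exists_eq_add_of_le (h1.trans hb)
  obtain ⟨c', hc'⟩ := Nat.exists_eq_add_of_le (h1.trans hc)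
  have := SInd.base n μ ρ s b' c' hb' hc' (by
    rw [hb', hc', hμ] at h2
    obtain ⟨ν, rfl⟩ : ∃ ν, μ = ν + 1 := ⟨μ - 1, by omega⟩
    have e : 2 * (ν + 1) + (2 * s + b') + (2 * s + c') - 2 = 2 * ν + (2 * s + b') + (2 * s + c') := by
      omega
    rw [e] at h2
    simp only [Nat.add_sub_cancel]
    nlinarith)
  rw [← ha, ← hμ] at this
  exact this

lemma Icc_fin_sum (N : ℕ → ℕ) (a k : ℕ) :
    ∑ i ∈ Finset.Icc a (a + k), N i = ∑ i : Fin (k + 1), N (a + i) := by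
  rw [Fin.sum_univ_eq_sum_range (fun i => N (a + i)), ← Finset.Ico_add_one_right_eq_Icc,
    Finset.sum_Ico_eq_sum_range]
  congr 2
  omega

lemma Icc_fin_prod (N : ℕ → ℕ) (a k : ℕ) :
    ∏ i ∈ Finset.Icc a (a + k), N i = ∏ i : Fin (k + 1), N (a + i) := by
  rw [Fin.prod_univ_eq_prod_range (fun i => N (a + i)), ← Finset.Ico_add_one_right_eq_Icc,
    Finset.prod_Ico_eq_prod_range]
  congr 2
  omega

lemma SInd.main (m : ℕ) (N : ℕ → ℕ)
    (hmono : ∀ i j : ℕ, 1 ≤ i → i ≤ j → j ≤ m → N j ≤ N i) (k : ℕ) :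
    ∀ A, m = A + (k + 3) → ∀ r, r ≤ rankBound N m (k + 3) →
      SInd (N (A + 1)) (fun i : Fin (k + 2) => N (A + 2 + i)) r := by
  induction k with
  | zero =>
    intro A hm r hr
    refine SInd.base3 _ _ _ ?_
    simp only [rankBound] at hr
    have e1 : m - 2 = A + 1 := by omega
    have e2 : m - 1 = A + 2 := by omega
    have e3 : m = A + 3 := by omega
    rw [e1, e2, e3] at hr
    exact hr
  | succ k ih =>
    intro A hm r hr
    have ih' := ih (A + 1) (by omega)
    have hr' : r ≤ N (m - (k + 4) + 1) *
        min (rankBound N m (k + 3))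
          ((∏ i ∈ Finset.Icc (m - (k + 4) + 2) m, N i) /
            ((∑ i ∈ Finset.Icc (m - (k + 4) + 1) m, N i) - (k + 4) + 1)) := hr
    have e1 : m - (k + 4) = A := by omega
    have e2 : Finset.Icc (A + 1) m = Finset.Icc (A + 1) (A + 1 + (k + 3)) := by
      congr 1; omega
    have e3 : Finset.Icc (A + 2) m = Finset.Icc (A + 2) (A + 2 + (k + 2)) := by
      congr 1; omega
    rw [e1, e2, e3, Icc_fin_sum, Icc_fin_prod] at hr'
    set s := min (rankBound N m (k + 3)) ((∏ i : Fin (k + 2 + 1), N (A + 2 + i)) /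
            ((∑ i : Fin (k + 3 + 1), N (A + 1 + i)) - (k + 4) + 1)) with hs
    refine SInd.mono ?_ hr'
    rcases Nat.eq_zero_or_pos s with h0 | h0
    · rw [h0]; exact SInd.zero
    have hs1 : s ≤ rankBound N m (k + 3) := min_le_left _ _
    have hs2 : s * ((∑ i : Fin (k + 3 + 1), N (A + 1 + i)) - (k + 4) + 1) ≤
        ∏ i : Fin (k + 2 + 1), N (A + 2 + i) :=
      (Nat.mul_le_mul_right _ (min_le_right _ _)).trans (Nat.div_mul_le_self _ _)
    have hpos : 0 < ∏ i : Fin (k + 2 + 1), N (A + 2 + i) := lt_of_lt_of_le (by positivity) hs2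
    have hN : ∀ i : Fin (k + 2 + 1), 0 < N (A + 2 + i) := by
      intro i
      rw [Nat.pos_iff_ne_zero]
      intro h
      exact hpos.ne' (Finset.prod_eq_zero (Finset.mem_univ i) h)
    have hNA : 0 < N (A + 1) :=
      lt_of_lt_of_le (hN 0) (hmono (A + 1) _ (by omega) (by simp) (by simp; omega))
    have htail : (fun i : Fin (k + 2) => N (A + 2 + (i.succ : Fin (k + 3)))) =
        fun i : Fin (k + 2) => N (A + 1 + 2 + i) := by
      ext i
      congr 1
      simp
      omega
    refine SInd.step (fun i : Fin (k + 2 + 1) => N (A + 2 + i)) (hN 0) ?_ ?_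
    · simp only [htail]
      exact ih' s hs1
    · refine le_trans (le_of_eq ?_) hs2
      congr 1
      have h1 : ∑ i : Fin (k + 2 + 1), (N (A + 2 + i) - 1) + (k + 3) =
          ∑ i : Fin (k + 2 + 1), N (A + 2 + i) := by
        have : ∑ i : Fin (k + 2 + 1), ((N (A + 2 + i) - 1) + 1) =
            ∑ i : Fin (k + 2 + 1), (N (A + 2 + i) - 1) + (k + 3) := by
          rw [Finset.sum_add_distrib]; simp
        rw [← this]
        exact Finset.sum_congr rfl fun i _ => Nat.sub_add_cancel (hN i)
      have h2 : ∑ i : Fin (k + 3 + 1), N (A + 1 + i) = N (A + 1) +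
          ∑ i : Fin (k + 2 + 1), N (A + 2 + i) := by
        rw [Fin.sum_univ_succ]
        congr 1
        refine Finset.sum_congr rfl fun i _ => ?_
        congr 1
        simp
        omega
      omega

end CPH

namespace CPH

lemma hess_gen {E κ : Type*} [NormedAddCommGroup E] [NormedSpace ℝ E] [Fintype κ]
    (g : κ → E → ℝ) (hg : ∀ k, ContDiff ℝ 2 (g k)) (x0 v : E) :
    iteratedFDeriv ℝ 2 (fun x => ∑ k, (g k x0 - g k x) ^ 2) x0 ![v, v] =
      2 * ∑ k, (fderiv ℝ (g k) x0 v) ^ 2 := by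
  have hd1 : ∀ k x, HasFDerivAt (g k) (fderiv ℝ (g k) x) x := fun k x =>
    ((hg k).differentiable (by norm_num) x).hasFDerivAt
  have h1 : fderiv ℝ (fun x => ∑ k, (g k x0 - g k x) ^ 2) =
      fun x => ∑ k, (2 * (g k x - g k x0)) • fderiv ℝ (g k) x := by
    ext1 x
    apply HasFDerivAt.fderiv
    refine HasFDerivAt.fun_sum fun k _ => ?_
    have := (((hd1 k x).const_sub (g k x0)).pow 2)
    refine this.congr_fderiv ?_
    ext w
    simp
    ring
  rw [iteratedFDeriv_two_apply, h1]
  have h2 : HasFDerivAt (fun x => ∑ k, (2 * (g k x - g k x0)) • fderiv ℝ (g k) x)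
      (∑ k, (2 * (g k x0 - g k x0)) • fderiv ℝ (fderiv ℝ (g k)) x0 +
        ∑ k, ((2 : ℝ) • fderiv ℝ (g k) x0).smulRight (fderiv ℝ (g k) x0)) x0 := by
    rw [← Finset.sum_add_distrib]
    refine HasFDerivAt.fun_sum fun k _ => ?_
    have hc : HasFDerivAt (fun x => 2 * (g k x - g k x0)) ((2 : ℝ) • fderiv ℝ (g k) x0) x0 :=
      ((hd1 k x0).sub_const (g k x0)).const_mul 2
    have hf : HasFDerivAt (fderiv ℝ (g k)) (fderiv ℝ (fderiv ℝ (g k)) x0) x0 :=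
      (((hg k).fderiv_right (m := 1) (by norm_num)).differentiable (by norm_num) x0).hasFDerivAt
    exact hc.smul hf
  rw [h2.fderiv]
  simp [Finset.mul_sum]
  refine Finset.sum_congr rfl fun k _ => ?_
  ring

section
variable {m r : ℕ} {n : Fin m → ℕ}

/-- linear part of the embedding -/
def embL (i : Fin m) (j : Fin (n i)) (c : Fin r) : (FreeIdx m r n → ℝ) →L[ℝ] ℝ :=
  if h : (i : ℕ) = 0 ∨ ((j : ℕ) ≠ 0) then
    ContinuousLinearMap.proj (⟨⟨i, (j, c)⟩, h⟩ : FreeIdx m r n) else 0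

lemma embL_apply (i : Fin m) (j : Fin (n i)) (c : Fin r) (v : FreeIdx m r n → ℝ) :
    embL i j c v = if h : (i : ℕ) = 0 ∨ ((j : ℕ) ≠ 0) then v ⟨⟨i, (j, c)⟩, h⟩ else 0 := by
  unfold embL
  split_ifs <;> rfl

lemma emb_eq (i : Fin m) (j : Fin (n i)) (c : Fin r) (x : FreeIdx m r n → ℝ) :
    embTheta (fun _ _ => 1) x i j c =
      embL i j c x + if (i : ℕ) = 0 ∨ ((j : ℕ) ≠ 0) then 0 else 1 := by
  rw [embL_apply]
  unfold embTheta
  split_ifs <;> simp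

lemma emb_fd (i : Fin m) (j : Fin (n i)) (c : Fin r) (x : FreeIdx m r n → ℝ) :
    HasFDerivAt (fun x => embTheta (fun _ _ => 1) x i j c) (embL i j c) x := by
  simp only [emb_eq]
  exact (embL i j c).hasFDerivAt.add_const _

lemma emb_cd (i : Fin m) (j : Fin (n i)) (c : Fin r) :
    ContDiff ℝ 2 (fun x : FreeIdx m r n → ℝ => embTheta (fun _ _ => 1) x i j c) := by
  simp only [emb_eq]
  exact (embL i j c).contDiff.add contDiff_const

lemma emb_poly (i : Fin m) (j : Fin (n i)) (c : Fin r) :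
    (fun x : FreeIdx m r n → ℝ => embTheta (fun _ _ => 1) x i j c) ∈
      PolyFn (FreeIdx m r n → ℝ) := by
  simp only [emb_eq]
  exact poly_add (poly_lin ((embL i j c : (FreeIdx m r n → ℝ) →L[ℝ] ℝ) :
    (FreeIdx m r n → ℝ) →ₗ[ℝ] ℝ)) (poly_const _)

/-- the Jacobian of one entry -/
def jacE (x : FreeIdx m r n → ℝ) (idx : (i : Fin m) → Fin (n i)) :
    (FreeIdx m r n → ℝ) →L[ℝ] ℝ :=
  ∑ c : Fin r, ∑ i : Fin m,
    (∏ j ∈ Finset.univ.erase i, embTheta (fun _ _ => 1) x j (idx j) c) • embL i (idx i) c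

lemma jac_fd (x : FreeIdx m r n → ℝ) (idx : (i : Fin m) → Fin (n i)) :
    HasFDerivAt (fun x => cpEntry (embTheta (fun _ _ => 1) x) idx) (jacE x idx) x := by
  unfold cpEntry jacE
  refine HasFDerivAt.fun_sum fun c _ => ?_
  exact HasFDerivAt.finsetProd fun i _ => emb_fd i (idx i) c x

lemma cp_cd (idx : (i : Fin m) → Fin (n i)) :
    ContDiff ℝ 2 (fun x : FreeIdx m r n → ℝ => cpEntry (embTheta (fun _ _ => 1) x) idx) := by
  unfold cpEntry
  exact ContDiff.sum fun c _ => contDiff_prod fun i _ => emb_cd i (idx i) c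

lemma jac_apply (x v : FreeIdx m r n → ℝ) (idx : (i : Fin m) → Fin (n i)) :
    jacE x idx v = ∑ c : Fin r, ∑ i : Fin m, embL i (idx i) c v *
      ∏ j, if j = i then 1 else embTheta (fun _ _ => 1) x j (idx j) c := by
  simp only [jacE, _root_.sum_apply, _root_.smul_apply, smul_eq_mul]
  refine Finset.sum_congr rfl fun c _ => Finset.sum_congr rfl fun i _ => ?_
  rw [mul_comm]
  congr 1
  rw [← Finset.mul_prod_erase Finset.univ _ (Finset.mem_univ i)]
  simp only [if_true, one_mul]
  refine Finset.prod_congr rfl fun j hj => ?_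
  rw [if_neg (Finset.ne_of_mem_erase hj)]

/-- the Jacobian -/
def jacM (x : FreeIdx m r n → ℝ) :
    (FreeIdx m r n → ℝ) →ₗ[ℝ] (((i : Fin m) → Fin (n i)) → ℝ) :=
  LinearMap.pi fun idx => (jacE x idx : (FreeIdx m r n → ℝ) →ₗ[ℝ] ℝ)

lemma jac_poly (v : FreeIdx m r n → ℝ) (idx : (i : Fin m) → Fin (n i)) :
    (fun x => jacM x v idx) ∈ PolyFn (FreeIdx m r n → ℝ) := by
  have : ∀ x, jacM x v idx = jacE x idx v := fun x => rfl
  simp only [this, jac_apply]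
  refine poly_sum _ fun c => poly_sum _ fun i => poly_mul (poly_const _) (poly_prod _ fun j => ?_)
  by_cases h : j = i
  · simp only [h, if_true]; exact poly_const 1
  · simp only [h, if_false]; exact emb_poly _ _ _

end

lemma jac_inj {k r : ℕ} (n : Fin (k + 1) → ℕ)
    (h : SInd (n 0) (fun i : Fin k => n i.succ) r) :
    ∃ x0 : FreeIdx (k + 1) r n → ℝ, ∀ v, jacM x0 v = 0 → v = 0 := by
  obtain ⟨u, x, h⟩ := h
  let W : (i : Fin (k + 1)) → Fin (n i) → Fin r → ℝ :=
    Fin.cons (α := fun i => Fin (n i) → Fin r → ℝ) (fun j c => u c j)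
      (fun i j c => hh (x c i) j)
  have hW0 : ∀ j c, W 0 j c = u c j := fun j c => rfl
  have hWs : ∀ (i : Fin k) j c, W i.succ j c = hh (x c i) j := fun i j c => rfl
  let x0 : FreeIdx (k + 1) r n → ℝ := fun p => W p.1.1 p.1.2.1 p.1.2.2
  have hx0 : ∀ i j c, embTheta (fun _ _ => 1) x0 i j c = W i j c := by
    intro i j c
    unfold embTheta
    split_ifs with hi
    · rfl
    · push Not at hi
      obtain ⟨hi, hj⟩ := hi
      induction i using Fin.cases with
      | zero => exact absurd rfl hi
      | succ i => rw [hWs]; simp [hh, hj]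
  refine ⟨x0, fun v hv => ?_⟩
  let V : Fin r → Fin (n 0) → ℝ := fun c a => v ⟨⟨0, (a, c)⟩, Or.inl rfl⟩
  let y : Fin r → SX (fun i : Fin k => n i.succ) := fun c i j =>
    v ⟨⟨i.succ, (j.1, c)⟩, Or.inr j.2⟩
  have hV : ∀ a c, embL 0 a c v = V c a := by
    intro a c
    rw [embL_apply]
    exact dif_pos (Or.inl rfl)
  have hy : ∀ (i : Fin k) j c, embL i.succ j c v = hd (y c i) j := by
    intro i j c
    rw [embL_apply, hd_apply]
    by_cases hj : (j : ℕ) = 0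
    · rw [dif_neg (by simp [hj]), dif_neg (by simp [hj])]
    · rw [dif_pos (Or.inr hj), dif_pos hj]
  obtain ⟨h1, h2⟩ := h V y (fun a => by
    ext idx
    have := congrFun hv (Fin.cons (α := fun i => Fin (n i)) a idx)
    have e : ∀ idx, jacM x0 v idx = jacE x0 idx v := fun _ => rfl
    rw [e, jac_apply] at this
    refine Eq.trans ?_ this
    simp only [Finset.sum_apply, Pi.add_apply, Pi.smul_apply, smul_eq_mul, sφ, sD_apply,
      Fin.prod_univ_succ, Fin.sum_univ_succ, Fin.cons_zero, Fin.cons_succ, hx0, hW0, hWs, hV, hy,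
      one_mul, Fin.succ_ne_zero, if_false, if_true, Fin.succ_inj, Ne.symm (Fin.succ_ne_zero _)]
    refine Finset.sum_congr rfl fun c _ => ?_
    congr 1
    rw [Finset.mul_sum]
    refine Finset.sum_congr rfl fun i _ => ?_
    ring)
  ext ⟨⟨i, j, c⟩, hp⟩
  induction i using Fin.cases with
  | zero => exact congrFun (congrFun h1 c) j
  | succ i =>
    have hj : (j : ℕ) ≠ 0 := hp.resolve_left (by simp)
    exact congrFun (congrFun (congrFun h2 c) i) ⟨j, hj⟩

end CPH

/-- Let `N 1 ≥ ⋯ ≥ N m` (`m ≥ 3`) and `r ≤ r_m`.  For normalized parameters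
`Θ̃* = (U₁*, Ũ₂*, …, Ũ_m*)` set `A = [[U₁*, [1ᵀ;Ũ₂*], …, [1ᵀ;Ũ_m*]]]` and
`f̃(Θ̃) = ‖A − [[U₁, [1ᵀ;Ũ₂], …, [1ᵀ;Ũ_m]]]‖_F²`.  Then for generic `Θ̃*` the Hessian
`∇²f̃(Θ̃*)` is positive definite: the set of bad `Θ̃*` is contained in the zero set of a
nonzero polynomial in the entries of `Θ̃*`. -/
theorem cp_normalized_hessian_posdef_generic
    (m r : ℕ) (hm : 3 ≤ m) (N : ℕ → ℕ)
    (hmono : ∀ i j : ℕ, 1 ≤ i → i ≤ j → j ≤ m → N j ≤ N i)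
    (hr : r ≤ rankBound N m m) :
    ∃ P : MvPolynomial (FreeIdx m r fun i => N ((i : ℕ) + 1)) ℝ, P ≠ 0 ∧
      ∀ xstar : FreeIdx m r (fun i => N ((i : ℕ) + 1)) → ℝ,
        MvPolynomial.eval xstar P ≠ 0 →
        ∀ v : FreeIdx m r (fun i => N ((i : ℕ) + 1)) → ℝ, v ≠ 0 →
          0 < iteratedFDeriv ℝ 2
              (fun x : FreeIdx m r (fun i => N ((i : ℕ) + 1)) → ℝ =>
                ∑ idx : (i : Fin m) → Fin (N ((i : ℕ) + 1)),
                  (cpEntry (embTheta (fun _ _ => 1) xstar) idx -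
                    cpEntry (embTheta (fun _ _ => 1) x) idx) ^ 2)
              xstar ![v, v] := by
  obtain ⟨k, rfl⟩ : ∃ k, m = (k + 2) + 1 := ⟨m - 3, by omega⟩
  have hS : CPH.SInd (N (0 + 1)) (fun i : Fin (k + 2) => N (0 + 2 + i)) r :=
    CPH.SInd.main _ N hmono k 0 (by omega) r hr
  have e : (fun i : Fin (k + 2) => N (0 + 2 + i)) =
      fun i : Fin (k + 2) => N (((i.succ : Fin (k + 2 + 1)) : ℕ) + 1) := by
    ext i
    congr 1
    simp
    omega
  rw [e] at hS
  obtain ⟨x0, hx0⟩ := CPH.jac_inj (fun i : Fin (k + 2 + 1) => N ((i : ℕ) + 1)) hS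
  obtain ⟨f, hf, ⟨z, hz⟩, hgen⟩ := CPH.gen_inj CPH.jacM CPH.jac_poly x0 hx0
  obtain ⟨P, hP⟩ := CPH.poly_mv hf
  refine ⟨P, ?_, fun xstar hx v hv => ?_⟩
  · rintro rfl
    exact hz (by rw [hP]; simp)
  rw [← hP] at hx
  have hinj := hgen xstar hx v
  rw [CPH.hess_gen (fun idx x => cpEntry (embTheta (fun _ _ => 1) x) idx)
    (fun idx => CPH.cp_cd idx) xstar v]
  simp only [(CPH.jac_fd xstar _).fderiv]
  refine mul_pos two_pos ?_
  refine lt_of_le_of_ne (Finset.sum_nonneg fun _ _ => sq_nonneg _) fun h0 => hv (hinj ?_)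
  ext idx
  have := (Finset.sum_eq_zero_iff_of_nonneg (fun _ _ => sq_nonneg _)).1 h0.symm idx
    (Finset.mem_univ _)
  exact pow_eq_zero_iff (two_ne_zero) |>.1 this
end
end

section
/- Let N_1 ≥ N_2 ≥ ⋯ ≥ N_m (m ≥ 3) and r ≤ r_m (with r_m defined by the recursion r_3 := Ñ_{m−2}·⌊Ñ_{m−1}Ñ_m/(Ñ_{m−2}+Ñ_{m−1}+Ñ_m−2)⌋, where Ñ_{m−2}, Ñ_{m−1}, Ñ_m are the largest integers with Ñ_{m−2} even, Ñ_{m−2} ≥ Ñ_{m−1} ≥ Ñ_m and N_i ≥ Ñ_i for i = m−2, m−1, m; and r_k := N_{m−k+1}·min{ r_{k−1}, ⌊N_{m−k+2}⋯N_m/(N_{m−k+1}+⋯+N_m−k+1)⌋ } for k = 4,…,m). Let u_2,…,u_m ∈ ℝ^r be vectors all of whose entries are nonzero. For Θ̃* = (U_1*, Ũ_2*, …, Ũ_m*) with U_1* ∈ ℝ^{N_1×r}, Ũ_i* ∈ ℝ^{(N_i−1)×r}, set A := [[U_1*, [u_2ᵀ;Ũ_2*], …, [u_mᵀ;Ũ_m*]]]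 and f̃_A(Θ̃) := ‖A − [[U_1, [u_2ᵀ;Ũ_2], …, [u_mᵀ;Ũ_m]]]‖_F². Then for generic Θ̃*, the Hessian ∇²f̃_A(Θ̃*) is positive definite, and there exist an open set O containing Θ̃* and a constant λ > 0 such that f̃_A is λ-strongly convex on O. -/
noncomputable section

def PolyFun {τ : Type*} (f : (τ → ℝ) → ℝ) : Prop :=
  ∃ p : MvPolynomial τ ℝ, ∀ x, MvPolynomial.eval x p = f x

namespace PolyFun
variable {τ : Type*}
lemma const (a : ℝ) : PolyFun (fun _ : τ → ℝ => a) := ⟨MvPolynomial.C a, by simp⟩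
lemma coord (t : τ) : PolyFun (fun x : τ → ℝ => x t) := ⟨MvPolynomial.X t, by simp⟩
lemma mul {f g : (τ → ℝ) → ℝ} (hf : PolyFun f) (hg : PolyFun g) :
    PolyFun (fun x => f x * g x) := by
  obtain ⟨p, hp⟩ := hf
  obtain ⟨q, hq⟩ := hg
  exact ⟨p * q, by simp [hp, hq]⟩
lemma sub {f g : (τ → ℝ) → ℝ} (hf : PolyFun f) (hg : PolyFun g) :
    PolyFun (fun x => f x - g x) := by
  obtain ⟨p, hp⟩ := hf
  obtain ⟨q, hq⟩ := hg
  exact ⟨p - q, by simp [hp, hq]⟩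
lemma sum {α : Type*} (s : Finset α) {f : α → (τ → ℝ) → ℝ} (hf : ∀ a, PolyFun (f a)) :
    PolyFun (fun x => ∑ a ∈ s, f a x) := by
  choose p hp using hf
  exact ⟨∑ a ∈ s, p a, by simp [hp]⟩
lemma prod {α : Type*} (s : Finset α) {f : α → (τ → ℝ) → ℝ} (hf : ∀ a, PolyFun (f a)) :
    PolyFun (fun x => ∏ a ∈ s, f a x) := by
  choose p hp using hf
  exact ⟨∏ a ∈ s, p a, by simp [hp]⟩
lemma ite {f g : (τ → ℝ) → ℝ} (c : Prop) [Decidable c] (hf : PolyFun f) (hg : PolyFun g) :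
    PolyFun (fun x => if c then f x else g x) := by
  by_cases h : c <;> simpa [h]
lemma comp {σ : Type*} {f : (τ → ℝ) → ℝ} (hf : PolyFun f) (e : τ → σ) :
    PolyFun (fun x : σ → ℝ => f (fun t => x (e t))) := by
  obtain ⟨p, hp⟩ := hf
  refine ⟨MvPolynomial.rename e p, fun x => ?_⟩
  rw [MvPolynomial.eval_rename, hp]
  rfl
end PolyFun

lemma open_inj {ι J τ : Type*} [Fintype ι] [Fintype J] (f : J → ι → (τ → ℝ) → ℝ)
    (hf : ∀ j k, PolyFun (f j k)) :
    ∃ P : MvPolynomial τ ℝ, ∀ x, MvPolynomial.eval x P ≠ 0 ↔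
      ∀ g : ι → ℝ, (∀ j, ∑ k, g k * f j k x = 0) → g = 0 := by
  classical
  choose p hp using hf
  let M : Matrix J ι (MvPolynomial τ ℝ) := Matrix.of p
  refine ⟨(M.transpose * M).det, fun x => ?_⟩
  let A : Matrix J ι ℝ := Matrix.of fun j k => f j k x
  have h1 : MvPolynomial.eval x (M.transpose * M).det = (A.transpose * A).det := by
    rw [RingHom.map_det]
    congr 1
    ext j k
    simp [Matrix.mul_apply, M, A, hp]
  rw [h1, not_iff_comm, ← Matrix.exists_mulVec_eq_zero_iff]
  have h2 : ∀ v, (A.transpose * A).mulVec v = 0 ↔ A.mulVec v = 0 := by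
    intro v
    have := Matrix.conjTranspose_mul_self_mulVec_eq_zero A v
    rwa [Matrix.conjTranspose_eq_transpose_of_trivial] at this
  simp only [h2]
  have h3 : ∀ v : ι → ℝ, A.mulVec v = 0 ↔ ∀ j, ∑ k, v k * f j k x = 0 := by
    intro v
    simp [funext_iff, Matrix.mulVec, dotProduct, A, mul_comm]
  simp only [h3]
  push Not
  constructor
  · rintro ⟨g, h, h'⟩; exact ⟨g, h', h⟩
  · rintro ⟨g, h, h'⟩; exact ⟨g, h', h⟩

lemma exists_eval_ne {κ τ : Type*} [Fintype κ] (p : κ → MvPolynomial τ ℝ)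
    (hp : ∀ k, ∃ x, MvPolynomial.eval x (p k) ≠ 0) :
    ∃ x, ∀ k, MvPolynomial.eval x (p k) ≠ 0 := by
  have h : ∏ k, p k ≠ 0 := by
    rw [Finset.prod_ne_zero_iff]
    rintro k - h0
    obtain ⟨x, hx⟩ := hp k
    simp [h0] at hx
  by_contra! hc
  apply h
  apply MvPolynomial.funext
  intro x
  obtain ⟨k, hk⟩ := hc x
  rw [MvPolynomial.eval_prod, map_zero]
  exact Finset.prod_eq_zero (Finset.mem_univ k) hk

/-- simultaneous version -/
lemma open_inj_simul {κ τ : Type*} [Fintype κ] {ι J : κ → Type*} [∀ k, Fintype (ι k)]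
    [∀ k, Fintype (J k)] (f : ∀ k, J k → ι k → (τ → ℝ) → ℝ)
    (hf : ∀ k j i, PolyFun (f k j i))
    (hx : ∀ k, ∃ x, ∀ g : ι k → ℝ, (∀ j, ∑ i, g i * f k j i x = 0) → g = 0) :
    ∃ x, ∀ k, ∀ g : ι k → ℝ, (∀ j, ∑ i, g i * f k j i x = 0) → g = 0 := by
  choose P hP using fun k => open_inj (f k) (hf k)
  obtain ⟨x, h⟩ := exists_eval_ne P (fun k => by
    obtain ⟨x, h⟩ := hx k
    exact ⟨x, (hP k x).2 h⟩)
  exact ⟨x, fun k => (hP k x).1 (h k)⟩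

section models
variable {I τ S : Type} [Fintype S]

def ND (h : (τ → ℝ) → I → ℝ) (D : S → (τ → ℝ) → I → ℝ) (A R : Type) [Fintype R] : Prop :=
  ∃ x : R → A → ℝ, ∃ y : R → τ → ℝ, ∀ (β : R → A → ℝ) (γ : R → S → ℝ),
    (∀ a i, ∑ c, (β c a * h (y c) i + x c a * ∑ s, γ c s * D s (y c) i) = 0) → β = 0 ∧ γ = 0

def SP (h : (τ → ℝ) → I → ℝ) (D : S → (τ → ℝ) → I → ℝ) (A K Ω : Type) [Fintype K]
    [Fintype Ω] : Prop :=
  ∃ x : K → A → ℝ, ∃ y : K → τ → ℝ, ∃ y' : Ω → τ → ℝ,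
    ∀ (β : K → A → ℝ) (γ : K → S → ℝ) (β' : Ω → A → ℝ),
    (∀ a i, ∑ c, (β c a * h (y c) i + x c a * ∑ s, γ c s * D s (y c) i)
      + ∑ o, β' o a * h (y' o) i = 0) → β = 0 ∧ γ = 0 ∧ β' = 0

lemma ND.reindex {h : (τ → ℝ) → I → ℝ} {D : S → (τ → ℝ) → I → ℝ} {A R R' : Type} [Fintype R]
    [Fintype R'] (e : R' ↪ R) (H : ND h D A R) : ND h D A R' := by
  classical
  obtain ⟨x, y, H⟩ := H
  refine ⟨x ∘ e, y ∘ e, fun β γ hrel => ?_⟩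
  have key : ∀ (F : R → ℝ), (∀ c, c ∉ Set.range e → F c = 0) → ∑ c, F c = ∑ c, F (e c) := by
    intro F hF
    rw [← Finset.sum_map Finset.univ e F]
    symm
    apply Finset.sum_subset (Finset.subset_univ _)
    intro c _ hc
    apply hF
    simpa using hc
  have inj := e.injective
  obtain ⟨h1, h2⟩ := H (Function.extend e β 0) (Function.extend e γ 0) (by
    intro a i
    rw [key]
    · simpa [inj.extend_apply] using hrel a i
    · intro c hc
      have hc' : ¬ ∃ a, e a = c := by simpa using hc
      simp [Function.extend_apply' _ _ _ hc'])
  constructor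
  · ext c a
    have := congrFun (congrFun h1 (e c)) a
    simpa [inj.extend_apply] using this
  · ext c a
    have := congrFun (congrFun h2 (e c)) a
    simpa [inj.extend_apply] using this

lemma ND.extend {h : (τ → ℝ) → I → ℝ} {D : S → (τ → ℝ) → I → ℝ} {A A' R : Type} [Fintype R]
    [Nonempty A] (e : A ↪ A') (H : ND h D A R) : ND h D A' R := by
  classical
  obtain ⟨x, y, H⟩ := H
  have inj := e.injective
  refine ⟨fun c => Function.extend e (x c) 0, y, fun β γ hrel => ?_⟩
  obtain ⟨h1, h2⟩ := H (fun c a => β c (e a)) γ (by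
    intro a i
    simpa [inj.extend_apply] using hrel (e a) i)
  refine ⟨?_, h2⟩
  obtain ⟨a0⟩ := ‹Nonempty A›
  ext c a
  by_cases ha : ∃ b, e b = a
  · obtain ⟨b, rfl⟩ := ha
    exact congrFun (congrFun h1 c) b
  · obtain ⟨h3, -⟩ := H (fun c b => if b = a0 then β c a else 0) 0 (by
      intro b i
      by_cases hb : b = a0
      · have := hrel a i
        simpa [Function.extend_apply' _ _ _ ha, hb] using this
      · simp [hb])
    have := congrFun (congrFun h3 c) a0
    simpa using this

lemma ND.transfer {I' τ' S' : Type} [Fintype S']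
    {h : (τ → ℝ) → I → ℝ} {D : S → (τ → ℝ) → I → ℝ}
    {h' : (τ' → ℝ) → I' → ℝ} {D' : S' → (τ' → ℝ) → I' → ℝ} {A R : Type} [Fintype R]
    (φ : (τ → ℝ) → τ' → ℝ) (e : S' ≃ S) (L : (I → ℝ) →ₗ[ℝ] (I' → ℝ))
    (hL : Function.Injective L) (hh : ∀ y, h' (φ y) = L (h y))
    (hD : ∀ s y, D' s (φ y) = L (D (e s) y))
    (H : ND h D A R) : ND h' D' A R := by
  obtain ⟨x, y, H⟩ := H
  refine ⟨x, fun c => φ (y c), fun β γ hrel => ?_⟩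
  obtain ⟨h1, h2⟩ := H β (fun c s => γ c (e.symm s)) (by
    intro a
    have : (∑ c, (β c a • h (y c) + x c a • ∑ s, γ c (e.symm s) • D s (y c))) = 0 := by
      apply hL
      rw [map_zero]
      funext i
      have := hrel a i
      simp only [map_sum, map_add, map_smul]
      simp only [hh, hD] at this
      simp only [Finset.sum_apply, Pi.add_apply, Pi.smul_apply, smul_eq_mul, Pi.zero_apply]
      rw [← this]
      refine Finset.sum_congr rfl fun c _ => ?_
      congr 2
      rw [← e.sum_comp]
      simp
    intro i
    have := congrFun this i
    simpa using this)
  refine ⟨h1, ?_⟩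
  ext c s
  have := congrFun (congrFun h2 c) (e s)
  simpa using this

variable [Fintype I]

lemma glue {h : (τ → ℝ) → I → ℝ} {D : S → (τ → ℝ) → I → ℝ}
    (ph : ∀ i, PolyFun (fun y => h y i)) (pD : ∀ s i, PolyFun (fun y => D s y i))
    (n : ℕ) (A K : Type) [Fintype A] [Fintype K] (H : SP h D A K (Fin n × K)) :
    ND h D (Fin (n+1) × A) (Fin (n+1) × K) := by
  classical
  obtain ⟨ξ, y, y', H⟩ := H
  let f : Fin (n+1) → (A × I) → (((Fin (n+1) × K) × A) ⊕ (K × S)) →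
      (((Fin (n+1) × K) × (A ⊕ τ)) → ℝ) → ℝ := fun i0 ai k X =>
    Sum.elim (fun ca => if ca.2 = ai.1 then h (fun t => X (ca.1, Sum.inr t)) ai.2 else 0)
      (fun ks => X ((i0, ks.1), Sum.inl ai.1) *
        D ks.2 (fun t => X ((i0, ks.1), Sum.inr t)) ai.2) k
  obtain ⟨X, hX⟩ := open_inj_simul (κ := Fin (n+1)) f (by
    rintro i0 ⟨a, i⟩ (⟨c, a'⟩ | ⟨k, s⟩)
    · exact PolyFun.ite _ ((ph i).comp (fun t => (c, Sum.inr t))) (PolyFun.const 0)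
    · exact (PolyFun.coord _).mul ((pD s i).comp (fun t => ((i0, k), Sum.inr t)))) (by
    intro i0
    refine ⟨fun p => Sum.elim (fun a => ξ p.1.2 a)
      (fun t => (i0.insertNth (α := fun _ => ℝ) (y p.1.2 t) (fun i' => y' (i', p.1.2) t)) p.1.1) p.2,
      fun g hg => ?_⟩
    obtain ⟨h1, h2, h3⟩ := H (fun k a => g (Sum.inl ((i0, k), a))) (fun k s => g (Sum.inr (k, s)))
      (fun o a => g (Sum.inl ((i0.succAbove o.1, o.2), a))) (by
      intro a i
      have := hg (a, i)
      simp only [f, Fintype.sum_sum_type, Fintype.sum_prod_type, Sum.elim_inl, Sum.elim_inr,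
        Fin.sum_univ_succAbove _ i0, Fin.insertNth_apply_same, Fin.insertNth_apply_succAbove,
        mul_ite, mul_zero, Finset.sum_ite_eq', Finset.mem_univ, if_true] at this
      rw [← this]
      simp only [Finset.sum_add_distrib, Fintype.sum_prod_type, Finset.mul_sum]
      have e1 : ∀ k s, ξ k a * (g (Sum.inr (k, s)) * D s (y k) i)
        = g (Sum.inr (k, s)) * (ξ k a * D s (y k) i) := by intros; ring
      simp only [e1]
      ring)
    ext (⟨⟨j, k⟩, a⟩ | ⟨k, s⟩)
    · rcases Fin.eq_self_or_eq_succAbove i0 j with rfl | ⟨j', rfl⟩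
      · exact congrFun (congrFun h1 k) a
      · exact congrFun (congrFun h3 (j', k)) a
    · exact congrFun (congrFun h2 k) s)
  refine ⟨fun c p => if c.1 = p.1 then X (c, Sum.inl p.2) else 0, fun c t => X (c, Sum.inr t),
    fun β γ hrel => ?_⟩
  have key : ∀ j, (∀ c a, β c (j, a) = 0) ∧ ∀ k s, γ (j, k) s = 0 := by
    intro j
    have := hX j (Sum.elim (fun ca => β ca.1 (j, ca.2)) (fun ks => γ (j, ks.1) ks.2)) (by
      rintro ⟨a, i⟩
      have := hrel (j, a) i
      rw [← this]
      simp only [f, Fintype.sum_sum_type, Fintype.sum_prod_type, Sum.elim_inl, Sum.elim_inr,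
        mul_ite, mul_zero, Finset.sum_ite_eq', Finset.mem_univ, if_true, Finset.sum_add_distrib,
        ite_mul, zero_mul]
      congr 1
      rw [Finset.sum_comm]
      conv_rhs => rw [Finset.sum_comm]
      simp only [Finset.sum_ite_eq', Finset.mem_univ, if_true, Finset.mul_sum]
      rw [Finset.sum_comm]
      refine Finset.sum_congr rfl fun k _ => Finset.sum_congr rfl fun s _ => ?_
      ring)
    constructor
    · intro c a
      exact congrFun this (Sum.inl (c, a))
    · intro k s
      exact congrFun this (Sum.inr (k, s))
  constructor
  · ext c ⟨j, a⟩
    exact (key j).1 c a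
  · ext ⟨j, k⟩ s
    exact (key j).2 k s

/-- extension of an independent family by generic values of `h`. -/
lemma extend_indep {h : (τ → ℝ) → I → ℝ} [DecidableEq I]
    (sp : ∀ i, ∃ y, h y = Pi.single i 1) (w : ℕ) {κ : Type} [Fintype κ] (v : κ → I → ℝ)
    (hv : LinearIndependent ℝ v) (hc : Fintype.card κ + w ≤ Fintype.card I) :
    ∃ y : Fin w → τ → ℝ, LinearIndependent ℝ (Sum.elim v (fun o => h (y o))) := by
  induction w generalizing κ with
  | zero => 
    refine ⟨fun o => o.elim0, ?_⟩
    have e : Sum.elim v (fun o : Fin 0 => h (o.elim0)) ∘ (Equiv.sumEmpty κ (Fin 0)).symm = v := by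
      ext; simp
    rw [← linearIndependent_equiv (Equiv.sumEmpty κ (Fin 0)).symm]
    rw [e]; exact hv
  | succ w ih =>
    obtain ⟨y0, hy0⟩ : ∃ y0, h y0 ∉ Submodule.span ℝ (Set.range v) := by
      by_contra! hcon
      have : Submodule.span ℝ (Set.range v) = ⊤ := by
        rw [eq_top_iff, ← (Pi.basisFun ℝ I).span_eq, Submodule.span_le]
        rintro _ ⟨i, rfl⟩
        obtain ⟨y, hy⟩ := sp i
        have := hcon y
        rw [hy] at this
        simpa using this
      have h1 := finrank_span_eq_card hv
      rw [this, finrank_top, Module.finrank_fintype_fun_eq_card] at h1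
      omega
    have hv' : LinearIndependent ℝ (fun o : Option κ => o.casesOn' (h y0) v) :=
      hv.option hy0
    obtain ⟨y, hy⟩ := ih (κ := Option κ) _ hv' (by simp; omega)
    refine ⟨Fin.cons y0 y, ?_⟩
    let e : κ ⊕ Fin (w+1) → Option κ ⊕ Fin w :=
      Sum.elim (fun k => Sum.inl (some k)) (Fin.cons (Sum.inl none) (fun i => Sum.inr i))
    have he : Function.Injective e := by
      rintro (k | i) (k' | i')
      · simp [e]
      · refine Fin.cases ?_ (fun i' => ?_) i' <;> simp [e]
      · refine Fin.cases ?_ (fun i => ?_) i <;> simp [e]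
      · refine Fin.cases ?_ (fun i => ?_) i <;> refine Fin.cases ?_ (fun i' => ?_) i' <;> simp [e]
    have := hy.comp e he
    convert this using 1
    funext z
    rcases z with k | i
    · simp [e]
    · refine Fin.cases ?_ (fun i => ?_) i <;> simp [e]


def CND (h : (τ → ℝ) → I → ℝ) (D : S → (τ → ℝ) → I → ℝ) (R : Type) [Fintype R] : Prop :=
  ∃ y : R → τ → ℝ, ∀ (β : R → ℝ) (γ : R → S → ℝ),
    (∀ i, ∑ c, (β c * h (y c) i + ∑ s, γ c s * D s (y c) i) = 0) → β = 0 ∧ γ = 0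

lemma ND.nonzero {h : (τ → ℝ) → I → ℝ} {D : S → (τ → ℝ) → I → ℝ}
    (ph : ∀ i, PolyFun (fun y => h y i)) (pD : ∀ s i, PolyFun (fun y => D s y i))
    {A R : Type} [Fintype R] [Fintype A] (a0 : A) (H : ND h D A R) :
    ∃ x : R → A → ℝ, ∃ y : R → τ → ℝ, (∀ c, x c a0 ≠ 0) ∧ ∀ (β : R → A → ℝ) (γ : R → S → ℝ),
    (∀ a i, ∑ c, (β c a * h (y c) i + x c a * ∑ s, γ c s * D s (y c) i) = 0) →
      β = 0 ∧ γ = 0 := by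
  classical
  obtain ⟨x, y, H⟩ := H
  let f : (A × I) → ((R × A) ⊕ (R × S)) → ((R × (A ⊕ τ)) → ℝ) → ℝ := fun ai k X =>
    Sum.elim (fun ca => if ca.2 = ai.1 then h (fun t => X (ca.1, Sum.inr t)) ai.2 else 0)
      (fun cs => X (cs.1, Sum.inl ai.1) * D cs.2 (fun t => X (cs.1, Sum.inr t)) ai.2) k
  have hf : ∀ j k, PolyFun (f j k) := by
    rintro ⟨a, i⟩ (⟨c, a'⟩ | ⟨c, s⟩)
    · exact PolyFun.ite _ ((ph i).comp (fun t => (c, Sum.inr t))) (PolyFun.const 0)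
    · exact (PolyFun.coord _).mul ((pD s i).comp (fun t => (c, Sum.inr t)))
  obtain ⟨P, hP⟩ := open_inj f hf
  have hsum : ∀ (X : (R × (A ⊕ τ)) → ℝ) (g : (R × A) ⊕ (R × S) → ℝ) a i,
      ∑ k, g k * f (a, i) k X = ∑ c, (g (Sum.inl (c, a)) * h (fun t => X (c, Sum.inr t)) i +
        X (c, Sum.inl a) * ∑ s, g (Sum.inr (c, s)) * D s (fun t => X (c, Sum.inr t)) i) := by
    intro X g a i
    simp only [f, Fintype.sum_sum_type, Fintype.sum_prod_type, Sum.elim_inl, Sum.elim_inr,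
        mul_ite, mul_zero, Finset.sum_ite_eq', Finset.mem_univ, if_true, Finset.sum_add_distrib,
        Finset.mul_sum]
    congr 1
    refine Finset.sum_congr rfl fun k _ => Finset.sum_congr rfl fun s _ => ?_
    ring
  obtain ⟨X, hX⟩ := exists_eval_ne (κ := Option R)
    (fun o => o.elim P (fun c => MvPolynomial.X (c, Sum.inl a0))) (by
    rintro (_ | c)
    · refine ⟨fun p => Sum.elim (x p.1) (y p.1) p.2, (hP _).2 fun g hg => ?_⟩
      obtain ⟨h1, h2⟩ := H (fun c a => g (Sum.inl (c, a))) (fun c s => g (Sum.inr (c, s))) (by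
        intro a i
        have := (hsum (fun p => Sum.elim (x p.1) (y p.1) p.2) g a i).symm.trans (hg (a, i))
        simpa using this)
      ext (⟨c, a⟩ | ⟨c, s⟩)
      · exact congrFun (congrFun h1 c) a
      · exact congrFun (congrFun h2 c) s
    · exact ⟨fun _ => 1, by simp⟩)
  refine ⟨fun c a => X (c, Sum.inl a), fun c t => X (c, Sum.inr t), fun c => ?_, fun β γ hrel => ?_⟩
  · simpa using hX (some c)
  · have := (hP X).1 (hX none) (Sum.elim (fun ca => β ca.1 ca.2) (fun cs => γ cs.1 cs.2)) (by
      rintro ⟨a, i⟩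
      rw [hsum]
      simpa using hrel a i)
    constructor
    · ext c a
      exact congrFun this (Sum.inl (c, a))
    · ext c s
      exact congrFun this (Sum.inr (c, s))

lemma SP_of_CND {h : (τ → ℝ) → I → ℝ} {D : S → (τ → ℝ) → I → ℝ} [DecidableEq I]
    (sp : ∀ i, ∃ y, h y = Pi.single i 1) (n : ℕ) (K : Type) [Fintype K]
    (H : CND h D K) (hc : Fintype.card K * (n + 1 + Fintype.card S) ≤ Fintype.card I) :
    SP h D Unit K (Fin n × K) := by
  classical
  obtain ⟨y, H⟩ := H
  let v : K ⊕ (K × S) → I → ℝ := Sum.elim (fun k => h (y k)) (fun ks => D ks.2 (y ks.1))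
  have hv : LinearIndependent ℝ v := by
    rw [Fintype.linearIndependent_iff]
    intro g hg
    obtain ⟨h1, h2⟩ := H (fun k => g (Sum.inl k)) (fun k s => g (Sum.inr (k, s))) (by
      intro i
      have := congrFun hg i
      simpa [v, Fintype.sum_sum_type, Fintype.sum_prod_type, Finset.sum_add_distrib] using this)
    rintro (k | ⟨k, s⟩)
    · exact congrFun h1 k
    · exact congrFun (congrFun h2 k) s
  obtain ⟨z, hz⟩ := extend_indep sp (Fintype.card (Fin n × K)) v hv (by
    simp only [Fintype.card_sum, Fintype.card_prod, Fintype.card_fin]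
    refine le_trans (le_of_eq ?_) hc
    ring)
  let e := Fintype.equivFin (Fin n × K)
  refine ⟨fun _ _ => 1, y, fun o => z (e o), fun β γ β' hrel => ?_⟩
  rw [Fintype.linearIndependent_iff] at hz
  have := hz (Sum.elim (Sum.elim (fun k => β k ()) (fun ks => γ ks.1 ks.2))
    (fun o => β' (e.symm o) ())) (by
      funext i
      have := hrel () i
      rw [← e.symm.sum_comp] at this
      simpa [v, Fintype.sum_sum_type, Fintype.sum_prod_type, Finset.sum_add_distrib] using this)
  refine ⟨?_, ?_, ?_⟩
  · ext k ⟨⟩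
    exact this (Sum.inl (Sum.inl k))
  · ext k s
    exact this (Sum.inl (Sum.inr (k, s)))
  · ext o ⟨⟩
    simpa using this (Sum.inr (e o))

end models

section tm

def tmh {k : ℕ} (N : Fin k → ℕ) (y : (Σ i, Fin (N i)) → ℝ) (idx : ∀ i, Fin (N i)) : ℝ :=
  ∏ i, y ⟨i, idx i⟩

def tmD {k : ℕ} (N : Fin k → ℕ) (s : Σ i, {j : Fin (N i) // (j : ℕ) ≠ 0})
    (y : (Σ i, Fin (N i)) → ℝ) (idx : ∀ i, Fin (N i)) : ℝ :=
  ∏ l, if l = s.1 then (if idx s.1 = s.2 then 1 else 0) else y ⟨l, idx l⟩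

lemma tmh_poly {k : ℕ} (N : Fin k → ℕ) (i) : PolyFun (fun y => tmh N y i) :=
  PolyFun.prod _ fun _ => PolyFun.coord _

lemma tmD_poly {k : ℕ} (N : Fin k → ℕ) (s i) : PolyFun (fun y => tmD N s y i) :=
  PolyFun.prod _ fun _ => PolyFun.ite _ (PolyFun.const _) (PolyFun.coord _)

lemma tmh_span {k : ℕ} (N : Fin k → ℕ) (i) : ∃ y, tmh N y = Pi.single i 1 := by
  refine ⟨fun p => if i p.1 = p.2 then 1 else 0, ?_⟩
  ext j
  unfold tmh
  by_cases h : j = i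
  · subst h; simp
  · rw [Pi.single_eq_of_ne h]
    obtain ⟨a, ha⟩ := Function.ne_iff.1 h
    apply Finset.prod_eq_zero (Finset.mem_univ a)
    simp [Ne.symm ha]

lemma tmh_cons {k : ℕ} (N : Fin (k+1) → ℕ) (y : (Σ i, Fin (N i)) → ℝ) (j : Fin (N 0))
    (idx : ∀ i : Fin k, Fin (N i.succ)) :
    tmh N y (Fin.cons j idx) = y ⟨0, j⟩ * tmh (fun i => N i.succ) (fun p => y ⟨p.1.succ, p.2⟩) idx := by
  simp [tmh, Fin.prod_univ_succ]

lemma tmD_zero {k : ℕ} (N : Fin (k+1) → ℕ) (y : (Σ i, Fin (N i)) → ℝ) (j : Fin (N 0))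
    (idx : ∀ i : Fin k, Fin (N i.succ)) (j') :
    tmD N ⟨0, j'⟩ y (Fin.cons j idx) = (if j = j' then 1 else 0) *
      tmh (fun i => N i.succ) (fun p => y ⟨p.1.succ, p.2⟩) idx := by
  simp [tmD, tmh, Fin.prod_univ_succ, Fin.succ_ne_zero]

lemma tmD_succ {k : ℕ} (N : Fin (k+1) → ℕ) (y : (Σ i, Fin (N i)) → ℝ) (j : Fin (N 0))
    (idx : ∀ i : Fin k, Fin (N i.succ)) (i : Fin k) (j') :
    tmD N ⟨i.succ, j'⟩ y (Fin.cons j idx) = y ⟨0, j⟩ *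
      tmD (fun i => N i.succ) ⟨i, j'⟩ (fun p => y ⟨p.1.succ, p.2⟩) idx := by
  simp [tmD, Fin.prod_univ_succ, (Fin.succ_ne_zero _).symm]

lemma sum_sigma_succ {k : ℕ} {T : Fin (k+1) → Type} [∀ i, Fintype (T i)] (F : (Σ i, T i) → ℝ) :
    ∑ p, F p = ∑ t : T 0, F ⟨0, t⟩ + ∑ p : (Σ i : Fin k, T i.succ), F ⟨p.1.succ, p.2⟩ := by
  rw [Fintype.sum_sigma, Fin.sum_univ_succ, Fintype.sum_sigma]

lemma CND_of_ND {k : ℕ} (N : Fin (k+1) → ℕ) (R : Type) [Fintype R] (h0 : 0 < N 0)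
    (H : ND (tmh (fun i : Fin k => N i.succ)) (tmD (fun i : Fin k => N i.succ)) (Fin (N 0)) R) :
    CND (tmh N) (tmD N) R := by
  obtain ⟨x, y, hx, H⟩ := H.nonzero (tmh_poly _) (tmD_poly _) ⟨0, h0⟩
  let Y : R → (Σ i, Fin (N i)) → ℝ := fun c p =>
    Fin.cases (motive := fun i => Fin (N i) → ℝ) (x c) (fun i j => y c ⟨i, j⟩) p.1 p.2
  have hY0 : ∀ c j, Y c ⟨0, j⟩ = x c j := fun c j => rfl
  have hYs : ∀ c, (fun p : (Σ i : Fin k, Fin (N i.succ)) => Y c ⟨p.1.succ, p.2⟩) = y c :=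
    fun c => rfl
  refine ⟨Y, fun β γ hrel => ?_⟩
  obtain ⟨h1, h2⟩ := H (fun c j => β c * x c j +
      if hj : (j : ℕ) ≠ 0 then γ c ⟨0, ⟨j, hj⟩⟩ else 0)
    (fun c s => γ c ⟨s.1.succ, s.2⟩) (by
      intro j idx
      refine Eq.trans ?_ (hrel (Fin.cons j idx))
      refine Finset.sum_congr rfl fun c _ => ?_
      rw [sum_sigma_succ]
      simp only [tmh_cons, tmD_zero, tmD_succ, hY0, hYs]
      have e1 : ∑ t : {j : Fin (N 0) // (j : ℕ) ≠ 0}, γ c ⟨0, t⟩ *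
          ((if j = t.1 then 1 else 0) * tmh (fun i : Fin k => N i.succ) (y c) idx) =
          (if hj : (j : ℕ) ≠ 0 then γ c ⟨0, ⟨j, hj⟩⟩ else 0) *
            tmh (fun i : Fin k => N i.succ) (y c) idx := by
        split_ifs with hj
        · rw [Finset.sum_eq_single ⟨j, hj⟩]
          · simp
          · rintro ⟨b, hb⟩ - hne
            have : j ≠ b := fun h => hne (by simp [h])
            simp [this]
          · simp
        · rw [zero_mul]
          apply Finset.sum_eq_zero
          rintro ⟨b, hb⟩ -
          have : j ≠ b := fun h => hj (h ▸ hb)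
          simp [this]
      rw [e1, Finset.mul_sum]
      have e2 : ∀ s : (Σ i : Fin k, {j : Fin (N i.succ) // (j : ℕ) ≠ 0}),
        γ c ⟨s.1.succ, s.2⟩ * (x c j * tmD (fun i : Fin k => N i.succ) ⟨s.1, s.2⟩ (y c) idx) =
        x c j * (γ c ⟨s.1.succ, s.2⟩ * tmD (fun i : Fin k => N i.succ) s (y c) idx) := by
        intro s; ring
      simp only [e2]
      ring)
  have hβ : ∀ c, β c = 0 := by
    intro c
    have := congrFun (congrFun h1 c) ⟨0, h0⟩
    simpa [hx c] using this
  refine ⟨funext hβ, ?_⟩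
  ext c ⟨i, j⟩
  revert j
  refine Fin.cases ?_ (fun i => ?_) i
  · rintro ⟨j, hj⟩
    have := congrFun (congrFun h1 c) j
    simpa [hβ c, hj] using this
  · intro j
    exact congrFun (congrFun h2 c) ⟨i, j⟩

lemma ND_empty {I τ S : Type} [Fintype S] (h : (τ → ℝ) → I → ℝ) (D : S → (τ → ℝ) → I → ℝ)
    (A R : Type) [Fintype R] [IsEmpty R] : ND h D A R :=
  ⟨isEmptyElim, isEmptyElim, fun _ _ _ => ⟨Subsingleton.elim _ _, Subsingleton.elim _ _⟩⟩

/-- inductive step -/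
lemma ND_step {k : ℕ} (N : Fin (k+1) → ℕ) (n q r : ℕ) (hq : q ≤ r) (h0 : 0 < N 0)
    (hc : q * (n + ∑ i, (N i - 1)) ≤ ∏ i, N i)
    (H : ND (tmh (fun i : Fin k => N i.succ)) (tmD (fun i : Fin k => N i.succ)) (Fin (N 0))
      (Fin r)) :
    ND (tmh N) (tmD N) (Fin n) (Fin (n * q)) := by
  rcases n with _ | n
  · rw [zero_mul]; exact ND_empty _ _ _ _
  have H1 := CND_of_ND N (Fin q) h0 (H.reindex (Fin.castLEEmb hq))
  have hS : Fintype.card (Σ i, {j : Fin (N i) // (j : ℕ) ≠ 0}) = ∑ i, (N i - 1) := by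
    rw [Fintype.card_sigma]
    refine Finset.sum_congr rfl fun i _ => ?_
    generalize N i = a
    rcases a with _ | a
    · simp
    · have : ∀ j : Fin (a+1), (j : ℕ) ≠ 0 ↔ j ≠ 0 := fun j => not_congr Fin.val_eq_zero_iff
      simp only [this]
      rw [Fintype.card_subtype_compl]
      simp
  have H2 := SP_of_CND (tmh_span N) n (Fin q) H1 (by
    rw [hS]
    simpa using hc)
  have H3 := glue (tmh_poly N) (tmD_poly N) n Unit (Fin q) H2
  have H4 := ND.extend (A' := Fin (n+1)) (Equiv.prodPUnit _).toEmbedding H3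
  exact H4.reindex (finProdFinEquiv.symm.toEmbedding)

end tm

section base

def dirvec {B : Type} [Fintype B] [DecidableEq B] (b0 : B) (γ : {j // j ≠ b0} → ℝ) (i : B) : ℝ :=
  ∑ t, γ t * ((if i = t.1 then 1 else 0) - (if i = b0 then 1 else 0))

lemma dirvec_sum {B : Type} [Fintype B] [DecidableEq B] (b0 : B) (γ : {j // j ≠ b0} → ℝ) :
    ∑ i, dirvec b0 γ i = 0 := by
  unfold dirvec
  rw [Finset.sum_comm]
  apply Finset.sum_eq_zero
  intro t _
  rw [← Finset.mul_sum]
  simp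

lemma dirvec_apply {B : Type} [Fintype B] [DecidableEq B] (b0 : B) (γ : {j // j ≠ b0} → ℝ)
    (t : {j // j ≠ b0}) : dirvec b0 γ t = γ t := by
  unfold dirvec
  rw [Finset.sum_eq_single t]
  · simp [t.2]
  · intro s _ hs
    have : t.1 ≠ s.1 := fun h => hs (Subtype.ext h.symm)
    simp [this, t.2]
  · simp

lemma dirvec_zero {B : Type} [Fintype B] [DecidableEq B] (b0 : B) (γ : {j // j ≠ b0} → ℝ) (x : B)
    (h : ∀ i, i ≠ x → dirvec b0 γ i = 0) : γ = 0 ∧ ∀ i, dirvec b0 γ i = 0 := by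
  have h1 := dirvec_sum b0 γ
  rw [Finset.sum_eq_single x (fun i _ hi => h i hi) (by simp)] at h1
  have h2 : ∀ i, dirvec b0 γ i = 0 := by
    intro i
    by_cases hi : i = x
    · rw [hi, h1]
    · exact h i hi
  refine ⟨?_, h2⟩
  ext t
  rw [← dirvec_apply b0 γ t, h2]; rfl

variable {B C : Type} [Fintype B] [DecidableEq B] [Fintype C] [DecidableEq C]

def lh (y : B ⊕ C → ℝ) (p : B × C) : ℝ := y (Sum.inl p.1) * y (Sum.inr p.2)

def lD (b0 : B) (c0 : C) (s : {j : B // j ≠ b0} ⊕ {j : C // j ≠ c0}) (y : B ⊕ C → ℝ)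
    (p : B × C) : ℝ :=
  Sum.elim
    (fun t => ((if p.1 = t.1 then 1 else 0) - (if p.1 = b0 then 1 else 0)) * y (Sum.inr p.2))
    (fun t => y (Sum.inl p.1) * ((if p.2 = t.1 then 1 else 0) - (if p.2 = c0 then 1 else 0))) s

lemma lD_sum (b0 : B) (c0 : C) (γ : {j : B // j ≠ b0} ⊕ {j : C // j ≠ c0} → ℝ) (y : B ⊕ C → ℝ)
    (p : B × C) : ∑ s, γ s * lD b0 c0 s y p =
      dirvec b0 (fun t => γ (Sum.inl t)) p.1 * y (Sum.inr p.2) +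
      y (Sum.inl p.1) * dirvec c0 (fun t => γ (Sum.inr t)) p.2 := by
  simp only [lD, dirvec, Fintype.sum_sum_type, Sum.elim_inl, Sum.elim_inr, Finset.sum_mul,
    Finset.mul_sum]
  congr 1 <;> refine Finset.sum_congr rfl fun t _ => by ring

/-- positions -/
def ppos (q b' c' : ℕ) (ε : Fin 2) :
    ((Fin b' × Fin c') ⊕ (Fin q × Fin c') ⊕ (Fin b' × Fin q)) →
      ((Fin 2 × Fin q) ⊕ Fin b') × ((Fin 2 × Fin q) ⊕ Fin c') :=
  Sum.elim (fun p => (Sum.inr p.1, Sum.inr p.2))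
    (Sum.elim (fun p => (Sum.inl (ε, p.1), Sum.inr p.2)) (fun p => (Sum.inr p.1, Sum.inl (ε, p.2))))

lemma ppos_inj (q b' c' : ℕ) (ε : Fin 2) : Function.Injective (ppos q b' c' ε) := by
  rintro (⟨a, b⟩ | ⟨a, b⟩ | ⟨a, b⟩) (⟨a', b'⟩ | ⟨a', b'⟩ | ⟨a', b'⟩) <;> simp [ppos]

lemma exists_pts (q b' c' w : ℕ) (hw : w ≤ b' * c' + (q * c' + b' * q)) :
    ∃ y : Fin w → (((Fin 2 × Fin q) ⊕ Fin b') ⊕ ((Fin 2 × Fin q) ⊕ Fin c')) → ℝ,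
      ∀ ε : Fin 2, ∀ g : Fin w → ℝ,
        (∀ t, ∑ o, g o * lh (y o) (ppos q b' c' ε t) = 0) → g = 0 := by
  obtain ⟨X, hX⟩ := open_inj_simul (κ := Fin 2) (ι := fun _ => Fin w)
    (J := fun _ => ((Fin b' × Fin c') ⊕ (Fin q × Fin c') ⊕ (Fin b' × Fin q)))
    (τ := Fin w × (((Fin 2 × Fin q) ⊕ Fin b') ⊕ ((Fin 2 × Fin q) ⊕ Fin c')))
    (fun ε t o X => lh (fun s => X (o, s)) (ppos q b' c' ε t))
    (fun ε t o => (PolyFun.coord _).mul (PolyFun.coord _)) (by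
    intro ε
    obtain ⟨y, hy⟩ := extend_indep
      (h := fun (y : (((Fin 2 × Fin q) ⊕ Fin b') ⊕ ((Fin 2 × Fin q) ⊕ Fin c')) → ℝ) t =>
        lh y (ppos q b' c' ε t)) (by
        intro t
        refine ⟨Sum.elim (fun i => if i = (ppos q b' c' ε t).1 then 1 else 0)
          (fun i => if i = (ppos q b' c' ε t).2 then 1 else 0), ?_⟩
        ext t'
        simp only [lh, Sum.elim_inl, Sum.elim_inr]
        by_cases h : t' = t
        · subst h; simp
        · rw [Pi.single_eq_of_ne h]
          have : ppos q b' c' ε t' ≠ ppos q b' c' ε t := fun hh => h (ppos_inj _ _ _ _ hh)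
          rw [Ne, Prod.ext_iff, not_and_or] at this
          rcases this with h | h <;> simp [h]) w (κ := Empty) (fun e => e.elim)
        linearIndependent_empty_type (by simpa using hw)
    refine ⟨fun p => y p.1 p.2, fun g hg => ?_⟩
    rw [Fintype.linearIndependent_iff] at hy
    have := hy (Sum.elim (fun e => e.elim) g) (by
      funext t
      have := hg t
      simpa using this)
    ext o
    exact this (Sum.inr o))
  exact ⟨fun o s => X (o, s), hX⟩

lemma exists_pts2 (q b' c' w : ℕ) (hw : w ≤ b' * c' + (q * c' + b' * q)) :
    ∃ y : Fin w → (((Fin 2 × Fin q) ⊕ Fin b') ⊕ ((Fin 2 × Fin q) ⊕ Fin c')) → ℝ,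
    ∃ ξ : (Fin 2 × Fin q) → Fin 2 → ℝ,
      (∀ k, ξ k 0 ≠ 0) ∧ (∀ k l, k ≠ l → ξ k 0 * ξ l 1 - ξ k 1 * ξ l 0 ≠ 0) ∧
      ∀ g : Fin w → Fin 2 → ℝ,
        (∀ ε i j, ∑ o, g o ε * lh (y o) (Sum.inr i, Sum.inr j) = 0) →
        (∀ k j, ∑ o, (g o 0 * ξ k 1 - g o 1 * ξ k 0) * lh (y o) (Sum.inl k, Sum.inr j) = 0) →
        (∀ k i, ∑ o, (g o 0 * ξ k 1 - g o 1 * ξ k 0) * lh (y o) (Sum.inr i, Sum.inl k) = 0) →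
        g = 0 := by
  obtain ⟨y, hy⟩ := exists_pts q b' c' w hw
  let K := Fin 2 × Fin q
  let J := (Fin 2 × Fin b' × Fin c') ⊕ (K × Fin c') ⊕ (K × Fin b')
  let τ := (K × Fin 2) ⊕ (Fin w × ((K ⊕ Fin b') ⊕ (K ⊕ Fin c')))
  let co : (τ → ℝ) → K → Fin 2 → ℝ := fun X k ε =>
    if ε = 0 then X (Sum.inl (k, 1)) else 0 - X (Sum.inl (k, 0))
  let f : J → (Fin w × Fin 2) → (τ → ℝ) → ℝ := fun j oe X =>
    Sum.elim
      (fun p => if oe.2 = p.1 then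
        lh (fun t => X (Sum.inr (oe.1, t))) (Sum.inr p.2.1, Sum.inr p.2.2) else 0)
      (Sum.elim
        (fun p => co X p.1 oe.2 * lh (fun t => X (Sum.inr (oe.1, t))) (Sum.inl p.1, Sum.inr p.2))
        (fun p => co X p.1 oe.2 * lh (fun t => X (Sum.inr (oe.1, t))) (Sum.inr p.2, Sum.inl p.1))) j
  have pco : ∀ k ε, PolyFun (fun X => co X k ε) := fun k ε =>
    PolyFun.ite _ (PolyFun.coord _) ((PolyFun.const 0).sub (PolyFun.coord _))
  have plh : ∀ o p, PolyFun (fun X : τ → ℝ => lh (fun t => X (Sum.inr (o, t))) p) := fun o p =>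
    (PolyFun.coord _).mul (PolyFun.coord _)
  have hf : ∀ j oe, PolyFun (f j oe) := by
    rintro (⟨ε, i, j⟩ | ⟨k, j⟩ | ⟨k, i⟩) ⟨o, ε'⟩
    · exact PolyFun.ite _ (plh _ _) (PolyFun.const 0)
    · exact (pco _ _).mul (plh _ _)
    · exact (pco _ _).mul (plh _ _)
  have hs1 : ∀ (X : τ → ℝ) (g : Fin w × Fin 2 → ℝ) ε i j,
      ∑ oe, g oe * f (Sum.inl (ε, i, j)) oe X =
        ∑ o, g (o, ε) * lh (fun t => X (Sum.inr (o, t))) (Sum.inr i, Sum.inr j) := by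
    intro X g ε i j
    simp [f, Fintype.sum_prod_type]
  have hs2 : ∀ (X : τ → ℝ) (g : Fin w × Fin 2 → ℝ) k j,
      ∑ oe, g oe * f (Sum.inr (Sum.inl (k, j))) oe X =
        ∑ o, (g (o, 0) * X (Sum.inl (k, 1)) - g (o, 1) * X (Sum.inl (k, 0))) *
          lh (fun t => X (Sum.inr (o, t))) (Sum.inl k, Sum.inr j) := by
    intro X g k j
    simp only [f, co, Fintype.sum_prod_type, Sum.elim_inl, Sum.elim_inr, Fin.sum_univ_two, if_true,
      if_neg (one_ne_zero : (1 : Fin 2) ≠ 0)]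
    refine Finset.sum_congr rfl fun o _ => by ring
  have hs3 : ∀ (X : τ → ℝ) (g : Fin w × Fin 2 → ℝ) k i,
      ∑ oe, g oe * f (Sum.inr (Sum.inr (k, i))) oe X =
        ∑ o, (g (o, 0) * X (Sum.inl (k, 1)) - g (o, 1) * X (Sum.inl (k, 0))) *
          lh (fun t => X (Sum.inr (o, t))) (Sum.inr i, Sum.inl k) := by
    intro X g k j
    simp only [f, co, Fintype.sum_prod_type, Sum.elim_inl, Sum.elim_inr, Fin.sum_univ_two, if_true,
      if_neg (one_ne_zero : (1 : Fin 2) ≠ 0)]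
    refine Finset.sum_congr rfl fun o _ => by ring
  obtain ⟨P, hP⟩ := open_inj f hf
  obtain ⟨X, hX⟩ := exists_eval_ne (κ := Option (K ⊕ {p : K × K // p.1 ≠ p.2})) (τ := τ)
    (fun o => o.elim P (Sum.elim (fun k => MvPolynomial.X (Sum.inl (k, 0)))
      (fun p => MvPolynomial.X (Sum.inl (p.1.1, 0)) * MvPolynomial.X (Sum.inl (p.1.2, 1)) -
        MvPolynomial.X (Sum.inl (p.1.1, 1)) * MvPolynomial.X (Sum.inl (p.1.2, 0))))) (by
    rintro (_ | k | ⟨⟨k, l⟩, hkl⟩)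
    · let X0 : τ → ℝ := Sum.elim (fun ke => if ke.1.1 = ke.2 then 0 else 1) (fun p => y p.1 p.2)
      refine ⟨X0, (hP _).2 fun g hg => ?_⟩
      have e0 : (fun o => g (o, 0)) = 0 := by
        apply hy 0
        rintro (⟨i, j⟩ | ⟨l, j⟩ | ⟨i, l⟩)
        · exact (hs1 X0 g 0 i j).symm.trans (hg _)
        · have := (hs2 X0 g (0, l) j).symm.trans (hg _)
          simpa [X0, ppos] using this
        · have := (hs3 X0 g (0, l) i).symm.trans (hg _)
          simpa [X0, ppos] using this
      have e1 : (fun o => g (o, 1)) = 0 := by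
        apply hy 1
        rintro (⟨i, j⟩ | ⟨l, j⟩ | ⟨i, l⟩)
        · exact (hs1 X0 g 1 i j).symm.trans (hg _)
        · have := (hs2 X0 g (1, l) j).symm.trans (hg _)
          simpa [X0, ppos] using this
        · have := (hs3 X0 g (1, l) i).symm.trans (hg _)
          simpa [X0, ppos] using this
      ext ⟨o, ε⟩
      fin_cases ε
      · exact congrFun e0 o
      · exact congrFun e1 o
    · exact ⟨fun _ => 1, by simp⟩
    · refine ⟨Sum.elim (fun ke => if ke.1 = k then (if ke.2 = 0 then 1 else 0) else
        (if ke.2 = 0 then 0 else 1)) (fun _ => 0), ?_⟩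
      have : l ≠ k := Ne.symm hkl
      simp [this])
  refine ⟨fun o t => X (Sum.inr (o, t)), fun k ε => X (Sum.inl (k, ε)), fun k => ?_,
    fun k l hkl => ?_, fun g h1 h2 h3 => ?_⟩
  · simpa using hX (some (Sum.inl k))
  · simpa using hX (some (Sum.inr ⟨(k, l), hkl⟩))
  · have := (hP X).1 (hX none) (fun oe => g oe.1 oe.2) (by
      rintro (⟨ε, i, j⟩ | ⟨k, j⟩ | ⟨k, i⟩)
      · exact (hs1 _ _ _ _ _).trans (h1 _ _ _)
      · exact (hs2 _ _ _ _).trans (h2 _ _)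
      · exact (hs3 _ _ _ _).trans (h3 _ _))
    ext o ε
    exact congrFun this (o, ε)

lemma SP_base (q b' c' : ℕ) (Ω : Type) [Fintype Ω]
    (hw : Fintype.card Ω ≤ b' * c' + (q * c' + b' * q))
    (b0 : (Fin 2 × Fin q) ⊕ Fin b') (c0 : (Fin 2 × Fin q) ⊕ Fin c') :
    SP lh (lD b0 c0) (Fin 2) (Fin 2 × Fin q) Ω := by
  obtain ⟨y', ξ, hξ0, hξ, hg⟩ := exists_pts2 q b' c' _ hw
  let e := Fintype.equivFin Ω
  refine ⟨ξ, fun k => Sum.elim (fun i => if i = Sum.inl k then 1 else 0)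
    (fun i => if i = Sum.inl k then 1 else 0), fun o => y' (e o), fun β γ β' hrel => ?_⟩
  simp only [lD_sum] at hrel
  set p := fun k => dirvec b0 (fun t => γ k (Sum.inl t)) with hp
  set p' := fun k => dirvec c0 (fun t => γ k (Sum.inr t)) with hp'
  set Q : Fin 2 → _ → ℝ := fun ε ij => ∑ o, β' o ε * lh (y' (e o)) ij with hQ
  have hrel' : ∀ ε i j, ∑ k, (β k ε * ((if i = Sum.inl k then 1 else 0) *
      (if j = Sum.inl k then 1 else 0)) + ξ k ε * (p k i * (if j = Sum.inl k then 1 else 0) +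
      (if i = Sum.inl k then 1 else 0) * p' k j)) + Q ε (i, j) = 0 := fun ε i j => hrel ε (i, j)
  have r1 : ∀ ε i j, Q ε (Sum.inr i, Sum.inr j) = 0 := by
    intro ε i j
    simpa using hrel' ε (Sum.inr i) (Sum.inr j)
  have r2 : ∀ ε k j, ξ k ε * p' k (Sum.inr j) + Q ε (Sum.inl k, Sum.inr j) = 0 := by
    intro ε k j
    have := hrel' ε (Sum.inl k) (Sum.inr j)
    simpa using this
  have r3 : ∀ ε k i, ξ k ε * p k (Sum.inr i) + Q ε (Sum.inr i, Sum.inl k) = 0 := by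
    intro ε k i
    have := hrel' ε (Sum.inr i) (Sum.inl k)
    simpa using this
  have hQs : ∀ k ij, ∑ o, ((fun o ε => β' (e.symm o) ε) o 0 * ξ k 1 -
      (fun o ε => β' (e.symm o) ε) o 1 * ξ k 0) * lh (y' o) ij =
      Q 0 ij * ξ k 1 - Q 1 ij * ξ k 0 := by
    intro k ij
    rw [← e.sum_comp]
    simp only [hQ, Finset.sum_mul, ← Finset.sum_sub_distrib, Equiv.symm_apply_apply]
    refine Finset.sum_congr rfl fun o _ => by ring
  have hβ' : β' = 0 := by
    have := hg (fun o ε => β' (e.symm o) ε) (by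
      intro ε i j
      rw [← e.sum_comp]
      simpa using r1 ε i j) (by
      intro k j
      rw [hQs]
      linear_combination ξ k 1 * r2 0 k j - ξ k 0 * r2 1 k j) (by
      intro k j
      rw [hQs]
      linear_combination ξ k 1 * r3 0 k j - ξ k 0 * r3 1 k j)
    ext o ε
    simpa using congrFun (congrFun this (e o)) ε
  have hQ0 : ∀ ε ij, Q ε ij = 0 := by
    intro ε ij
    simp [hQ, hβ']
  have r4 : ∀ ε k l, k ≠ l → ξ l ε * p l (Sum.inl k) + ξ k ε * p' k (Sum.inl l) = 0 := by
    intro ε k l hkl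
    have := hrel' ε (Sum.inl k) (Sum.inl l)
    rw [hQ0, add_zero] at this
    simp only [Sum.inl.injEq, mul_add, Finset.sum_add_distrib, mul_ite, mul_one, mul_zero, ite_mul,
      one_mul, zero_mul, Finset.sum_ite_eq, Finset.mem_univ, if_true, if_neg hkl] at this
    linarith
  have hpz : ∀ k i, i ≠ Sum.inl k → p k i = 0 := by
    intro k i hi
    rcases i with i | i
    · have hne : i ≠ k := fun h => hi (by rw [h])
      have a0 := r4 0 i k hne
      have a1 := r4 1 i k hne
      have : (ξ k 0 * ξ i 1 - ξ k 1 * ξ i 0) * p k (Sum.inl i) = 0 := by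
        linear_combination ξ i 1 * a0 - ξ i 0 * a1
      exact (mul_eq_zero.1 this).resolve_left (hξ k i hne.symm)
    · have := r3 0 k i
      rw [hQ0, add_zero] at this
      exact (mul_eq_zero.1 this).resolve_left (hξ0 k)
  have hpz' : ∀ k i, i ≠ Sum.inl k → p' k i = 0 := by
    intro k i hi
    rcases i with i | i
    · have hne : i ≠ k := fun h => hi (by rw [h])
      have a0 := r4 0 k i hne.symm
      have a1 := r4 1 k i hne.symm
      have : (ξ k 0 * ξ i 1 - ξ k 1 * ξ i 0) * p' k (Sum.inl i) = 0 := by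
        linear_combination ξ i 1 * a0 - ξ i 0 * a1
      exact (mul_eq_zero.1 this).resolve_left (hξ k i hne.symm)
    · have := r2 0 k i
      rw [hQ0, add_zero] at this
      exact (mul_eq_zero.1 this).resolve_left (hξ0 k)
  have z1 := fun k => dirvec_zero b0 (fun t => γ k (Sum.inl t)) (Sum.inl k) (hpz k)
  have z2 := fun k => dirvec_zero c0 (fun t => γ k (Sum.inr t)) (Sum.inl k) (hpz' k)
  refine ⟨?_, ?_, hβ'⟩
  · ext k ε
    have := hrel' ε (Sum.inl k) (Sum.inl k)
    have y1 : ∀ k i, p k i = 0 := fun k => (z1 k).2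
    have y2 : ∀ k i, p' k i = 0 := fun k => (z2 k).2
    simpa [hQ0, y1, y2] using this
  · ext k (t | t)
    · exact congrFun (z1 k).1 t
    · exact congrFun (z2 k).1 t

/-- change of coordinates -/
def GG {b : ℕ} (e : Fin b ≃ B) (j : Fin b) (k : B) : ℝ :=
  if (j : ℕ) = 0 then 1 else if k = e j then 1 else 0

lemma GG_inj {b : ℕ} (hb : 0 < b) (e : Fin b ≃ B) (U : B → ℝ) (h : ∀ j, ∑ k, GG e j k * U k = 0) :
    ∀ k, U k = 0 := by
  have h1 : ∀ k, k ≠ e ⟨0, hb⟩ → U k = 0 := by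
    intro k hk
    have hj : ((e.symm k : Fin b) : ℕ) ≠ 0 := by
      intro h0
      apply hk
      rw [← e.symm_apply_eq]
      exact Fin.ext h0
    have := h (e.symm k)
    simpa [GG, hj] using this
  intro k
  by_cases hk : k = e ⟨0, hb⟩
  · have := h ⟨0, hb⟩
    simp only [GG, if_true, one_mul] at this
    rw [Finset.sum_eq_single (e ⟨0, hb⟩) (fun k _ => h1 k) (by simp)] at this
    rw [hk, this]
  · exact h1 k hk

lemma GG_dir {b : ℕ} (hb : 0 < b) (e : Fin b ≃ B) (j t : Fin b) (ht : (t : ℕ) ≠ 0) :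
    ∑ k, GG e j k * ((if k = e t then 1 else 0) - (if k = e ⟨0, hb⟩ then 1 else 0)) =
      if j = t then 1 else 0 := by
  simp only [mul_sub, Finset.sum_sub_distrib, mul_ite, mul_one, mul_zero, Finset.sum_ite_eq',
    Finset.mem_univ, if_true]
  by_cases hj : (j : ℕ) = 0
  · have : j ≠ t := by rintro rfl; exact ht hj
    simp [GG, hj, this]
  · have : (⟨0, hb⟩ : Fin b) ≠ j := by rintro rfl; exact hj rfl
    simp [GG, hj, this, this.symm, eq_comm]

def LL {N : Fin 2 → ℕ} (eB : Fin (N 0) ≃ B) (eC : Fin (N 1) ≃ C) :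
    (B × C → ℝ) →ₗ[ℝ] ((∀ i, Fin (N i)) → ℝ) where
  toFun T idx := ∑ k, GG eB (idx 0) k * ∑ l, GG eC (idx 1) l * T (k, l)
  map_add' := by
    intro T T'
    ext idx
    simp [mul_add, Finset.sum_add_distrib]
  map_smul' := by
    intro a T
    ext idx
    simp only [Pi.smul_apply, smul_eq_mul, RingHom.id_apply, Finset.mul_sum]
    refine Finset.sum_congr rfl fun k _ => Finset.sum_congr rfl fun l _ => by ring

lemma LL_inj {N : Fin 2 → ℕ} (hN : ∀ i, 0 < N i) (eB : Fin (N 0) ≃ B) (eC : Fin (N 1) ≃ C) :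
    Function.Injective (LL eB eC) := by
  rw [← LinearMap.ker_eq_bot, LinearMap.ker_eq_bot']
  intro T hT
  have h1 : ∀ j' k, ∑ l, GG eC j' l * T (k, l) = 0 := by
    intro j'
    apply GG_inj (hN 0) eB
    intro j
    exact congrFun hT (Fin.cons j (Fin.cons j' (fun i => i.elim0)))
  ext ⟨k, l⟩
  exact GG_inj (hN 1) eC (fun l => T (k, l)) (fun j' => h1 j' k) l

lemma LL_mul {N : Fin 2 → ℕ} (eB : Fin (N 0) ≃ B) (eC : Fin (N 1) ≃ C) (T : B × C → ℝ)
    (f : B → ℝ) (g : C → ℝ) (h : ∀ k l, T (k, l) = f k * g l) (idx) :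
    LL eB eC T idx = (∑ k, GG eB (idx 0) k * f k) * (∑ l, GG eC (idx 1) l * g l) := by
  simp only [LL, LinearMap.coe_mk, AddHom.coe_mk, h, Finset.sum_mul, Finset.mul_sum]
  conv_rhs => rw [Finset.sum_comm]
  refine Finset.sum_congr rfl fun k _ => Finset.sum_congr rfl fun l _ => by ring

lemma ND_lambda_transfer {N : Fin 2 → ℕ} (hN : ∀ i, 0 < N i) (eB : Fin (N 0) ≃ B)
    (eC : Fin (N 1) ≃ C) (A R : Type) [Fintype R]
    (H : ND lh (lD (eB ⟨0, hN 0⟩) (eC ⟨0, hN 1⟩)) A R) : ND (tmh N) (tmD N) A R := by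
  let φ : (B ⊕ C → ℝ) → (Σ i, Fin (N i)) → ℝ := fun y p =>
    Fin.cases (motive := fun i => Fin (N i) → ℝ) (fun j => ∑ k, GG eB j k * y (Sum.inl k))
      (fun i => Fin.cases (motive := fun i => Fin (N i.succ) → ℝ)
        (fun j => ∑ l, GG eC j l * y (Sum.inr l)) (fun i => i.elim0) i) p.1 p.2
  have φ0 : ∀ y j, φ y ⟨0, j⟩ = ∑ k, GG eB j k * y (Sum.inl k) := fun _ _ => rfl
  have φ1 : ∀ y j, φ y ⟨1, j⟩ = ∑ l, GG eC j l * y (Sum.inr l) := fun _ _ => rfl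
  have hv : ∀ {n : ℕ} (hn : 0 < n) {E : Type} (e : Fin n ≃ E) (t : Fin n), 
      (t : ℕ) ≠ 0 ↔ e t ≠ e ⟨0, hn⟩ := by
    intro n hn E e t
    rw [Ne, Ne, e.apply_eq_iff_eq, Fin.ext_iff]
  let s1 : {j : Fin (N 0) // (j : ℕ) ≠ 0} ≃ {k : B // k ≠ eB ⟨0, hN 0⟩} :=
    eB.subtypeEquiv (fun t => hv (hN 0) eB t)
  let s2 : {j : Fin (N 1) // (j : ℕ) ≠ 0} ≃ {k : C // k ≠ eC ⟨0, hN 1⟩} :=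
    eC.subtypeEquiv (fun t => hv (hN 1) eC t)
  let e : ({j : Fin (N 0) // (j : ℕ) ≠ 0} ⊕ {j : Fin (N 1) // (j : ℕ) ≠ 0}) ≃
      (Σ i, {j : Fin (N i) // (j : ℕ) ≠ 0}) :=
    { toFun := Sum.elim (fun t => ⟨0, t⟩) (fun t => ⟨1, t⟩)
      invFun := fun p => Fin.cases (motive := fun i => {j : Fin (N i) // (j : ℕ) ≠ 0} →
          ({j : Fin (N 0) // (j : ℕ) ≠ 0} ⊕ {j : Fin (N 1) // (j : ℕ) ≠ 0})) Sum.inl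
        (fun i => Fin.cases (motive := fun i => {j : Fin (N i.succ) // (j : ℕ) ≠ 0} →
          ({j : Fin (N 0) // (j : ℕ) ≠ 0} ⊕ {j : Fin (N 1) // (j : ℕ) ≠ 0}))
          Sum.inr (fun i => i.elim0) i) p.1 p.2
      left_inv := by rintro (t | t) <;> rfl
      right_inv := by
        rintro ⟨i, t⟩
        fin_cases i <;> rfl }
  refine ND.transfer φ (e.symm.trans (Equiv.sumCongr s1 s2)) (LL eB eC) (LL_inj hN eB eC) ?_ ?_ H
  · intro y
    ext idx
    rw [LL_mul eB eC _ (fun k => y (Sum.inl k)) (fun l => y (Sum.inr l)) (fun k l => rfl)]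
    rw [tmh, Fin.prod_univ_two, φ0, φ1]
  · intro s y
    obtain ⟨s, rfl⟩ := e.surjective s
    ext idx
    rcases s with t | t
    · rw [LL_mul eB eC _ (fun k => (if k = eB t.1 then 1 else 0) -
        (if k = eB ⟨0, hN 0⟩ then 1 else 0)) (fun l => y (Sum.inr l)) (fun k l => by
          rw [Equiv.trans_apply, Equiv.symm_apply_apply]; rfl)]
      rw [GG_dir _ _ _ _ t.2, ← φ1]
      rw [show e (Sum.inl t) = ⟨0, t⟩ from rfl]
      simp [tmD, Fin.prod_univ_two]
    · rw [LL_mul eB eC _ (fun k => y (Sum.inl k)) (fun k => (if k = eC t.1 then 1 else 0) -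
        (if k = eC ⟨0, hN 1⟩ then 1 else 0)) (fun k l => by
          rw [Equiv.trans_apply, Equiv.symm_apply_apply]; rfl)]
      rw [GG_dir _ _ _ _ t.2, ← φ0]
      rw [show e (Sum.inr t) = ⟨1, t⟩ from rfl]
      simp [tmD, Fin.prod_univ_two]

lemma ND_base_even (N : Fin 2 → ℕ) (a' q b' c' : ℕ) (hb : N 0 = 2 * q + b') (hc : N 1 = 2 * q + c')
    (hN : ∀ i, 0 < N i) (hw : a' * (2 * q) ≤ b' * c' + (q * c' + b' * q)) :
    ND (tmh N) (tmD N) (Fin (a' + 1) × Fin 2) (Fin (a' + 1) × (Fin 2 × Fin q)) := by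
  have eB : Fin (N 0) ≃ (Fin 2 × Fin q) ⊕ Fin b' :=
    Fintype.equivOfCardEq (by simp [hb])
  have eC : Fin (N 1) ≃ (Fin 2 × Fin q) ⊕ Fin c' :=
    Fintype.equivOfCardEq (by simp [hc])
  apply ND_lambda_transfer hN eB eC
  apply glue
  · intro i
    exact (PolyFun.coord _).mul (PolyFun.coord _)
  · rintro (t | t) i
    · exact (PolyFun.const _).mul (PolyFun.coord _)
    · exact (PolyFun.coord _).mul (PolyFun.const _)
  · apply SP_base
    simpa using hw

end base

lemma base_arith (a b c : ℕ) (hab : b ≤ a) (hbc : c ≤ b) (q t1 t2 t3 : ℕ) (h1 : t1 ≤ a)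
    (ht2 : t2 = min b t1) (ht3 : t3 = min c t2) (hev : t1 % 2 = 0)
    (hq : q = t2 * t3 / (t1 + t2 + t3 - 2)) (hq0 : 0 < q) :
    ∃ a' b' c', t1 = 2 * (a' + 1) ∧ b = 2 * q + b' ∧ c = 2 * q + c' ∧
      a' * (2 * q) ≤ b' * c' + (q * c' + b' * q) := by
  have hle : q * (t1 + t2 + t3 - 2) ≤ t2 * t3 := by
    rw [hq]; exact Nat.div_mul_le_self _ _
  have h21 : t2 ≤ t1 := by rw [ht2]; exact min_le_right _ _
  have h2b : t2 ≤ b := by rw [ht2]; exact min_le_left _ _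
  have h32 : t3 ≤ t2 := by rw [ht3]; exact min_le_right _ _
  have h3c : t3 ≤ c := by rw [ht3]; exact min_le_left _ _
  clear ht2 ht3 
  have h3 : 0 < t3 := by
    rcases Nat.eq_zero_or_pos t3 with h | h
    · subst h; simp at hq; omega
    · exact h
  clear hq
  have h3' : 2 ≤ t3 := by
    by_contra hlt
    have : t3 = 1 := by omega
    subst this
    have : 2 ≤ t1 := by omega
    have : 1 * (t1 + t2 + 1 - 2) ≤ q * (t1 + t2 + 1 - 2) := Nat.mul_le_mul_right _ hq0
    omega
  have hq3 : 2 * q ≤ t3 := by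
    have : t2 * (2 * q) ≤ t2 * t3 := by
      refine le_trans ?_ hle
      have : q * (t2 + t2) ≤ q * (t1 + t2 + t3 - 2) := Nat.mul_le_mul_left _ (by omega)
      linarith
    exact Nat.le_of_mul_le_mul_left this (by omega)
  obtain ⟨a'', rfl⟩ : ∃ a'', t1 = 2 * a'' := ⟨t1 / 2, by omega⟩
  obtain ⟨a', rfl⟩ : ∃ a', a'' = a' + 1 := ⟨a'' - 1, by omega⟩
  obtain ⟨x, rfl⟩ : ∃ x, t2 = 2 * q + x := ⟨t2 - 2 * q, by omega⟩
  obtain ⟨z, rfl⟩ : ∃ z, t3 = 2 * q + z := ⟨t3 - 2 * q, by omega⟩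
  obtain ⟨b', rfl⟩ : ∃ b', b = 2 * q + x + b' := ⟨b - (2 * q + x), by omega⟩
  obtain ⟨c', rfl⟩ : ∃ c', c = 2 * q + z + c' := ⟨c - (2 * q + z), by omega⟩
  refine ⟨a', x + b', z + c', rfl, by ring, by ring, ?_⟩
  have e : 2 * (a' + 1) + (2 * q + x) + (2 * q + z) - 2 = 2 * a' + 4 * q + x + z := by omega
  rw [e] at hle
  have : a' * (2 * q) ≤ x * z + (q * z + x * q) := by nlinarith
  have h2 : x * z + (q * z + x * q) ≤
    (x + b') * (z + c') + (q * (z + c') + (x + b') * q) := by gcongr <;> omega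
  exact this.trans h2

lemma ND_base3 (N : Fin 2 → ℕ) (a : ℕ) (hab : N 0 ≤ a) (hbc : N 1 ≤ N 0) :
    ND (tmh N) (tmD N) (Fin a) (Fin (rankBound3 a (N 0) (N 1))) := by
  generalize hR : rankBound3 a (N 0) (N 1) = R
  unfold rankBound3 at hR
  simp only at hR
  have h1 : evenTrunc a ≤ a := by unfold evenTrunc; split_ifs <;> omega
  have hev : evenTrunc a % 2 = 0 := by unfold evenTrunc; split_ifs <;> omega
  generalize evenTrunc a = t1 at *
  generalize ht2 : min (N 0) t1 = t2 at *
  generalize ht3 : min (N 1) t2 = t3 at *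
  generalize hq : t2 * t3 / (t1 + t2 + t3 - 2) = q at *
  subst hR
  rcases Nat.eq_zero_or_pos q with h | hq0
  · subst h
    rw [mul_zero]; exact ND_empty _ _ _ _
  obtain ⟨a', b', c', ha, hb, hc, hw⟩ := base_arith a (N 0) (N 1) hab hbc q t1 t2 t3 h1 ht2.symm
    ht3.symm hev hq.symm hq0
  have hN : ∀ i, 0 < N i := by
    intro i
    fin_cases i
    · show 0 < N 0
      omega
    · show 0 < N 1
      omega
  have H := ND_base_even N a' q b' c' hb hc hN hw
  have e1 : Fin (a' + 1) × Fin 2 ↪ Fin a :=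
    (finProdFinEquiv.toEmbedding).trans (Fin.castLEEmb (by omega))
  have e2 : Fin (t1 * q) ≃ Fin (a' + 1) × (Fin 2 × Fin q) :=
    Fintype.equivOfCardEq (by simp [ha]; ring)
  exact (H.extend e1).reindex e2.toEmbedding

lemma prod_Icc_fin (N : ℕ → ℕ) (d k : ℕ) : ∏ i ∈ Finset.Icc d (d + k), N i =
    ∏ i : Fin (k + 1), N (d + i) := by
  rw [Fin.prod_univ_eq_prod_range (fun i => N (d + i)), ← Finset.Ico_add_one_right_eq_Icc,
    Finset.prod_Ico_eq_prod_range]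
  congr 2; omega

lemma sum_Icc_fin (N : ℕ → ℕ) (d k : ℕ) : ∑ i ∈ Finset.Icc d (d + k), N i =
    ∑ i : Fin (k + 1), N (d + i) := by
  rw [Fin.sum_univ_eq_sum_range (fun i => N (d + i)), ← Finset.Ico_add_one_right_eq_Icc,
    Finset.sum_Ico_eq_sum_range]
  congr 2; omega

lemma ND_congr {k : ℕ} {M M' : Fin k → ℕ} {a a' r : ℕ} (h : M = M') (ha : a = a')
    (H : ND (tmh M) (tmD M) (Fin a) (Fin r)) : ND (tmh M') (tmD M') (Fin a') (Fin r) := by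
  subst h ha
  exact H

lemma ND_main (m : ℕ) (N : ℕ → ℕ)
    (hmono : ∀ i j : ℕ, 1 ≤ i → i ≤ j → j ≤ m → N j ≤ N i) (k d : ℕ) (hm : m = d + k + 3) :
    ND (tmh (fun i : Fin (k + 2) => N (d + 2 + i))) (tmD (fun i : Fin (k + 2) => N (d + 2 + i)))
      (Fin (N (d + 1))) (Fin (rankBound N m (k + 3))) := by
  induction k generalizing d with
  | zero =>
    have := ND_base3 (fun i : Fin 2 => N (d + 2 + i)) (N (d + 1))
      (hmono _ _ (by omega) (by simp) (by simp; omega))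
      (hmono _ _ (by omega) (by simp) (by simp; omega))
    have e : rankBound N m (0 + 3) = rankBound3 (N (d + 1)) (N (d + 2 + ((0 : Fin 2) : ℕ)))
        (N (d + 2 + ((1 : Fin 2) : ℕ))) := by
      show rankBound3 (N (m - 2)) (N (m - 1)) (N m) = _
      subst hm
      rfl
    rw [e]
    exact this
  | succ k ih =>
    have IH := ih (d + 1) (by omega)
    have e : rankBound N m (k + 1 + 3) = N (d + 1) *
        min (rankBound N m (k + 3))
          ((∏ i : Fin (k + 3), N (d + 2 + i)) /
            ((N (d + 1) + ∑ i : Fin (k + 3), N (d + 2 + i)) - (k + 4) + 1)) := by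
      show N (m - (k + 4) + 1) *
        min (rankBound N m (k + 3))
          ((∏ i ∈ Finset.Icc (m - (k + 4) + 2) m, N i) /
            ((∑ i ∈ Finset.Icc (m - (k + 4) + 1) m, N i) - (k + 4) + 1)) = _
      have e1 : m - (k + 4) = d := by omega
      rw [e1, ← prod_Icc_fin N (d + 2) (k + 2), ← sum_Icc_fin N (d + 2) (k + 2)]
      have e2 : d + 2 + (k + 2) = m := by omega
      rw [e2]
      have e3 : Finset.Icc (d + 1) m = insert (d + 1) (Finset.Icc (d + 2) m) := by
        ext x; simp; omega
      rw [e3, Finset.sum_insert (by simp)]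
    rw [e]
    generalize hq : min (rankBound N m (k + 3))
          ((∏ i : Fin (k + 3), N (d + 2 + i)) /
            ((N (d + 1) + ∑ i : Fin (k + 3), N (d + 2 + i)) - (k + 4) + 1)) = q
    rcases Nat.eq_zero_or_pos q with h | hq0
    · subst h
      rw [mul_zero]; exact ND_empty _ _ _ _
    have hqr : q ≤ rankBound N m (k + 3) := by rw [← hq]; exact min_le_left _ _
    have hqd : q ≤ (∏ i : Fin (k + 3), N (d + 2 + i)) /
            ((N (d + 1) + ∑ i : Fin (k + 3), N (d + 2 + i)) - (k + 4) + 1) := by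
      rw [← hq]; exact min_le_right _ _
    have hpos : ∀ i : Fin (k + 3), 1 ≤ N (d + 2 + i) := by
      intro i
      by_contra h
      have : N (d + 2 + i) = 0 := by omega
      rw [Finset.prod_eq_zero (Finset.mem_univ i) this, Nat.zero_div] at hqd
      omega
    have hpos1 : 1 ≤ N (d + 1) :=
      (hpos 0).trans (hmono _ _ (by omega) (by simp) (by simp; omega))
    have hS : ∑ i : Fin (k + 3), (N (d + 2 + i) - 1) + (k + 3) =
        ∑ i : Fin (k + 3), N (d + 2 + i) := by
      have : ∑ i : Fin (k + 3), (N (d + 2 + i) - 1 + 1) = ∑ i : Fin (k + 3), N (d + 2 + i) :=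
        Finset.sum_congr rfl fun i _ => Nat.sub_add_cancel (hpos i)
      rw [← this, Finset.sum_add_distrib]
      simp
    have hc : q * (N (d + 1) + ∑ i : Fin (k + 3), (N (d + 2 + i) - 1)) ≤
        ∏ i : Fin (k + 3), N (d + 2 + i) := by
      refine le_trans ?_ (Nat.div_mul_le_self _
        ((N (d + 1) + ∑ i : Fin (k + 3), N (d + 2 + i)) - (k + 4) + 1))
      exact Nat.mul_le_mul hqd (by omega)
    refine ND_step (fun i : Fin (k + 3) => N (d + 2 + i)) (N (d + 1)) q _ hqr (hpos 0) hc ?_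
    have e4 : (fun i : Fin (k + 2) => N (d + 2 + (i.succ : ℕ))) =
        fun i : Fin (k + 2) => N (d + 1 + 2 + (i : ℕ)) := by
      funext i
      congr 1
      simp
      omega
    exact ND_congr e4.symm (by simp) IH


lemma posdef_quad {ι : Type*} [Fintype ι] (B : (ι → ℝ) →L[ℝ] (ι → ℝ) →L[ℝ] ℝ)
    (hB : ∀ v, v ≠ 0 → 0 < B v v) : ∃ μ : ℝ, 0 < μ ∧ ∀ v, μ * ∑ p, v p ^ 2 ≤ B v v := by
  have hsq : ∀ v : ι → ℝ, ‖v‖ ^ 2 ≤ ∑ p, v p ^ 2 := by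
    intro v
    have h0 : 0 ≤ ∑ p, v p ^ 2 := Finset.sum_nonneg fun p _ => sq_nonneg _
    have : ‖v‖ ≤ √(∑ p, v p ^ 2) := by
      rw [pi_norm_le_iff_of_nonneg (Real.sqrt_nonneg _)]
      intro i
      rw [Real.norm_eq_abs]
      exact Real.abs_le_sqrt (Finset.single_le_sum (f := fun p => v p ^ 2)
        (fun p _ => sq_nonneg _) (Finset.mem_univ i))
    calc ‖v‖ ^ 2 ≤ (√(∑ p, v p ^ 2)) ^ 2 := by gcongr
      _ = _ := Real.sq_sqrt h0
  let S : Set (ι → ℝ) := {v | ∑ p, v p ^ 2 = 1}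
  have hS : IsCompact S := by
    refine Metric.isCompact_of_isClosed_isBounded ?_ ?_
    · exact isClosed_eq (by fun_prop) continuous_const
    · refine (Metric.isBounded_closedBall (x := (0 : ι → ℝ)) (r := 1)).subset ?_
      intro v hv
      have := hsq v
      rw [show ∑ p, v p ^ 2 = 1 from hv] at this
      rw [mem_closedBall_zero_iff]
      nlinarith [norm_nonneg v]
  have key : ∃ μ : ℝ, 0 < μ ∧ ∀ v ∈ S, μ ≤ B v v := by
    rcases S.eq_empty_or_nonempty with h | h
    · exact ⟨1, one_pos, by simp [h]⟩
    · obtain ⟨v, hv, hmin⟩ := hS.exists_isMinOn h (f := fun v => B v v)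
        (Continuous.continuousOn (by fun_prop))
      refine ⟨B v v, hB v ?_, fun w hw => hmin hw⟩
      rintro rfl
      simp [S] at hv
  obtain ⟨μ, hμ, hk⟩ := key
  refine ⟨μ, hμ, fun v => ?_⟩
  have h0 : 0 ≤ ∑ p, v p ^ 2 := Finset.sum_nonneg fun p _ => sq_nonneg _
  rcases h0.eq_or_lt with h | h
  · have : v = 0 := by
      have := hsq v
      rw [← h] at this
      exact norm_eq_zero.1 (by nlinarith [norm_nonneg v])
    subst this
    simp
  · set s := ∑ p, v p ^ 2 with hs
    have hs0 : √s ≠ 0 := (Real.sqrt_pos.2 h).ne'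
    have hss : √s * √s = s := Real.mul_self_sqrt h0
    have h1 := hk ((√s)⁻¹ • v) (by
      show ∑ p, ((√s)⁻¹ • v) p ^ 2 = 1
      simp only [Pi.smul_apply, smul_eq_mul, mul_pow, ← Finset.mul_sum]
      rw [← hs, inv_pow, Real.sq_sqrt h0, inv_mul_cancel₀ h.ne'])
    simp only [map_smul, ContinuousLinearMap.smul_apply, smul_eq_mul] at h1
    rw [← mul_assoc, ← mul_inv, hss] at h1
    rw [inv_mul_eq_div, le_div_iff₀ h] at h1
    exact h1

set_option maxSynthPendingDepth 3 in
lemma bilin_near {E : Type*} [NormedAddCommGroup E] [NormedSpace ℝ E] (B : E → E →L[ℝ] E →L[ℝ] ℝ)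
    (hB : Continuous B) (xs : E) (ε : ℝ) (hε : 0 < ε) :
    ∃ O : Set E, IsOpen O ∧ xs ∈ O ∧ ∀ x ∈ O, ∀ v, B xs v v - ε * (‖v‖ * ‖v‖) ≤ B x v v := by
  refine ⟨{x | ‖B x - B xs‖ < ε}, isOpen_lt (by fun_prop) continuous_const, by simpa using hε, ?_⟩
  intro x hx v
  have h1 := (B x - B xs).le_opNorm₂ v v
  have h2 : ‖B x - B xs‖ * ‖v‖ * ‖v‖ ≤ ε * (‖v‖ * ‖v‖) := by
    rw [mul_assoc]
    exact mul_le_mul_of_nonneg_right (le_of_lt hx) (by positivity)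
  have h4 := (abs_le.1 (h1.trans h2)).1
  simp only [_root_.sub_apply] at h4
  linarith

lemma quad_open {ι : Type*} [Fintype ι] (f : (ι → ℝ) → ℝ) (hf : ContDiff ℝ 2 f) (xs : ι → ℝ)
    (hB : ∀ v, v ≠ 0 → 0 < iteratedFDeriv ℝ 2 f xs ![v, v]) :
    ∃ O : Set (ι → ℝ), IsOpen O ∧ xs ∈ O ∧ ∃ lam : ℝ, 0 < lam ∧ ∀ x ∈ O, ∀ v : ι → ℝ,
      lam * ∑ p, v p ^ 2 ≤ iteratedFDeriv ℝ 2 f x ![v, v] := by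
  simp only [iteratedFDeriv_two_apply, Matrix.cons_val_zero, Matrix.cons_val_one] at hB ⊢
  obtain ⟨μ, hμ, h⟩ := posdef_quad (fderiv ℝ (fderiv ℝ f) xs) hB
  have hc : Continuous (fderiv ℝ (fderiv ℝ f)) := by
    have h1 : ContDiff ℝ 1 (fderiv ℝ f) := hf.fderiv_right (by norm_num)
    exact h1.continuous_fderiv (by norm_num)
  have hsq : ∀ v : ι → ℝ, ‖v‖ * ‖v‖ ≤ ∑ p, v p ^ 2 := by
    intro v
    have h0 : 0 ≤ ∑ p, v p ^ 2 := Finset.sum_nonneg fun p _ => sq_nonneg _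
    have : ‖v‖ ≤ √(∑ p, v p ^ 2) := by
      rw [pi_norm_le_iff_of_nonneg (Real.sqrt_nonneg _)]
      intro i
      rw [Real.norm_eq_abs]
      exact Real.abs_le_sqrt (Finset.single_le_sum (f := fun p => v p ^ 2)
        (fun p _ => sq_nonneg _) (Finset.mem_univ i))
    calc ‖v‖ * ‖v‖ ≤ (√(∑ p, v p ^ 2)) * (√(∑ p, v p ^ 2)) := by gcongr
      _ = _ := Real.mul_self_sqrt h0
  obtain ⟨O, hO, hx, hb⟩ := bilin_near (E := ι → ℝ) (fderiv ℝ (fderiv ℝ f)) hc xs (μ / 2)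
    (by positivity)
  refine ⟨O, hO, hx, μ / 2, by positivity, fun x hx v => ?_⟩
  have h2 := hb x hx v
  have h3 := h v
  have h4 : μ / 2 * (‖v‖ * ‖v‖) ≤ μ / 2 * ∑ p, v p ^ 2 :=
    mul_le_mul_of_nonneg_left (hsq v) (by positivity)
  linarith

lemma hess_sq {K : Type*} [Fintype K] {ι : Type*} [Fintype ι] (F : K → (ι → ℝ) → ℝ)
    (hF : ∀ k, ContDiff ℝ 2 (F k)) (xs v : ι → ℝ) :
    iteratedFDeriv ℝ 2 (fun x => ∑ k, (F k xs - F k x) ^ 2) xs ![v, v] =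
      2 * ∑ k, (fderiv ℝ (F k) xs v) ^ 2 := by
  rw [iteratedFDeriv_two_apply]
  simp only [Matrix.cons_val_zero, Matrix.cons_val_one]
  have hd : ∀ k x, HasFDerivAt (F k) (fderiv ℝ (F k) x) x := fun k x =>
    ((hF k).differentiable (by norm_num) x).hasFDerivAt
  have h1 : fderiv ℝ (fun x => ∑ k, (F k xs - F k x) ^ 2) =
      fun x => ∑ k, (2 * (F k x - F k xs)) • fderiv ℝ (F k) x := by
    funext x
    have : HasFDerivAt (fun x => ∑ k, (F k xs - F k x) ^ 2)
      (∑ k, (2 * (F k x - F k xs)) • fderiv ℝ (F k) x) x := by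
      refine HasFDerivAt.fun_sum fun k _ => ?_
      have := (((hd k x).const_sub (F k xs)).pow 2)
      refine this.congr_fderiv ?_
      ext w
      simp
      ring
    exact this.fderiv
  rw [h1]
  have hd2 : ∀ k, HasFDerivAt (fderiv ℝ (F k)) (fderiv ℝ (fderiv ℝ (F k)) xs) xs := fun k =>
    (((hF k).fderiv_right (m := 1) (by norm_num)).differentiable (by norm_num) xs).hasFDerivAt
  have h2 : HasFDerivAt (fun x => ∑ k, (2 * (F k x - F k xs)) • fderiv ℝ (F k) x)
      (∑ k, ((2 * (F k xs - F k xs)) • fderiv ℝ (fderiv ℝ (F k)) xs +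
        ((2 : ℝ) • fderiv ℝ (F k) xs).smulRight (fderiv ℝ (F k) xs))) xs := by
    refine HasFDerivAt.fun_sum fun k _ => ?_
    exact ((((hd k xs).sub_const (F k xs)).const_mul 2)).smul (hd2 k)
  rw [h2.fderiv, Finset.mul_sum]
  simp
  refine Finset.sum_congr rfl fun k _ => ?_
  ring

lemma calc_main {K : Type*} [Fintype K] {ι : Type*} [Fintype ι] (F : K → (ι → ℝ) → ℝ)
    (hF : ∀ k, ContDiff ℝ 2 (F k)) (xs : ι → ℝ)
    (hinj : ∀ v, (∀ k, fderiv ℝ (F k) xs v = 0) → v = 0) :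
    (∀ v, v ≠ 0 → 0 < iteratedFDeriv ℝ 2 (fun x => ∑ k, (F k xs - F k x) ^ 2) xs ![v, v]) ∧
    ∃ O : Set (ι → ℝ), IsOpen O ∧ xs ∈ O ∧ ∃ lam : ℝ, 0 < lam ∧ ∀ x ∈ O, ∀ v : ι → ℝ,
      lam * ∑ p, v p ^ 2 ≤
        iteratedFDeriv ℝ 2 (fun x => ∑ k, (F k xs - F k x) ^ 2) x ![v, v] := by
  have h1 : ∀ v, v ≠ 0 →
      0 < iteratedFDeriv ℝ 2 (fun x => ∑ k, (F k xs - F k x) ^ 2) xs ![v, v] := by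
    intro v hv
    rw [hess_sq F hF]
    have h0 : 0 ≤ ∑ k, (fderiv ℝ (F k) xs v) ^ 2 := Finset.sum_nonneg fun _ _ => sq_nonneg _
    rcases h0.eq_or_lt with h | h
    · exfalso
      apply hv
      apply hinj
      intro k
      have := (Finset.sum_eq_zero_iff_of_nonneg (fun k _ => sq_nonneg _)).1 h.symm k
        (Finset.mem_univ k)
      exact pow_eq_zero_iff (two_ne_zero) |>.1 this
    · positivity
  refine ⟨h1, quad_open _ ?_ xs h1⟩
  exact ContDiff.sum fun k _ => (contDiff_const.sub (hF k)).pow 2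

def INJ {m r : ℕ} {N : Fin m → ℕ} (W : (i : Fin m) → Fin (N i) → Fin r → ℝ) : Prop :=
  ∀ V : (i : Fin m) → Fin (N i) → Fin r → ℝ,
    (∀ (i : Fin m) (j : Fin (N i)) (c : Fin r), (i : ℕ) ≠ 0 → (j : ℕ) = 0 → V i j c = 0) →
    (∀ idx : (i : Fin m) → Fin (N i),
      ∑ c, ∑ i, V i (idx i) c * ∏ l ∈ Finset.univ.erase i, W l (idx l) c = 0) → V = 0

lemma INJ_of_ND {k r : ℕ} {N : Fin (k + 1) → ℕ}
    (H : ND (tmh (fun i : Fin k => N i.succ)) (tmD (fun i : Fin k => N i.succ)) (Fin (N 0))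
      (Fin r)) : ∃ W : (i : Fin (k + 1)) → Fin (N i) → Fin r → ℝ, INJ W := by
  obtain ⟨x, y, H⟩ := H
  let W : (i : Fin (k + 1)) → Fin (N i) → Fin r → ℝ :=
    Fin.cases (motive := fun i => Fin (N i) → Fin r → ℝ) (fun j c => x c j)
      (fun i j c => y c ⟨i, j⟩)
  refine ⟨W, fun V hV h => ?_⟩
  obtain ⟨hβ, hγ⟩ := H (fun c j => V 0 j c) (fun c s => V s.1.succ s.2.1 c) (by
    intro a idx
    have h1 := h (Fin.cons a idx)
    rw [← h1]
    refine Finset.sum_congr rfl fun c _ => ?_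
    rw [Fin.sum_univ_succ]
    have e0 : ∏ l ∈ Finset.univ.erase (0 : Fin (k + 1)),
        W l ((Fin.cons a idx : (i : Fin (k + 1)) → Fin (N i)) l) c =
        tmh (fun i : Fin k => N i.succ) (y c) idx := by
      have : Finset.univ.erase (0 : Fin (k + 1)) = Finset.univ.image Fin.succ := by
        ext l
        refine Fin.cases ?_ (fun l => ?_) l <;> simp [Fin.succ_ne_zero]
      rw [this, Finset.prod_image (fun a _ b _ h => Fin.succ_injective _ h)]
      rfl
    have es : ∀ i : Fin k, ∏ l ∈ Finset.univ.erase i.succ,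
        W l ((Fin.cons a idx : (i : Fin (k + 1)) → Fin (N i)) l) c =
        x c a * ∏ l ∈ Finset.univ.erase i, y c ⟨l, idx l⟩ := by
      intro i
      have : Finset.univ.erase i.succ = insert 0 ((Finset.univ.erase i).image Fin.succ) := by
        ext l
        refine Fin.cases ?_ (fun l => ?_) l <;> simp [Fin.succ_ne_zero, (Fin.succ_ne_zero _).symm]
      rw [this, Finset.prod_insert (by simp [Fin.succ_ne_zero]),
        Finset.prod_image (fun a _ b _ h => Fin.succ_injective _ h)]
      rfl
    rw [e0]
    simp only [es, Fin.cons_zero, Fin.cons_succ]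
    congr 1
    rw [Fintype.sum_sigma, Finset.mul_sum]
    refine Finset.sum_congr rfl fun i _ => ?_
    have eD : ∀ t : {j : Fin (N i.succ) // (j : ℕ) ≠ 0},
        tmD (fun i : Fin k => N i.succ) ⟨i, t⟩ (y c) idx =
          (if idx i = t.1 then 1 else 0) * ∏ l ∈ Finset.univ.erase i, y c ⟨l, idx l⟩ := by
      intro t
      unfold tmD
      rw [← Finset.mul_prod_erase _ _ (Finset.mem_univ i), if_pos rfl]
      congr 1
      exact Finset.prod_congr rfl fun l hl => if_neg (Finset.ne_of_mem_erase hl)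
    simp only [eD]
    by_cases hj : (idx i : ℕ) = 0
    · rw [hV i.succ (idx i) c (by simp) hj, zero_mul, Finset.sum_eq_zero, mul_zero]
      rintro t -
      rw [if_neg, zero_mul, mul_zero]
      intro h
      exact t.2 (h ▸ hj)
    · rw [Finset.sum_eq_single ⟨idx i, hj⟩]
      · simp only [if_true]
        ring
      · rintro ⟨b, hb⟩ - hne
        rw [if_neg (fun h => hne (by simp [h])), zero_mul, mul_zero]
      · simp)
  funext i j c
  revert j
  refine Fin.cases ?_ (fun i => ?_) i
  · intro j
    exact congrFun (congrFun hβ c) j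
  · intro j
    by_cases hj : (j : ℕ) = 0
    · exact hV _ _ _ (by simp) hj
    · exact congrFun (congrFun hγ c) ⟨i, ⟨j, hj⟩⟩

lemma INJ.ne_zero {k r : ℕ} {N : Fin (k + 1) → ℕ} {W : (i : Fin (k + 1)) → Fin (N i) → Fin r → ℝ}
    (H : INJ W) (hN : ∀ i, N i ≤ N 0) (i : Fin (k + 1)) (hi : i ≠ 0) (j : Fin (N i))
    (hj : (j : ℕ) = 0) (c : Fin r) : W i j c ≠ 0 := by
  intro h0
  have hi' : (0 : Fin (k + 1)) ≠ i := fun h => hi h.symm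
  have h1 := H (fun l j' c' => if c' = c then (if l = 0 then - W l j' c' else
      if l = i then W l j' c' else 0) else 0) (by
    intro l j' c' hl hj'
    have hl0 : l ≠ 0 := fun h => hl (by simp [h])
    simp only [hl0, if_false]
    split_ifs with h2 h3
    · subst h2 h3
      rw [show j' = j from Fin.ext (by omega), h0]
    · rfl
    · rfl) (by
    intro idx
    refine Finset.sum_eq_zero fun c' _ => ?_
    by_cases hc : c' = c
    · simp only [hc, if_true]
      rw [← Finset.add_sum_erase _ _ (Finset.mem_univ 0), if_pos rfl,
        ← Finset.add_sum_erase _ _ (Finset.mem_erase.2 ⟨hi, Finset.mem_univ i⟩),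
        if_neg hi, if_pos rfl, Finset.mul_prod_erase _ (fun l => W l (idx l) c)
        (Finset.mem_univ i), neg_mul, Finset.mul_prod_erase _ (fun l => W l (idx l) c)
        (Finset.mem_univ 0), neg_add_cancel_left]
      refine Finset.sum_eq_zero fun l hl => ?_
      simp only [Finset.mem_erase] at hl
      rw [if_neg hl.2.1, if_neg hl.1, zero_mul]
    · simp [hc])
  have hW : ∀ j', W i j' c = 0 := by
    intro j'
    have := congrFun (congrFun (congrFun h1 i) j') c
    simpa [hi] using this
  have h2 := H (fun l _ c' => if c' = c ∧ l = 0 then 1 else 0) (by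
    intro l j' c' hl _
    rw [if_neg]
    rintro ⟨-, rfl⟩
    simp at hl) (by
    intro idx
    refine Finset.sum_eq_zero fun c' _ => Finset.sum_eq_zero fun l _ => ?_
    by_cases hl : c' = c ∧ l = 0
    · obtain ⟨rfl, rfl⟩ := hl
      rw [Finset.prod_eq_zero (Finset.mem_erase.2 ⟨hi, Finset.mem_univ i⟩) (hW _), mul_zero]
    · rw [if_neg hl, zero_mul])
  have hpos : 0 < N 0 := lt_of_lt_of_le (by have := j.2; omega) (hN i)
  have := congrFun (congrFun (congrFun h2 0) ⟨0, hpos⟩) c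
  simp at this

lemma INJ.scale {m r : ℕ} {N : Fin m → ℕ} {W : (i : Fin m) → Fin (N i) → Fin r → ℝ}
    (H : INJ W) (σ : Fin m → Fin r → ℝ) (hσ : ∀ i c, σ i c ≠ 0) :
    INJ (fun i j c => σ i c * W i j c) := by
  intro V hV h
  have h1 := H (fun i j c => V i j c * ∏ l ∈ Finset.univ.erase i, σ l c) (by
    intro i j c hi hj
    rw [hV i j c hi hj, zero_mul]) (by
    intro idx
    rw [← h idx]
    refine Finset.sum_congr rfl fun c _ => Finset.sum_congr rfl fun i _ => ?_
    rw [Finset.prod_mul_distrib, mul_assoc])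
  funext i j c
  have := congrFun (congrFun (congrFun h1 i) j) c
  simp only [Pi.zero_apply] at this
  rcases mul_eq_zero.1 this with h | h
  · exact h
  · exact absurd h (Finset.prod_ne_zero_iff.2 fun l _ => hσ l c)

lemma exists_INJ_emb {k r : ℕ} {N : Fin (k + 1) → ℕ}
    (H : ND (tmh (fun i : Fin k => N i.succ)) (tmD (fun i : Fin k => N i.succ)) (Fin (N 0))
      (Fin r)) (hN : ∀ i, N i ≤ N 0) (u : Fin (k + 1) → Fin r → ℝ)
    (hu : ∀ i : Fin (k + 1), (i : ℕ) ≠ 0 → ∀ c : Fin r, u i c ≠ 0) :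
    ∃ x : FreeIdx (k + 1) r N → ℝ, INJ (embTheta u x) := by
  obtain ⟨W, hW⟩ := INJ_of_ND H
  let σ : Fin (k + 1) → Fin r → ℝ := fun i c =>
    if i = 0 then 1 else if h : 0 < N i then u i c / W i ⟨0, h⟩ c else 1
  have hσ : ∀ i c, σ i c ≠ 0 := by
    intro i c
    simp only [σ]
    split_ifs with h1 h2
    · exact one_ne_zero
    · exact div_ne_zero (hu i (fun h => h1 (Fin.ext h)) c) (hW.ne_zero hN i h1 _ rfl c)
    · exact one_ne_zero
  have h := hW.scale σ hσ
  refine ⟨fun p => σ p.1.1 p.1.2.2 * W p.1.1 p.1.2.1 p.1.2.2, ?_⟩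
  convert h using 1
  funext i j c
  unfold embTheta
  split_ifs with h1
  · rfl
  · push Not at h1
    have hi : i ≠ 0 := fun h => h1.1 (by simp [h])
    have hp : 0 < N i := by have := j.2; omega
    have ej : j = ⟨0, hp⟩ := Fin.ext h1.2
    simp only [σ, if_neg hi, dif_pos hp, ej]
    rw [div_mul_cancel₀ _ (hW.ne_zero hN i hi _ rfl c)]

def JAC {m r : ℕ} {N : Fin m → ℕ} (u : Fin m → Fin r → ℝ) (x v : FreeIdx m r N → ℝ)
    (idx : (i : Fin m) → Fin (N i)) : ℝ :=
  ∑ c, ∑ i, embTheta (fun _ _ => 0) v i (idx i) c *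
    ∏ l ∈ Finset.univ.erase i, embTheta u x l (idx l) c

lemma INJ.jac {m r : ℕ} {N : Fin m → ℕ} {u : Fin m → Fin r → ℝ} {x : FreeIdx m r N → ℝ}
    (H : INJ (embTheta u x)) (v : FreeIdx m r N → ℝ) (h : ∀ idx, JAC u x v idx = 0) : v = 0 := by
  have h1 := H (embTheta (fun _ _ => 0) v) (by
    intro i j c hi hj
    unfold embTheta
    rw [dif_neg]
    tauto) h
  funext p
  obtain ⟨⟨i, j, c⟩, hp⟩ := p
  have := congrFun (congrFun (congrFun h1 i) j) c
  unfold embTheta at this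
  rw [dif_pos hp] at this
  exact this

lemma emb_lin {m r : ℕ} {N : Fin m → ℕ} (v : FreeIdx m r N → ℝ) (i j c) :
    embTheta (fun _ _ => 0) v i j c =
      ∑ p, v p * embTheta (fun _ _ => 0) (Pi.single p 1) i j c := by
  unfold embTheta
  split_ifs with h
  · simp [Pi.single_apply]
  · simp

lemma JAC_lin {m r : ℕ} {N : Fin m → ℕ} (u : Fin m → Fin r → ℝ) (x v : FreeIdx m r N → ℝ)
    (idx : (i : Fin m) → Fin (N i)) :
    JAC u x v idx = ∑ p, v p * JAC u x (Pi.single p 1) idx := by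
  unfold JAC
  simp_rw [Finset.mul_sum]
  symm
  rw [Finset.sum_comm]
  refine Finset.sum_congr rfl fun c _ => ?_
  rw [Finset.sum_comm]
  refine Finset.sum_congr rfl fun i _ => ?_
  rw [emb_lin v, Finset.sum_mul]
  exact Finset.sum_congr rfl fun p _ => (mul_assoc _ _ _).symm

lemma emb_poly {m r : ℕ} {N : Fin m → ℕ} (u : Fin m → Fin r → ℝ) (i j c) :
    PolyFun (fun x : FreeIdx m r N → ℝ => embTheta u x i j c) := by
  unfold embTheta
  split_ifs with h
  · exact PolyFun.coord _
  · exact PolyFun.const _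

lemma JAC_poly {m r : ℕ} {N : Fin m → ℕ} (u : Fin m → Fin r → ℝ) (v : FreeIdx m r N → ℝ)
    (idx : (i : Fin m) → Fin (N i)) : PolyFun (fun x => JAC u x v idx) :=
  PolyFun.sum _ fun _ => PolyFun.sum _ fun _ => PolyFun.mul (PolyFun.const _)
    (PolyFun.prod _ fun _ => emb_poly _ _ _ _)

def embCLM {m r : ℕ} (N : Fin m → ℕ) (i : Fin m) (j : Fin (N i)) (c : Fin r) :
    (FreeIdx m r N → ℝ) →L[ℝ] ℝ :=
  if h : (i : ℕ) = 0 ∨ ((j : ℕ) ≠ 0) then ContinuousLinearMap.proj ⟨⟨i, (j, c)⟩, h⟩ else 0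

lemma embCLM_apply {m r : ℕ} (N : Fin m → ℕ) (i : Fin m) (j : Fin (N i)) (c : Fin r) (v) :
    embCLM N i j c v = embTheta (fun _ _ => 0) v i j c := by
  unfold embCLM embTheta
  split_ifs <;> rfl

lemma emb_hasFDerivAt {m r : ℕ} {N : Fin m → ℕ} (u : Fin m → Fin r → ℝ) (i j c)
    (x : FreeIdx m r N → ℝ) : HasFDerivAt (fun x => embTheta u x i j c) (embCLM N i j c) x := by
  unfold embTheta embCLM
  split_ifs with h
  · exact (ContinuousLinearMap.proj (R := ℝ) (φ := fun _ : FreeIdx m r N => ℝ)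
      ⟨⟨i, (j, c)⟩, h⟩).hasFDerivAt
  · exact hasFDerivAt_const _ _

lemma cp_fderiv {m r : ℕ} {N : Fin m → ℕ} (u : Fin m → Fin r → ℝ) (x v : FreeIdx m r N → ℝ)
    (idx : (i : Fin m) → Fin (N i)) :
    fderiv ℝ (fun x => cpEntry (embTheta u x) idx) x v = JAC u x v idx := by
  have h : HasFDerivAt (fun x => cpEntry (embTheta u x) idx)
      (∑ c, ∑ i, (∏ l ∈ Finset.univ.erase i, embTheta u x l (idx l) c) • embCLM N i (idx i) c)
      x := by
    unfold cpEntry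
    refine HasFDerivAt.fun_sum fun c _ => ?_
    exact HasFDerivAt.finsetProd fun i _ => emb_hasFDerivAt u i (idx i) c x
  rw [h.fderiv]
  simp [JAC, embCLM_apply, mul_comm]

lemma cp_contDiff {m r : ℕ} {N : Fin m → ℕ} (u : Fin m → Fin r → ℝ)
    (idx : (i : Fin m) → Fin (N i)) :
    ContDiff ℝ 2 (fun x : FreeIdx m r N → ℝ => cpEntry (embTheta u x) idx) := by
  unfold cpEntry
  refine ContDiff.sum fun c _ => contDiff_prod fun i _ => ?_
  unfold embTheta
  split_ifs with h
  · exact contDiff_apply ℝ ℝ _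
  · exact contDiff_const

lemma main_aux (k r : ℕ) (N : Fin (k + 1) → ℕ)
    (H : ND (tmh (fun i : Fin k => N i.succ)) (tmD (fun i : Fin k => N i.succ)) (Fin (N 0))
      (Fin r)) (hN : ∀ i, N i ≤ N 0) (u : Fin (k + 1) → Fin r → ℝ)
    (hu : ∀ i : Fin (k + 1), (i : ℕ) ≠ 0 → ∀ c : Fin r, u i c ≠ 0) :
    ∃ P : MvPolynomial (FreeIdx (k + 1) r N) ℝ, P ≠ 0 ∧
      ∀ xs : FreeIdx (k + 1) r N → ℝ, MvPolynomial.eval xs P ≠ 0 →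
        (∀ v, (∀ idx, fderiv ℝ (fun x => cpEntry (embTheta u x) idx) xs v = 0) → v = 0) := by
  obtain ⟨x0, hx0⟩ := exists_INJ_emb H hN u hu
  obtain ⟨P, hP⟩ := open_inj
    (fun (idx : (i : Fin (k + 1)) → Fin (N i)) (p : FreeIdx (k + 1) r N) x =>
      JAC u x (Pi.single p 1) idx) (fun idx p => JAC_poly u _ idx)
  simp only [← JAC_lin] at hP
  refine ⟨P, ?_, fun xs hxs v hv => ?_⟩
  · rintro rfl
    exact (hP x0).2 (fun v hv => hx0.jac v hv) (by simp)
  · refine (hP xs).1 hxs v fun idx => ?_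
    rw [← cp_fderiv]
    exact hv idx

/-- Let `N 1 ≥ ⋯ ≥ N m` (`m ≥ 3`), `r ≤ r_m`, and let `u₂,…,u_m ∈ ℝ^r` have
all entries nonzero.  For normalized parameters `Θ̃* = (U₁*, Ũ₂*, …, Ũ_m*)` set
`A = [[U₁*, [u₂ᵀ;Ũ₂*], …, [u_mᵀ;Ũ_m*]]]` and
`f̃_A(Θ̃) = ‖A − [[U₁, [u₂ᵀ;Ũ₂], …, [u_mᵀ;Ũ_m]]]‖_F²`.  Then for generic `Θ̃*` the Hessian
`∇²f̃_A(Θ̃*)` is positive definite and there exist an open set `O ∋ Θ̃*` and `λ > 0` such that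
`f̃_A` is `λ`-strongly convex on `O` (smallest Hessian eigenvalue `≥ λ` throughout `O`). -/
theorem cp_arbitrary_normalization_hessian_posdef_generic
    (m r : ℕ) (hm : 3 ≤ m) (N : ℕ → ℕ)
    (hmono : ∀ i j : ℕ, 1 ≤ i → i ≤ j → j ≤ m → N j ≤ N i)
    (hr : r ≤ rankBound N m m)
    (u : Fin m → Fin r → ℝ) (hu : ∀ i : Fin m, (i : ℕ) ≠ 0 → ∀ c : Fin r, u i c ≠ 0) :
    ∃ P : MvPolynomial (FreeIdx m r fun i => N ((i : ℕ) + 1)) ℝ, P ≠ 0 ∧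
      ∀ xstar : FreeIdx m r (fun i => N ((i : ℕ) + 1)) → ℝ,
        MvPolynomial.eval xstar P ≠ 0 →
        (∀ v : FreeIdx m r (fun i => N ((i : ℕ) + 1)) → ℝ, v ≠ 0 →
          0 < iteratedFDeriv ℝ 2
              (fun x : FreeIdx m r (fun i => N ((i : ℕ) + 1)) → ℝ =>
                ∑ idx : (i : Fin m) → Fin (N ((i : ℕ) + 1)),
                  (cpEntry (embTheta u xstar) idx - cpEntry (embTheta u x) idx) ^ 2)
              xstar ![v, v]) ∧
        (∃ O : Set (FreeIdx m r (fun i => N ((i : ℕ) + 1)) → ℝ), IsOpen O ∧ xstar ∈ O ∧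
          ∃ lam : ℝ, 0 < lam ∧
            ∀ x ∈ O, ∀ v : FreeIdx m r (fun i => N ((i : ℕ) + 1)) → ℝ,
              lam * ∑ p, v p ^ 2 ≤
                iteratedFDeriv ℝ 2
                  (fun x' : FreeIdx m r (fun i => N ((i : ℕ) + 1)) → ℝ =>
                    ∑ idx : (i : Fin m) → Fin (N ((i : ℕ) + 1)),
                      (cpEntry (embTheta u xstar) idx - cpEntry (embTheta u x') idx) ^ 2)
                  x ![v, v]) := by
  obtain ⟨k, rfl⟩ : ∃ k, m = k + 2 + 1 := ⟨m - 3, by omega⟩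
  have H0 := (ND_main (k + 2 + 1) N hmono k 0 (by omega)).reindex (Fin.castLEEmb hr)
  have H : ND (tmh (fun i : Fin (k + 2) => N ((i.succ : ℕ) + 1)))
      (tmD (fun i : Fin (k + 2) => N ((i.succ : ℕ) + 1)))
      (Fin (N (((0 : Fin (k + 2 + 1)) : ℕ) + 1))) (Fin r) := by
    refine ND_congr ?_ ?_ H0
    · funext i
      congr 1
      simp
      omega
    · simp
  obtain ⟨P, hP0, hP⟩ := main_aux (k + 2) r (fun i => N ((i : ℕ) + 1)) H
    (fun i => hmono _ _ (by simp) (by simp) (by omega)) u hu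
  refine ⟨P, hP0, fun xs hxs => ?_⟩
  exact calc_main (fun idx x => cpEntry (embTheta u x) idx) (fun idx => cp_contDiff u idx) xs
    (hP xs hxs)
end
end
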